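/- arXiv:1609.00976 — 2 statements merged into one kernel-verified Lean document; each statement's English description precedes it below -/
import Mathlib

section
/- Let p, q ≥ 2 be even integers with (p,q) ≠ (2,2), let f(x,y) = x^p + y^q + 1, and let φ : ℝ² → ℝ satisfy the standard assumptions with φ(0,0) = 1. Set β = −1/p − 1/q and d = 2/(1−β). Then for τ₀ sufficiently large the curve C = {(Re I(τ), Im I(τ)) : τ ≥ τ₀} has box dimension d and its d-dimensional Minkowski content equals M^d(C) = [4 Γ(1/p + 1) Γ(1/q + 1)]^{2/(1−β)} · (−β)^{2β/(1−β)} · π^{(1+β)/(1−β)} · (1−β)/(1+β), where Γ denotes the Euler gamma function. -/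
open MeasureTheory Filter Metric Set Topology ENNReal

noncomputable section

/-- The Euclidean plane `ℝ²`. -/
abbrev E2 := EuclideanSpace ℝ (Fin 2)

/-- The point of the Euclidean plane with coordinates `a`, `b`. -/
def pt (a b : ℝ) : E2 := (WithLp.equiv 2 (Fin 2 → ℝ)).symm ![a, b]

/-- The lower `s`-dimensional Minkowski content of `A ⊆ ℝ²`:
`liminf_{ε→0⁺} |A_ε| / ε^(2-s)`, where `A_ε` is the open `ε`-neighbourhood of `A`. -/
def lowerMink (s : ℝ) (A : Set E2) : ℝ≥0∞ :=
  Filter.liminf (fun ε : ℝ => volume (Metric.thickening ε A) / ENNReal.ofReal (ε ^ (2 - s)))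
    (𝓝[>] (0:ℝ))

/-- The upper `s`-dimensional Minkowski content of `A ⊆ ℝ²`. -/
def upperMink (s : ℝ) (A : Set E2) : ℝ≥0∞ :=
  Filter.limsup (fun ε : ℝ => volume (Metric.thickening ε A) / ENNReal.ofReal (ε ^ (2 - s)))
    (𝓝[>] (0:ℝ))

/-- The lower box dimension of `A ⊆ ℝ²`. -/
def lowerDimB (A : Set E2) : ℝ := sInf {s : ℝ | 0 ≤ s ∧ lowerMink s A = 0}

/-- The upper box dimension of `A ⊆ ℝ²`. -/
def upperDimB (A : Set E2) : ℝ := sInf {s : ℝ | 0 ≤ s ∧ upperMink s A = 0}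

/-- The box dimension of `A` exists and equals `d`. -/
def dimBEq (A : Set E2) (d : ℝ) : Prop := lowerDimB A = d ∧ upperDimB A = d

/-- `A` is Minkowski nondegenerate for the dimension `d`:
`0 < M_*^d(A) ≤ M^{*d}(A) < ∞`. -/
def minkNondeg (A : Set E2) (d : ℝ) : Prop := 0 < lowerMink d A ∧ upperMink d A < ⊤

/-- `A` is Minkowski measurable with `d`-dimensional Minkowski content the value `v ∈ (0,∞)`. -/
def minkMeasurableWith (A : Set E2) (d v : ℝ) : Prop :=
  0 < v ∧ lowerMink d A = ENNReal.ofReal v ∧ upperMink d A = ENNReal.ofReal v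

/-- The graph of `g` over `S ⊆ ℝ`, as a subset of the plane. -/
def graphOn (g : ℝ → ℝ) (S : Set ℝ) : Set E2 := (fun t => pt t (g t)) '' S

/-- The curve `τ ↦ (X τ, Y τ)`, `τ ≥ τ₀`, as a subset of the plane. -/
def curveFrom (X Y : ℝ → ℝ) (τ₀ : ℝ) : Set E2 := (fun τ => pt (X τ) (Y τ)) '' Set.Ici τ₀

/-- The radial `ε`-neighbourhood of `A ⊆ ℝ²`: the set of points `y` whose distance to
`A ∩ {t • y : t ≥ 0}` is `< ε`. -/
def rayNbhd (ε : ℝ) (A : Set E2) : Set E2 :=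
  {y | ∃ z ∈ A, (∃ t : ℝ, 0 ≤ t ∧ z = t • y) ∧ dist y z < ε}

/-- The radial lower `s`-dimensional Minkowski content. -/
def radLowerMink (s : ℝ) (A : Set E2) : ℝ≥0∞ :=
  Filter.liminf (fun ε : ℝ => volume (rayNbhd ε A) / ENNReal.ofReal (ε ^ (2 - s))) (𝓝[>] (0:ℝ))

/-- The radial upper `s`-dimensional Minkowski content. -/
def radUpperMink (s : ℝ) (A : Set E2) : ℝ≥0∞ :=
  Filter.limsup (fun ε : ℝ => volume (rayNbhd ε A) / ENNReal.ofReal (ε ^ (2 - s))) (𝓝[>] (0:ℝ))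

/-- The radial lower box dimension. -/
def radLowerDimB (A : Set E2) : ℝ := sInf {s : ℝ | 0 ≤ s ∧ radLowerMink s A = 0}

/-- The radial upper box dimension. -/
def radUpperDimB (A : Set E2) : ℝ := sInf {s : ℝ | 0 ≤ s ∧ radUpperMink s A = 0}

/-- The radial box dimension of `A` exists and equals `d`. -/
def radDimBEq (A : Set E2) (d : ℝ) : Prop := radLowerDimB A = d ∧ radUpperDimB A = d

/-- The spiral `r = f(φ)` in polar coordinates, over the set of angles `S`. -/
def spiralArc (f : ℝ → ℝ) (S : Set ℝ) : Set E2 :=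
  (fun φ => pt (f φ * Real.cos φ) (f φ * Real.sin φ)) '' S

/-- `u(x) ≃₁ v(x)` as `x → 0⁺`: `u/v → 1` and `u'/v' → 1` as `x → 0⁺`. -/
def asympOneZero (u v : ℝ → ℝ) : Prop :=
  Tendsto (fun x => u x / v x) (𝓝[>] (0:ℝ)) (𝓝 1) ∧
  Tendsto (fun x => deriv u x / deriv v x) (𝓝[>] (0:ℝ)) (𝓝 1)


/-! ### Part A: asymptotics of the oscillatory integral -/

/-- The phase function on `ℝ × ℝ`. -/
def FF (p q : ℕ) (z : ℝ × ℝ) : ℝ := z.1 ^ p + z.2 ^ q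

lemma FF_nonneg {p q : ℕ} (hp : Even p) (hq : Even q) (z : ℝ × ℝ) : 0 ≤ FF p q z :=
  add_nonneg (hp.pow_nonneg _) (hq.pow_nonneg _)

lemma FF_continuous (p q : ℕ) : Continuous (FF p q) := by
  unfold FF; fun_prop

lemma one_dim_integrable {p : ℕ} (hp : Even p) {a : ℝ} (ha : 0 < a)
    (h : 1 < p * a) : Integrable (fun x : ℝ => (1 + x ^ p) ^ (-a)) := by
  have h1 : Integrable (fun x : ℝ => (2:ℝ) ^ (p * a) * (1 + ‖x‖) ^ (-(p * a))) := by
    refine (integrable_one_add_norm ?_).const_mul _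
    simpa using h
  refine h1.mono' ?_ ?_
  · refine Continuous.aestronglyMeasurable ?_
    refine Continuous.rpow_const (by fun_prop) (fun x => Or.inl ?_)
    have := hp.pow_nonneg x
    positivity
  · refine Eventually.of_forall (fun x => ?_)
    have hx : 0 ≤ x ^ p := hp.pow_nonneg x
    have e1 : x ^ p = ‖x‖ ^ p := by rw [Real.norm_eq_abs, hp.pow_abs]
    have hpos : 0 < 1 + ‖x‖ := by positivity
    rw [Real.norm_of_nonneg (by positivity)]
    have key : (1 + ‖x‖) ^ p ≤ 2 ^ p * (1 + x ^ p) := by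
      rw [e1]
      have hm : 1 + ‖x‖ ≤ 2 * max 1 ‖x‖ := by
        have := le_max_left 1 ‖x‖
        have := le_max_right 1 ‖x‖
        linarith
      calc (1 + ‖x‖) ^ p ≤ (2 * max 1 ‖x‖) ^ p := by gcongr
        _ = 2 ^ p * (max 1 ‖x‖) ^ p := by rw [mul_pow]
        _ ≤ 2 ^ p * (1 + ‖x‖ ^ p) := by
          gcongr
          rcases le_total 1 ‖x‖ with h | h
          · rw [max_eq_right h]; linarith
          · rw [max_eq_left h]
            simp
    have k2 : ((1 + ‖x‖) ^ p : ℝ) ^ a ≤ (2 ^ p * (1 + x ^ p)) ^ a :=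
      Real.rpow_le_rpow (by positivity) key ha.le
    rw [Real.mul_rpow (by positivity) (by positivity), ← Real.rpow_natCast, ← Real.rpow_natCast,
      ← Real.rpow_mul hpos.le, ← Real.rpow_mul (by norm_num)] at k2
    rw [Real.rpow_neg (by positivity), Real.rpow_neg (by positivity)]
    rw [← div_eq_mul_inv, le_div_iff₀ (by positivity), inv_mul_le_iff₀ (by positivity)]
    linarith

lemma FF_integrable {p q : ℕ} (hp2 : 2 ≤ p) (hq2 : 2 ≤ q) (hp : Even p) (hq : Even q)
    (hα : 1 / (p:ℝ) + 1 / (q:ℝ) < 1) :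
    Integrable (fun z : ℝ × ℝ => (1 + FF p q z)⁻¹) := by
  set α : ℝ := 1 / (p:ℝ) + 1 / (q:ℝ) with hαd
  have hp0 : (0:ℝ) < p := by exact_mod_cast (by omega : 0 < p)
  have hq0 : (0:ℝ) < q := by exact_mod_cast (by omega : 0 < q)
  have hα0 : 0 < α := by positivity
  have h1 := one_dim_integrable hp (a := 1 / p / α) (by positivity) (by
    have : (p:ℝ) * (1 / p / α) = 1 / α := by field_simp
    rw [this, lt_div_iff₀ hα0]; linarith)
  have h2 := one_dim_integrable hq (a := 1 / q / α) (by positivity) (by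
    have : (q:ℝ) * (1 / q / α) = 1 / α := by field_simp
    rw [this, lt_div_iff₀ hα0]; linarith)
  have h3 := h1.mul_prod h2
  refine h3.mono' ?_ ?_
  · refine Continuous.aestronglyMeasurable ?_
    refine Continuous.inv₀ (continuous_const.add (FF_continuous p q)) (fun z => ?_)
    have := FF_nonneg hp hq z
    positivity
  · refine Eventually.of_forall (fun z => ?_)
    have hz := FF_nonneg hp hq z
    have hx : 0 ≤ z.1 ^ p := hp.pow_nonneg _
    have hy : 0 ≤ z.2 ^ q := hq.pow_nonneg _
    rw [Real.norm_of_nonneg (by positivity), Real.rpow_neg (by positivity),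
      Real.rpow_neg (by positivity), ← mul_inv]
    refine inv_anti₀ (by positivity) ?_
    calc (1 + z.1 ^ p) ^ (1 / p / α) * (1 + z.2 ^ q) ^ (1 / q / α)
        ≤ (1 + FF p q z) ^ (1 / p / α) * (1 + FF p q z) ^ (1 / q / α) := by
          unfold FF
          gcongr <;> linarith
      _ = (1 + FF p q z) ^ (1 : ℝ) := by
          rw [← Real.rpow_add (by positivity)]
          congr 1
          rw [← add_div, ← hαd, div_self hα0.ne']
      _ = _ := Real.rpow_one _

lemma FF_hasFDerivAt (p q : ℕ) (z : ℝ × ℝ) : HasFDerivAt (FF p q)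
    ((p * z.1 ^ (p-1)) • ContinuousLinearMap.fst ℝ ℝ ℝ +
      (q * z.2 ^ (q-1)) • ContinuousLinearMap.snd ℝ ℝ ℝ) z := by
  unfold FF
  have h1 : HasFDerivAt (fun z : ℝ × ℝ => z.1 ^ p) _ z := (hasFDerivAt_fst (𝕜 := ℝ)).pow p
  have h2 : HasFDerivAt (fun z : ℝ × ℝ => z.2 ^ q) _ z := (hasFDerivAt_snd (𝕜 := ℝ)).pow q
  refine (h1.add h2).congr_fderiv ?_
  simp only [nsmul_eq_mul]

lemma FFc_hasFDerivAt (p q : ℕ) (z : ℝ × ℝ) : HasFDerivAt (fun z => (FF p q z : ℂ))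
    (Complex.ofRealCLM.comp ((p * z.1 ^ (p-1)) • ContinuousLinearMap.fst ℝ ℝ ℝ +
      (q * z.2 ^ (q-1)) • ContinuousLinearMap.snd ℝ ℝ ℝ)) z :=
  Complex.ofRealCLM.hasFDerivAt.comp z (FF_hasFDerivAt p q z)

/-- The oscillating factor. -/
def ee (p q : ℕ) (τ : ℝ) (z : ℝ × ℝ) : ℂ := Complex.exp (Complex.I * τ * (FF p q z : ℂ))

lemma ee_norm (p q : ℕ) (τ : ℝ) (z : ℝ × ℝ) : ‖ee p q τ z‖ = 1 := by
  unfold ee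
  rw [Complex.norm_exp]
  simp

lemma ee_continuous (p q : ℕ) (τ : ℝ) : Continuous (ee p q τ) := by
  unfold ee
  have := FF_continuous p q
  fun_prop

lemma ee_hasFDerivAt (p q : ℕ) (τ : ℝ) (z : ℝ × ℝ) : HasFDerivAt (ee p q τ)
    (ee p q τ z • ((Complex.I * τ) • (Complex.ofRealCLM.comp
      ((p * z.1 ^ (p-1)) • ContinuousLinearMap.fst ℝ ℝ ℝ +
      (q * z.2 ^ (q-1)) • ContinuousLinearMap.snd ℝ ℝ ℝ)))) z :=
  ((FFc_hasFDerivAt p q z).const_mul (Complex.I * τ)).cexp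

/-- `x ∂ₓ χ` -/
def dA (χ : ℝ × ℝ → ℂ) (z : ℝ × ℝ) : ℂ := (z.1 : ℂ) * fderiv ℝ χ z (1, 0)
/-- `y ∂_y χ` -/
def dB (χ : ℝ × ℝ → ℂ) (z : ℝ × ℝ) : ℂ := (z.2 : ℂ) * fderiv ℝ χ z (0, 1)

lemma integrable_ee {p q : ℕ} {τ : ℝ} {χ : ℝ × ℝ → ℂ} (h : Integrable χ) :
    Integrable (fun z => χ z * ee p q τ z) := by
  refine h.mul_bdd (c := 1) (ee_continuous p q τ).aestronglyMeasurable ?_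
  exact Eventually.of_forall fun z => (ee_norm p q τ z).le

lemma abs_le_one_add_pow {p : ℕ} (hp2 : 2 ≤ p) (hp : Even p) (x : ℝ) : |x| ≤ 1 + x ^ p := by
  rw [← hp.pow_abs]
  rcases le_total |x| 1 with h | h
  · have : 0 ≤ |x| ^ p := by positivity
    linarith
  · have := le_self_pow₀ h (by omega : p ≠ 0)
    linarith

lemma ibp_x {p q : ℕ} (hp2 : 2 ≤ p) (hp : Even p) (hq : Even q)
    (τ : ℝ) {χ : ℝ × ℝ → ℂ} (hχ : Differentiable ℝ χ) (h0 : Integrable χ)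
    (hF : Integrable (fun z => (FF p q z : ℂ) * χ z)) (hA : Integrable (dA χ)) :
    Complex.I * τ * p * ∫ z, ((z.1 ^ p : ℝ) * χ z) * ee p q τ z =
      - (∫ z, χ z * ee p q τ z) - ∫ z, dA χ z * ee p q τ z := by
  have hxc : Continuous (fun z : ℝ × ℝ => (z.1 : ℂ)) := by fun_prop
  have hdx : ∀ z : ℝ × ℝ, HasFDerivAt (fun z : ℝ × ℝ => (z.1 : ℂ))
    (Complex.ofRealCLM.comp (ContinuousLinearMap.fst ℝ ℝ ℝ)) z := fun z =>
      Complex.ofRealCLM.hasFDerivAt.comp z hasFDerivAt_fst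
  have hf : ∀ z, HasFDerivAt (fun z : ℝ × ℝ => (z.1 : ℂ) * χ z) _ z := fun z =>
    (hdx z).mul (hχ z).hasFDerivAt
  have e1 : ∀ z, fderiv ℝ (fun z : ℝ × ℝ => (z.1 : ℂ) * χ z) z (1, 0) = χ z + dA χ z := by
    intro z; rw [(hf z).fderiv]; simp [dA]; ring
  have e2 : ∀ z, fderiv ℝ (ee p q τ) z (1, 0) =
      Complex.I * τ * p * (z.1 : ℂ) ^ (p-1) * ee p q τ z := by
    intro z; rw [(ee_hasFDerivAt p q τ z).fderiv]; simp; ring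
  have e3 : ∀ z : ℝ × ℝ, (z.1 : ℂ) * χ z * fderiv ℝ (ee p q τ) z (1, 0) =
      (Complex.I * τ * p) * ((((z.1 ^ p : ℝ) : ℂ) * χ z) * ee p q τ z) := by
    intro z
    rw [e2]
    obtain ⟨k, rfl⟩ : ∃ k, p = k + 1 := ⟨p - 1, by omega⟩
    push_cast
    simp only [pow_succ]
    ring
  have hxp : Integrable (fun z : ℝ × ℝ => ((z.1 ^ p : ℝ) : ℂ) * χ z) := by
    refine hF.mono ?_ ?_
    · exact Continuous.aestronglyMeasurable (by have := hχ.continuous; fun_prop)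
    · refine Eventually.of_forall fun z => ?_
      rw [norm_mul, norm_mul, Complex.norm_real, Complex.norm_real,
        Real.norm_of_nonneg (FF_nonneg hp hq z), Real.norm_of_nonneg (hp.pow_nonneg _)]
      gcongr
      unfold FF
      have := hq.pow_nonneg z.2
      linarith
  have hx : Integrable (fun z : ℝ × ℝ => (z.1 : ℂ) * χ z) := by
    refine (h0.norm.add hxp.norm).mono' ?_ ?_
    · exact Continuous.aestronglyMeasurable (by have := hχ.continuous; fun_prop)
    · refine Eventually.of_forall fun z => ?_
      simp only [Pi.add_apply, norm_mul, Complex.norm_real, Real.norm_eq_abs]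
      have := abs_le_one_add_pow hp2 hp z.1
      rw [abs_of_nonneg (hp.pow_nonneg z.1)]
      nlinarith [norm_nonneg (χ z)]
  have key := integral_mul_fderiv_eq_neg_fderiv_mul_of_integrable (μ := (volume : Measure (ℝ × ℝ)))
    (f := fun z : ℝ × ℝ => (z.1 : ℂ) * χ z) (g := ee p q τ) (v := ((1:ℝ), (0:ℝ)))
    (by simp only [e1]; exact integrable_ee (h0.add hA))
    (by simp only [e3]; exact (integrable_ee hxp).const_mul _)
    (integrable_ee hx) (fun z _ => (hf z).differentiableAt)
    (fun z _ => (ee_hasFDerivAt p q τ z).differentiableAt)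
  simp only [e1, e3] at key
  rw [integral_const_mul] at key
  rw [key]
  simp only [add_mul]
  rw [integral_add (integrable_ee h0) (integrable_ee hA)]
  ring

lemma ibp_y {p q : ℕ} (hq2 : 2 ≤ q) (hp : Even p) (hq : Even q)
    (τ : ℝ) {χ : ℝ × ℝ → ℂ} (hχ : Differentiable ℝ χ) (h0 : Integrable χ)
    (hF : Integrable (fun z => (FF p q z : ℂ) * χ z)) (hB : Integrable (dB χ)) :
    Complex.I * τ * q * ∫ z, ((z.2 ^ q : ℝ) * χ z) * ee p q τ z =
      - (∫ z, χ z * ee p q τ z) - ∫ z, dB χ z * ee p q τ z := by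
  have hdx : ∀ z : ℝ × ℝ, HasFDerivAt (fun z : ℝ × ℝ => (z.2 : ℂ))
    (Complex.ofRealCLM.comp (ContinuousLinearMap.snd ℝ ℝ ℝ)) z := fun z =>
      Complex.ofRealCLM.hasFDerivAt.comp z hasFDerivAt_snd
  have hf : ∀ z, HasFDerivAt (fun z : ℝ × ℝ => (z.2 : ℂ) * χ z) _ z := fun z =>
    (hdx z).mul (hχ z).hasFDerivAt
  have e1 : ∀ z, fderiv ℝ (fun z : ℝ × ℝ => (z.2 : ℂ) * χ z) z (0, 1) = χ z + dB χ z := by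
    intro z; rw [(hf z).fderiv]; simp [dB]; ring
  have e2 : ∀ z, fderiv ℝ (ee p q τ) z (0, 1) =
      Complex.I * τ * q * (z.2 : ℂ) ^ (q-1) * ee p q τ z := by
    intro z; rw [(ee_hasFDerivAt p q τ z).fderiv]; simp; ring
  have e3 : ∀ z : ℝ × ℝ, (z.2 : ℂ) * χ z * fderiv ℝ (ee p q τ) z (0, 1) =
      (Complex.I * τ * q) * ((((z.2 ^ q : ℝ) : ℂ) * χ z) * ee p q τ z) := by
    intro z
    rw [e2]
    obtain ⟨k, rfl⟩ : ∃ k, q = k + 1 := ⟨q - 1, by omega⟩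
    push_cast
    simp only [pow_succ]
    ring
  have hxp : Integrable (fun z : ℝ × ℝ => ((z.2 ^ q : ℝ) : ℂ) * χ z) := by
    refine hF.mono ?_ ?_
    · exact Continuous.aestronglyMeasurable (by have := hχ.continuous; fun_prop)
    · refine Eventually.of_forall fun z => ?_
      rw [norm_mul, norm_mul, Complex.norm_real, Complex.norm_real,
        Real.norm_of_nonneg (FF_nonneg hp hq z), Real.norm_of_nonneg (hq.pow_nonneg _)]
      gcongr
      unfold FF
      have := hp.pow_nonneg z.1
      linarith
  have hx : Integrable (fun z : ℝ × ℝ => (z.2 : ℂ) * χ z) := by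
    refine (h0.norm.add hxp.norm).mono' ?_ ?_
    · exact Continuous.aestronglyMeasurable (by have := hχ.continuous; fun_prop)
    · refine Eventually.of_forall fun z => ?_
      simp only [Pi.add_apply, norm_mul, Complex.norm_real, Real.norm_eq_abs]
      have := abs_le_one_add_pow hq2 hq z.2
      rw [abs_of_nonneg (hq.pow_nonneg z.2)]
      nlinarith [norm_nonneg (χ z)]
  have key := integral_mul_fderiv_eq_neg_fderiv_mul_of_integrable (μ := (volume : Measure (ℝ × ℝ)))
    (f := fun z : ℝ × ℝ => (z.2 : ℂ) * χ z) (g := ee p q τ) (v := ((0:ℝ), (1:ℝ)))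
    (by simp only [e1]; exact integrable_ee (h0.add hB))
    (by simp only [e3]; exact (integrable_ee hxp).const_mul _)
    (integrable_ee hx) (fun z _ => (hf z).differentiableAt)
    (fun z _ => (ee_hasFDerivAt p q τ z).differentiableAt)
  simp only [e1, e3] at key
  rw [integral_const_mul] at key
  rw [key]
  simp only [add_mul]
  rw [integral_add (integrable_ee h0) (integrable_ee hB)]
  ring

/-- The Euler field applied to `χ`. -/
def dE (p q : ℕ) (χ : ℝ × ℝ → ℂ) (z : ℝ × ℝ) : ℂ := dA χ z / p + dB χ z / q

lemma ibp {p q : ℕ} (hp2 : 2 ≤ p) (hq2 : 2 ≤ q) (hp : Even p) (hq : Even q)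
    (τ : ℝ) {χ : ℝ × ℝ → ℂ} (hχ : Differentiable ℝ χ) (h0 : Integrable χ)
    (hF : Integrable (fun z => (FF p q z : ℂ) * χ z)) (hA : Integrable (dA χ))
    (hB : Integrable (dB χ)) :
    Complex.I * τ * ∫ z, ((FF p q z : ℂ) * χ z) * ee p q τ z =
      - (1 / (p:ℂ) + 1 / (q:ℂ)) * (∫ z, χ z * ee p q τ z) - ∫ z, dE p q χ z * ee p q τ z := by
  have h1 := ibp_x hp2 hp hq τ hχ h0 hF hA
  have h2 := ibp_y hq2 hp hq τ hχ h0 hF hB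
  have hp0 : (p:ℂ) ≠ 0 := by exact_mod_cast (by omega : p ≠ 0)
  have hq0 : (q:ℂ) ≠ 0 := by exact_mod_cast (by omega : q ≠ 0)
  have hxp : Integrable (fun z : ℝ × ℝ => ((z.1 ^ p : ℝ) : ℂ) * χ z) := by
    refine hF.mono ?_ ?_
    · exact Continuous.aestronglyMeasurable (by have := hχ.continuous; fun_prop)
    · refine Eventually.of_forall fun z => ?_
      rw [norm_mul, norm_mul, Complex.norm_real, Complex.norm_real,
        Real.norm_of_nonneg (FF_nonneg hp hq z), Real.norm_of_nonneg (hp.pow_nonneg _)]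
      gcongr
      unfold FF
      have := hq.pow_nonneg z.2
      linarith
  have hyp : Integrable (fun z : ℝ × ℝ => ((z.2 ^ q : ℝ) : ℂ) * χ z) := by
    have := hF.sub hxp
    refine this.congr (Eventually.of_forall fun z => ?_)
    simp only [Pi.sub_apply, FF]
    push_cast; ring
  have e1 : ∫ z, ((FF p q z : ℂ) * χ z) * ee p q τ z =
      (∫ z, ((z.1 ^ p : ℝ) * χ z) * ee p q τ z) + ∫ z, ((z.2 ^ q : ℝ) * χ z) * ee p q τ z := by
    rw [← integral_add (integrable_ee hxp) (integrable_ee hyp)]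
    congr 1; ext z; simp only [FF]; push_cast; ring
  have e2 : ∫ z, dE p q χ z * ee p q τ z =
      (∫ z, dA χ z * ee p q τ z) / p + (∫ z, dB χ z * ee p q τ z) / q := by
    rw [← integral_div, ← integral_div, ← integral_add ((integrable_ee hA).div_const _)
      ((integrable_ee hB).div_const _)]
    congr 1; ext z; simp only [dE]; ring
  rw [e1, e2]
  generalize (∫ z, ((z.1 ^ p : ℝ) * χ z) * ee p q τ z) = X at *
  generalize (∫ z, ((z.2 ^ q : ℝ) * χ z) * ee p q τ z) = Y at *
  generalize (∫ z, dA χ z * ee p q τ z) = A at *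
  generalize (∫ z, dB χ z * ee p q τ z) = B at *
  generalize (∫ z, χ z * ee p q τ z) = J at *
  have h1' : Complex.I * τ * X = (-J - A) / p := by rw [← h1]; field_simp
  have h2' : Complex.I * τ * Y = (-J - B) / q := by rw [← h2]; field_simp
  rw [mul_add, h1', h2']; ring

/-- Regularity class of amplitudes. -/
structure Good (p q : ℕ) (ψ : ℝ × ℝ → ℂ) : Prop where
  cd : ContDiff ℝ 1 ψ
  b0 : ∃ M, ∀ z, ‖ψ z‖ ≤ M
  bA : ∃ M, ∀ z, ‖dA ψ z‖ ≤ M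
  bB : ∃ M, ∀ z, ‖dB ψ z‖ ≤ M
  i0 : Integrable ψ
  iF : Integrable (fun z => (FF p q z : ℂ) * ψ z)
  iA : Integrable (dA ψ)
  iB : Integrable (dB ψ)

lemma scale_integral {a b : ℝ} (ha : 0 < a) (hb : 0 < b) (G : ℝ × ℝ → ℂ) :
    (a * b : ℝ) * ∫ z : ℝ × ℝ, G (a * z.1, b * z.2) = ∫ z, G z := by
  have h1 : Measure.map (fun z : ℝ × ℝ => (a * z.1, b * z.2)) volume =
      ENNReal.ofReal (a⁻¹ * b⁻¹) • (volume : Measure (ℝ × ℝ)) := by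
    have e := Measure.map_prod_map (volume : Measure ℝ) (volume : Measure ℝ)
      (measurable_const_mul a) (measurable_const_mul b)
    rw [Real.map_volume_mul_left ha.ne', Real.map_volume_mul_left hb.ne',
      Measure.prod_smul_left, Measure.prod_smul_right, smul_smul,
      abs_of_pos (inv_pos.2 ha), abs_of_pos (inv_pos.2 hb),
      ← ENNReal.ofReal_mul (inv_pos.2 ha).le] at e
    rw [Measure.volume_eq_prod, e]
    rfl
  let T : (ℝ × ℝ) ≃ₜ (ℝ × ℝ) := (Homeomorph.mulLeft₀ a ha.ne').prodCongr
    (Homeomorph.mulLeft₀ b hb.ne')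
  have h2 : ∫ z : ℝ × ℝ, G (a * z.1, b * z.2) =
      ∫ z, G z ∂(Measure.map (fun z : ℝ × ℝ => (a * z.1, b * z.2)) volume) := by
    have := T.measurableEmbedding.integral_map (μ := (volume : Measure (ℝ × ℝ))) G
    rw [show (fun z : ℝ × ℝ => (a * z.1, b * z.2)) = T from rfl, this]
    rfl
  rw [h2, h1, integral_smul_measure, ENNReal.toReal_ofReal (by positivity)]
  rw [Complex.real_smul, ← mul_assoc, ← Complex.ofReal_mul]
  have : a * b * (a⁻¹ * b⁻¹) = 1 := by field_simp
  rw [this]; simp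

/-- The regularising factor. -/
def hh (p q : ℕ) (τ : ℝ) (z : ℝ × ℝ) : ℂ := (1 + Complex.I * τ * (FF p q z : ℂ))⁻¹

lemma one_add_ne (t : ℝ) : (1 + Complex.I * (t : ℂ)) ≠ 0 := by
  intro h
  have := congrArg Complex.re h
  simp at this

lemma norm_one_add_ge (t : ℝ) : 1 ≤ ‖1 + Complex.I * (t : ℂ)‖ := by
  have := Complex.abs_re_le_norm (1 + Complex.I * (t : ℂ))
  simpa using this

lemma norm_one_add_ge' (t : ℝ) : |t| ≤ ‖1 + Complex.I * (t : ℂ)‖ := by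
  have := Complex.abs_im_le_norm (1 + Complex.I * (t : ℂ))
  simpa using this

lemma hh_eq (p q : ℕ) (τ : ℝ) (z : ℝ × ℝ) :
    hh p q τ z = (1 + Complex.I * ((τ * FF p q z : ℝ) : ℂ))⁻¹ := by
  unfold hh; push_cast; ring_nf

lemma hh_norm_le (p q : ℕ) (τ : ℝ) (z : ℝ × ℝ) : ‖hh p q τ z‖ ≤ 1 := by
  rw [hh_eq, norm_inv]
  exact inv_le_one_of_one_le₀ (norm_one_add_ge _)

lemma hh_norm_le' {p q : ℕ} (hp : Even p) (hq : Even q) (z : ℝ × ℝ) :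
    ‖hh p q 1 z‖ ≤ 2 * (1 + FF p q z)⁻¹ := by
  have h0 := FF_nonneg hp hq z
  rw [hh_eq, norm_inv, ← div_eq_mul_inv, inv_eq_one_div, div_le_div_iff₀]
  · have h1 := norm_one_add_ge (1 * FF p q z)
    have h2 := norm_one_add_ge' (1 * FF p q z)
    rw [one_mul, abs_of_nonneg h0] at h2
    rw [one_mul] at h1
    rw [one_mul (FF p q z), one_mul]
    linarith
  · have h1 := norm_one_add_ge (1 * FF p q z)
    linarith
  · positivity

lemma hh_mul_norm_le {p q : ℕ} (hp : Even p) (hq : Even q) {τ : ℝ} (hτ : 0 ≤ τ) (z : ℝ × ℝ) :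
    τ * FF p q z * ‖hh p q τ z‖ ≤ 1 := by
  have h0 := FF_nonneg hp hq z
  have h2 := norm_one_add_ge' (τ * FF p q z)
  have h1 := norm_one_add_ge (τ * FF p q z)
  rw [abs_of_nonneg (by positivity)] at h2
  rw [hh_eq, norm_inv, ← div_eq_mul_inv, div_le_one (by linarith)]
  exact h2

lemma hh_hasFDerivAt (p q : ℕ) (τ : ℝ) (z : ℝ × ℝ) : HasFDerivAt (hh p q τ)
    (-(hh p q τ z) ^ 2 • ((Complex.I * τ) • (Complex.ofRealCLM.comp
      ((p * z.1 ^ (p-1)) • ContinuousLinearMap.fst ℝ ℝ ℝ +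
      (q * z.2 ^ (q-1)) • ContinuousLinearMap.snd ℝ ℝ ℝ)))) z := by
  have h1 := ((FFc_hasFDerivAt p q z).const_mul (Complex.I * τ)).const_add 1
  have hne : (1 + Complex.I * τ * (FF p q z : ℂ)) ≠ 0 := by
    have := one_add_ne (τ * FF p q z)
    push_cast at this
    rwa [← mul_assoc] at this
  have h2 := (hasDerivAt_inv hne).comp_hasFDerivAt z h1
  refine h2.congr_fderiv ?_
  simp only [hh, inv_pow]

lemma hh_continuous (p q : ℕ) (τ : ℝ) : Continuous (hh p q τ) :=
  continuous_iff_continuousAt.2 fun z => (hh_hasFDerivAt p q τ z).continuousAt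

lemma dA_continuous {ψ : ℝ × ℝ → ℂ} (h : ContDiff ℝ 1 ψ) : Continuous (dA ψ) := by
  unfold dA
  have := h.continuous_fderiv (by norm_num)
  fun_prop

lemma dB_continuous {ψ : ℝ × ℝ → ℂ} (h : ContDiff ℝ 1 ψ) : Continuous (dB ψ) := by
  unfold dB
  have := h.continuous_fderiv (by norm_num)
  fun_prop

lemma dE_continuous {p q : ℕ} {ψ : ℝ × ℝ → ℂ} (h : ContDiff ℝ 1 ψ) : Continuous (dE p q ψ) := by
  unfold dE
  have := dA_continuous h
  have := dB_continuous h
  fun_prop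

lemma regularised {p q : ℕ} (hp2 : 2 ≤ p) (hq2 : 2 ≤ q) (hp : Even p) (hq : Even q)
    {ψ : ℝ × ℝ → ℂ} (hψ : Good p q ψ) {τ : ℝ} (hτ : 0 ≤ τ) :
    ∫ z, ψ z * ee p q τ z = ∫ z, ((1 - (1 / (p:ℂ) + 1 / (q:ℂ))) * (ψ z * hh p q τ z)
      - dE p q ψ z * hh p q τ z
      + ψ z * (Complex.I * τ * (FF p q z : ℂ)) * (hh p q τ z) ^ 2) * ee p q τ z := by
  have hψd : Differentiable ℝ ψ := hψ.cd.differentiable (by norm_num)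
  have hp0 : (p:ℂ) ≠ 0 := by exact_mod_cast (by omega : p ≠ 0)
  have hq0 : (q:ℂ) ≠ 0 := by exact_mod_cast (by omega : q ≠ 0)
  set χ : ℝ × ℝ → ℂ := fun z => ψ z * hh p q τ z with hχdef
  have hχ : ∀ z, HasFDerivAt χ _ z := fun z => (hψd z).hasFDerivAt.mul (hh_hasFDerivAt p q τ z)
  have hχd : Differentiable ℝ χ := fun z => (hχ z).differentiableAt
  have hhm : ∀ {g : ℝ × ℝ → ℂ}, Integrable g → Integrable (fun z => g z * hh p q τ z) := by
    intro g hg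
    refine hg.mul_bdd (c := 1) (hh_continuous p q τ).aestronglyMeasurable ?_
    exact Eventually.of_forall fun z => hh_norm_le p q τ z
  have eA : ∀ z, dA χ z = dA ψ z * hh p q τ z -
      p * (ψ z * (Complex.I * τ * ((z.1 ^ p : ℝ) : ℂ)) * (hh p q τ z) ^ 2) := by
    intro z
    simp only [dA]
    rw [(hχ z).fderiv]
    obtain ⟨k, rfl⟩ : ∃ k, p = k + 1 := ⟨p - 1, by omega⟩
    simp [pow_succ]; ring
  have eB : ∀ z, dB χ z = dB ψ z * hh p q τ z -
      q * (ψ z * (Complex.I * τ * ((z.2 ^ q : ℝ) : ℂ)) * (hh p q τ z) ^ 2) := by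
    intro z
    simp only [dB]
    rw [(hχ z).fderiv]
    obtain ⟨k, rfl⟩ : ∃ k, q = k + 1 := ⟨q - 1, by omega⟩
    simp [pow_succ]; ring
  have eE : ∀ z, dE p q χ z = dE p q ψ z * hh p q τ z -
      ψ z * (Complex.I * τ * (FF p q z : ℂ)) * (hh p q τ z) ^ 2 := by
    intro z
    simp only [dE]
    rw [eA, eB]
    simp only [FF]; push_cast
    field_simp; ring
  have hc : Continuous ψ := hψd.continuous
  have hcF := FF_continuous p q
  have hch := hh_continuous p q τ
  have ibound : ∀ (g : ℝ × ℝ → ℝ), Continuous g → (∀ z, 0 ≤ g z) → (∀ z, g z ≤ FF p q z) →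
      Integrable (fun z => ψ z * (Complex.I * τ * (g z : ℂ)) * (hh p q τ z) ^ 2) := by
    intro g hg hg0 hgF
    refine hψ.i0.mono ?_ ?_
    · exact Continuous.aestronglyMeasurable (by fun_prop)
    · refine Eventually.of_forall fun z => ?_
      have h1 := hh_mul_norm_le hp hq hτ z
      have h2 := hh_norm_le p q τ z
      have h3 : τ * g z * ‖hh p q τ z‖ ≤ 1 := by
        refine le_trans ?_ h1
        have := hgF z
        gcongr
      simp only [norm_mul, norm_pow, Complex.norm_real, Complex.norm_I, one_mul,
        Real.norm_of_nonneg hτ, Real.norm_of_nonneg (hg0 z)]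
      calc ‖ψ z‖ * (τ * g z) * ‖hh p q τ z‖ ^ 2
          = ‖ψ z‖ * ((τ * g z * ‖hh p q τ z‖) * ‖hh p q τ z‖) := by ring
        _ ≤ ‖ψ z‖ * (1 * 1) := by
          have := hg0 z
          gcongr
        _ = ‖ψ z‖ := by ring
  have iA : Integrable (dA χ) := by
    rw [show dA χ = _ from funext eA]
    refine (hhm hψ.iA).sub (Integrable.const_mul ?_ _)
    refine ibound (fun z => z.1 ^ p) (by fun_prop) (fun z => hp.pow_nonneg _) (fun z => ?_)
    simpa [FF] using hq.pow_nonneg z.2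
  have iB : Integrable (dB χ) := by
    rw [show dB χ = _ from funext eB]
    refine (hhm hψ.iB).sub (Integrable.const_mul ?_ _)
    refine ibound (fun z => z.2 ^ q) (by fun_prop) (fun z => hq.pow_nonneg _) (fun z => ?_)
    simpa [FF] using hp.pow_nonneg z.1
  have iE : Integrable (dE p q χ) := (iA.div_const _).add (iB.div_const _)
  have i0 : Integrable χ := hhm hψ.i0
  have iF : Integrable (fun z => (FF p q z : ℂ) * χ z) := by
    refine (hhm hψ.iF).congr (Eventually.of_forall fun z => ?_)
    simp only [hχdef]; ring
  have key := ibp hp2 hq2 hp hq τ hχd i0 iF iA iB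
  have e1 : ∫ z, ψ z * ee p q τ z = (∫ z, χ z * ee p q τ z) +
      Complex.I * τ * ∫ z, ((FF p q z : ℂ) * χ z) * ee p q τ z := by
    rw [← integral_const_mul, ← integral_add (integrable_ee i0) ((integrable_ee iF).const_mul _)]
    congr 1; ext z
    have hne : (1 + Complex.I * τ * (FF p q z : ℂ)) * hh p q τ z = 1 := by
      rw [hh]
      refine mul_inv_cancel₀ ?_
      have := one_add_ne (τ * FF p q z)
      push_cast at this
      rwa [← mul_assoc] at this
    simp only [hχdef]
    linear_combination (-(ψ z * ee p q τ z)) * hne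
  have e2 : ∫ z, ((1 - (1 / (p:ℂ) + 1 / (q:ℂ))) * (ψ z * hh p q τ z)
      - dE p q ψ z * hh p q τ z
      + ψ z * (Complex.I * τ * (FF p q z : ℂ)) * (hh p q τ z) ^ 2) * ee p q τ z =
      (1 - (1 / (p:ℂ) + 1 / (q:ℂ))) * (∫ z, χ z * ee p q τ z) - ∫ z, dE p q χ z * ee p q τ z := by
    rw [← integral_const_mul, ← integral_sub ((integrable_ee i0).const_mul _) (integrable_ee iE)]
    congr 1; ext z
    rw [eE]
    simp only [hχdef]
    ring
  rw [e1, key, e2]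
  ring

/-- The integrand of the limit constant. -/
def kk (p q : ℕ) (z : ℝ × ℝ) : ℂ := ((1 - (1 / (p:ℂ) + 1 / (q:ℂ))) * hh p q 1 z
      + (Complex.I * (FF p q z : ℂ)) * (hh p q 1 z) ^ 2) * ee p q 1 z

lemma asym {p q : ℕ} (hp2 : 2 ≤ p) (hq2 : 2 ≤ q) (hp : Even p) (hq : Even q)
    (hα : 1 / (p:ℝ) + 1 / (q:ℝ) < 1) {ψ : ℝ × ℝ → ℂ} (hψ : Good p q ψ) :
    Tendsto (fun τ : ℝ => ((τ ^ (1 / (p:ℝ) + 1 / (q:ℝ)) : ℝ) : ℂ) * ∫ z, ψ z * ee p q τ z) atTop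
      (𝓝 (ψ 0 * ∫ z, kk p q z)) := by
  have hp0 : (0:ℝ) < p := by exact_mod_cast (by omega : 0 < p)
  have hq0 : (0:ℝ) < q := by exact_mod_cast (by omega : 0 < q)
  obtain ⟨M0, hM0⟩ := hψ.b0
  obtain ⟨MA, hMA⟩ := hψ.bA
  obtain ⟨MB, hMB⟩ := hψ.bB
  have hM0' : 0 ≤ M0 := le_trans (norm_nonneg _) (hM0 0)
  have hME : ∀ z, ‖dE p q ψ z‖ ≤ MA / p + MB / q := by
    intro z
    refine (norm_add_le _ _).trans ?_
    rw [norm_div, norm_div, Complex.norm_natCast, Complex.norm_natCast]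
    gcongr
    · exact hMA z
    · exact hMB z
  set ME := MA / p + MB / q
  have hME' : 0 ≤ ME := le_trans (norm_nonneg _) (hME 0)
  set c : ℂ := 1 - (1 / (p:ℂ) + 1 / (q:ℂ)) with hc
  set S : ℝ → ℝ × ℝ → ℝ × ℝ := fun τ z => (τ ^ (-(1 / (p:ℝ))) * z.1, τ ^ (-(1 / (q:ℝ))) * z.2)
    with hS
  set G : ℝ → ℝ × ℝ → ℂ := fun τ z => (c * (ψ (S τ z) * hh p q 1 z) - dE p q ψ (S τ z) * hh p q 1 z
      + ψ (S τ z) * (Complex.I * (FF p q z : ℂ)) * (hh p q 1 z) ^ 2) * ee p q 1 z with hG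
  have hSF : ∀ τ > 0, ∀ z, τ * FF p q (S τ z) = FF p q z := by
    intro τ hτ z
    simp only [FF, hS, mul_pow]
    rw [← Real.rpow_natCast (τ ^ _) p, ← Real.rpow_natCast (τ ^ _) q, ← Real.rpow_mul hτ.le,
      ← Real.rpow_mul hτ.le]
    have e1 : -(1 / (p:ℝ)) * (p:ℝ) = -1 := by field_simp
    have e2 : -(1 / (q:ℝ)) * (q:ℝ) = -1 := by field_simp
    rw [e1, e2, Real.rpow_neg_one]
    field_simp
  have e1 : ∀ τ > 0, ((τ ^ (1 / (p:ℝ) + 1 / (q:ℝ)) : ℝ) : ℂ) * ∫ z, ψ z * ee p q τ z =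
      ∫ z, G τ z := by
    intro τ hτ
    rw [regularised hp2 hq2 hp hq hψ hτ.le,
      ← scale_integral (Real.rpow_pos_of_pos hτ (-(1 / (p:ℝ))))
        (Real.rpow_pos_of_pos hτ (-(1 / (q:ℝ)))), ← mul_assoc, ← Complex.ofReal_mul]
    have e2 : τ ^ (1 / (p:ℝ) + 1 / (q:ℝ)) * (τ ^ (-(1 / (p:ℝ))) * τ ^ (-(1 / (q:ℝ)))) = 1 := by
      rw [← Real.rpow_add hτ, ← Real.rpow_add hτ]
      convert Real.rpow_zero τ using 2
      ring
    rw [e2, Complex.ofReal_one, one_mul]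
    congr 1; ext z
    have e3 : (τ:ℂ) * (FF p q (S τ z) : ℂ) = (FF p q z : ℂ) := by exact_mod_cast hSF τ hτ z
    have e4 : hh p q τ (S τ z) = hh p q 1 z := by
      simp only [hh, mul_assoc, e3, Complex.ofReal_one, one_mul]
    have e5 : ee p q τ (S τ z) = ee p q 1 z := by
      simp only [ee, mul_assoc, e3, Complex.ofReal_one, one_mul]
    have e6 : (τ ^ (-(1 / (p:ℝ))) * z.1, τ ^ (-(1 / (q:ℝ))) * z.2) = S τ z := rfl
    simp only [e6, e4, e5, hG]
    rw [mul_assoc Complex.I, e3]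
  have hlim : Tendsto (fun τ => ∫ z, G τ z) atTop (𝓝 (∫ z, ψ 0 * kk p q z)) := by
    have hψc := hψ.cd.continuous
    have hEc : Continuous (dE p q ψ) := dE_continuous hψ.cd
    have hcF := FF_continuous p q
    have hch := hh_continuous p q 1
    have hce := ee_continuous p q 1
    refine tendsto_integral_filter_of_dominated_convergence
      (fun z => (‖c‖ * M0 + ME + M0) * (2 * (1 + FF p q z)⁻¹)) ?_ ?_ ?_ ?_
    · refine Eventually.of_forall fun τ => Continuous.aestronglyMeasurable ?_
      have hSc : Continuous (S τ) := by simp only [hS]; fun_prop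
      simp only [hG]
      fun_prop
    · refine Eventually.of_forall fun τ => Eventually.of_forall fun z => ?_
      have h1 := hh_norm_le' hp hq z
      have h2 := hh_mul_norm_le hp hq zero_le_one z
      rw [one_mul] at h2
      have h3 := FF_nonneg hp hq z
      simp only [hG]
      rw [norm_mul, ee_norm, mul_one]
      refine le_trans ?_ (mul_le_mul_of_nonneg_left h1 (by positivity))
      refine (norm_add_le _ _).trans ?_
      rw [add_mul]
      refine add_le_add ((norm_sub_le _ _).trans ?_) ?_
      · rw [norm_mul, norm_mul, norm_mul, add_mul, ← mul_assoc]
        gcongr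
        · exact hM0 _
        · exact hME _
      · simp only [norm_mul, norm_pow, Complex.norm_real, Complex.norm_I, one_mul,
          Real.norm_of_nonneg h3]
        calc ‖ψ (S τ z)‖ * FF p q z * ‖hh p q 1 z‖ ^ 2
            = ‖ψ (S τ z)‖ * (FF p q z * ‖hh p q 1 z‖) * ‖hh p q 1 z‖ := by ring
          _ ≤ M0 * 1 * ‖hh p q 1 z‖ := by
            gcongr
            exact hM0 _
          _ = _ := by ring
    · exact ((FF_integrable hp2 hq2 hp hq hα).const_mul _).const_mul _
    · refine Eventually.of_forall fun z => ?_
      have hS0 : Tendsto (fun τ => S τ z) atTop (𝓝 0) := by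
        have t1 : Tendsto (fun τ : ℝ => τ ^ (-(1 / (p:ℝ))) * z.1) atTop (𝓝 0) := by
          simpa using (tendsto_rpow_neg_atTop (by positivity : 0 < 1 / (p:ℝ))).mul_const z.1
        have t2 : Tendsto (fun τ : ℝ => τ ^ (-(1 / (q:ℝ))) * z.2) atTop (𝓝 0) := by
          simpa using (tendsto_rpow_neg_atTop (by positivity : 0 < 1 / (q:ℝ))).mul_const z.2
        exact t1.prodMk_nhds t2
      have t1 := (hψc.tendsto 0).comp hS0
      have t2 := (hEc.tendsto 0).comp hS0
      have hE0 : dE p q ψ 0 = 0 := by simp [dE, dA, dB]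
      rw [hE0] at t2
      have := ((((t1.mul_const (hh p q 1 z)).const_mul c).sub (t2.mul_const (hh p q 1 z))).add
        ((t1.mul_const (Complex.I * (FF p q z : ℂ))).mul_const
          ((hh p q 1 z) ^ 2))).mul_const (ee p q 1 z)
      refine this.congr' ?_ |>.trans ?_
      · exact Eventually.of_forall fun τ => rfl
      · apply le_of_eq
        congr 1
        simp only [kk, hc]
        ring
  rw [← integral_const_mul]
  refine hlim.congr' ?_
  filter_upwards [eventually_gt_atTop 0] with τ hτ
  exact (e1 τ hτ).symm

lemma deriv_J {p q : ℕ} {ψ : ℝ × ℝ → ℂ} (hψ : Good p q ψ) (τ : ℝ) :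
    HasDerivAt (fun τ : ℝ => ∫ z, ψ z * ee p q τ z)
      (Complex.I * ∫ z, (FF p q z : ℂ) * ψ z * ee p q τ z) τ := by
  have hψc := hψ.cd.continuous
  have hcF := FF_continuous p q
  rw [← integral_const_mul]
  have := hasDerivAt_integral_of_dominated_loc_of_deriv_le (μ := (volume : Measure (ℝ × ℝ)))
    (F := fun (τ : ℝ) z => ψ z * ee p q τ z)
    (F' := fun (τ : ℝ) z => Complex.I * ((FF p q z : ℂ) * ψ z * ee p q τ z))
    (bound := fun z => ‖(FF p q z : ℂ) * ψ z‖) (x₀ := τ) (s := univ) univ_mem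
    (Eventually.of_forall fun t => Continuous.aestronglyMeasurable
      (by have := ee_continuous p q t; fun_prop))
    (integrable_ee hψ.i0)
    (Continuous.aestronglyMeasurable (by have := ee_continuous p q τ; fun_prop))
    (Eventually.of_forall fun z t _ => by
      rw [norm_mul, norm_mul, ee_norm, Complex.norm_I, one_mul, mul_one])
    hψ.iF.norm
    (Eventually.of_forall fun z t _ => by
      have h1 : HasDerivAt (fun t : ℝ => Complex.I * t * (FF p q z : ℂ))
          (Complex.I * 1 * (FF p q z : ℂ)) t :=
        ((Complex.ofRealCLM.hasDerivAt (x := t)).const_mul Complex.I).mul_const _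
      have h2 := h1.cexp.const_mul (ψ z)
      refine h2.congr_deriv ?_
      simp only [ee]; ring)
  exact this.2

/-- The model amplitude. -/
def psi0 (p q : ℕ) (z : ℝ × ℝ) : ℂ := Complex.exp (-(FF p q z : ℂ))

lemma psi0_hasFDerivAt (p q : ℕ) (z : ℝ × ℝ) : HasFDerivAt (psi0 p q)
    (psi0 p q z • (-(Complex.ofRealCLM.comp
      ((p * z.1 ^ (p-1)) • ContinuousLinearMap.fst ℝ ℝ ℝ +
      (q * z.2 ^ (q-1)) • ContinuousLinearMap.snd ℝ ℝ ℝ)))) z :=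
  ((FFc_hasFDerivAt p q z).neg).cexp

lemma psi0_norm (p q : ℕ) (z : ℝ × ℝ) : ‖psi0 p q z‖ = Real.exp (-FF p q z) := by
  unfold psi0
  rw [Complex.norm_exp]; simp

lemma dA_psi0 {p q : ℕ} (hp2 : 2 ≤ p) (z : ℝ × ℝ) :
    dA (psi0 p q) z = - p * ((z.1 ^ p : ℝ) : ℂ) * psi0 p q z := by
  simp only [dA]
  rw [(psi0_hasFDerivAt p q z).fderiv]
  obtain ⟨k, rfl⟩ : ∃ k, p = k + 1 := ⟨p - 1, by omega⟩
  simp [pow_succ]; ring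

lemma dB_psi0 {p q : ℕ} (hq2 : 2 ≤ q) (z : ℝ × ℝ) :
    dB (psi0 p q) z = - q * ((z.2 ^ q : ℝ) : ℂ) * psi0 p q z := by
  simp only [dB]
  rw [(psi0_hasFDerivAt p q z).fderiv]
  obtain ⟨k, rfl⟩ : ∃ k, q = k + 1 := ⟨q - 1, by omega⟩
  simp [pow_succ]; ring

lemma exp_bd {t : ℝ} (ht : 0 ≤ t) : Real.exp (-t) ≤ (1 + t)⁻¹ ∧
    t * Real.exp (-t) ≤ 2 * (1 + t)⁻¹ := by
  have h := Real.quadratic_le_exp_of_nonneg ht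
  rw [Real.exp_neg]
  constructor
  · refine inv_anti₀ (by positivity) (by nlinarith)
  · rw [← div_eq_mul_inv, ← div_eq_mul_inv, div_le_div_iff₀ (Real.exp_pos t) (by positivity)]
    nlinarith

lemma psi0_good {p q : ℕ} (hp2 : 2 ≤ p) (hq2 : 2 ≤ q) (hp : Even p) (hq : Even q)
    (hα : 1 / (p:ℝ) + 1 / (q:ℝ) < 1) : Good p q (psi0 p q) := by
  have hcF := FF_continuous p q
  have hc : Continuous (psi0 p q) := by unfold psi0; fun_prop
  have hcd : ContDiff ℝ 1 (psi0 p q) := by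
    unfold psi0
    have h1 : ContDiff ℝ 1 (FF p q) := by unfold FF; fun_prop
    have h2 : ContDiff ℝ 1 (fun z => (FF p q z : ℂ)) := Complex.ofRealCLM.contDiff.comp h1
    exact h2.neg.cexp
  have hI := FF_integrable hp2 hq2 hp hq hα
  have bd : ∀ z, ∀ t : ℝ, 0 ≤ t → t ≤ FF p q z → ‖(t : ℂ) * psi0 p q z‖ ≤ 2 * (1 + FF p q z)⁻¹ := by
    intro z t h0 ht
    rw [norm_mul, psi0_norm, Complex.norm_real, Real.norm_of_nonneg h0]
    refine le_trans ?_ (exp_bd (FF_nonneg hp hq z)).2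
    gcongr
  have le2 : ∀ z, 2 * (1 + FF p q z)⁻¹ ≤ 2 := by
    intro z
    have := FF_nonneg hp hq z
    have : (1 + FF p q z)⁻¹ ≤ 1 := inv_le_one_of_one_le₀ (by linarith)
    linarith
  have lx : ∀ z : ℝ × ℝ, z.1 ^ p ≤ FF p q z := fun z => by
    have := hq.pow_nonneg z.2
    simp only [FF]; linarith
  have ly : ∀ z : ℝ × ℝ, z.2 ^ q ≤ FF p q z := fun z => by
    have := hp.pow_nonneg z.1
    simp only [FF]; linarith
  have bdA : ∀ z, ‖dA (psi0 p q) z‖ ≤ p * (2 * (1 + FF p q z)⁻¹) := by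
    intro z
    rw [dA_psi0 hp2, mul_assoc, norm_mul, norm_neg, Complex.norm_natCast]
    exact mul_le_mul_of_nonneg_left (bd z _ (hp.pow_nonneg _) (lx z)) (by positivity)
  have bdB : ∀ z, ‖dB (psi0 p q) z‖ ≤ q * (2 * (1 + FF p q z)⁻¹) := by
    intro z
    rw [dB_psi0 hq2, mul_assoc, norm_mul, norm_neg, Complex.norm_natCast]
    exact mul_le_mul_of_nonneg_left (bd z _ (hq.pow_nonneg _) (ly z)) (by positivity)
  refine ⟨hcd, ⟨1, fun z => ?_⟩, ⟨p * 2, fun z => ?_⟩, ⟨q * 2, fun z => ?_⟩, ?_, ?_, ?_, ?_⟩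
  · rw [psi0_norm, Real.exp_le_one_iff]
    have := FF_nonneg hp hq z
    linarith
  · exact (bdA z).trans (mul_le_mul_of_nonneg_left (le2 z) (by positivity))
  · exact (bdB z).trans (mul_le_mul_of_nonneg_left (le2 z) (by positivity))
  · refine hI.mono' hc.aestronglyMeasurable (Eventually.of_forall fun z => ?_)
    rw [psi0_norm]
    exact (exp_bd (FF_nonneg hp hq z)).1
  · refine (hI.const_mul 2).mono' (Continuous.aestronglyMeasurable (by fun_prop))
      (Eventually.of_forall fun z => bd z _ (FF_nonneg hp hq z) le_rfl)
  · exact ((hI.const_mul 2).const_mul (p:ℝ)).mono' (dA_continuous hcd).aestronglyMeasurable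
      (Eventually.of_forall bdA)
  · exact ((hI.const_mul 2).const_mul (q:ℝ)).mono' (dB_continuous hcd).aestronglyMeasurable
      (Eventually.of_forall bdB)

lemma integral_exp_neg_pow {p : ℕ} (hp2 : 2 ≤ p) (hp : Even p) :
    ∫ x : ℝ, Complex.exp (-((x ^ p : ℝ) : ℂ)) = ((2 * Real.Gamma (1 / (p:ℝ) + 1) : ℝ) : ℂ) := by
  have h1 := integral_exp_neg_rpow (p := (p:ℝ)) (by exact_mod_cast (by omega : 0 < p))
  have h2 := integral_comp_abs (f := fun x : ℝ => Real.exp (- x ^ (p:ℝ)))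
  rw [h1] at h2
  rw [← h2, ← integral_complex_ofReal]
  congr 1; ext x
  rw [Real.rpow_natCast, hp.pow_abs]
  push_cast; rfl

lemma psi0_integral {p q : ℕ} (hp2 : 2 ≤ p) (hq2 : 2 ≤ q) (hp : Even p) (hq : Even q) :
    ∫ z, psi0 p q z =
      ((4 * Real.Gamma (1 / (p:ℝ) + 1) * Real.Gamma (1 / (q:ℝ) + 1) : ℝ) : ℂ) := by
  have h := integral_prod_mul (μ := (volume : Measure ℝ)) (ν := (volume : Measure ℝ))
    (fun x : ℝ => Complex.exp (-((x ^ p : ℝ) : ℂ))) (fun x : ℝ => Complex.exp (-((x ^ q : ℝ) : ℂ)))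
  rw [integral_exp_neg_pow hp2 hp, integral_exp_neg_pow hq2 hq] at h
  have e : ∫ z, psi0 p q z = ∫ z : ℝ × ℝ, Complex.exp (-((z.1 ^ p : ℝ) : ℂ)) *
      Complex.exp (-((z.2 ^ q : ℝ) : ℂ)) := by
    congr 1; ext z
    rw [← Complex.exp_add, psi0, FF]
    push_cast
    ring_nf
  rw [e, Measure.volume_eq_prod, h]
  push_cast; ring

lemma kk_norm {p q : ℕ} (hp2 : 2 ≤ p) (hq2 : 2 ≤ q) (hp : Even p) (hq : Even q)
    (hα : 1 / (p:ℝ) + 1 / (q:ℝ) < 1) :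
    ‖∫ z, kk p q z‖ = 4 * Real.Gamma (1 / (p:ℝ) + 1) * Real.Gamma (1 / (q:ℝ) + 1) := by
  have hp0 : (0:ℝ) < p := by exact_mod_cast (by omega : 0 < p)
  have hq0 : (0:ℝ) < q := by exact_mod_cast (by omega : 0 < q)
  have hpc : (p:ℂ) ≠ 0 := by exact_mod_cast (by omega : p ≠ 0)
  have hqc : (q:ℂ) ≠ 0 := by exact_mod_cast (by omega : q ≠ 0)
  have hg := psi0_good hp2 hq2 hp hq hα
  have hlim := asym hp2 hq2 hp hq hα hg
  have h00 : psi0 p q 0 = 1 := by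
    have hpn : p ≠ 0 := by omega
    have hqn : q ≠ 0 := by omega
    simp [psi0, FF, hpn, hqn]
  rw [h00, one_mul] at hlim
  set α : ℝ := 1 / (p:ℝ) + 1 / (q:ℝ) with hαd
  have hα0 : 0 < α := by positivity
  set J : ℝ → ℂ := fun τ => ∫ z, psi0 p q z * ee p q τ z with hJ
  have hne : ∀ τ : ℝ, (1 - Complex.I * τ : ℂ) ≠ 0 := by
    intro τ h
    have := congrArg Complex.re h
    simp at this
  have hJd : ∀ τ : ℝ, HasDerivAt J (Complex.I * α / (1 - Complex.I * τ) * J τ) τ := by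
    intro τ
    refine (deriv_J hg τ).congr_deriv ?_
    have h1 := ibp hp2 hq2 hp hq τ (hg.cd.differentiable (by norm_num)) hg.i0 hg.iF hg.iA hg.iB
    have h2 : ∫ z, dE p q (psi0 p q) z * ee p q τ z =
        - ∫ z, (FF p q z : ℂ) * psi0 p q z * ee p q τ z := by
      rw [← integral_neg]
      congr 1; ext z
      simp only [dE]
      rw [dA_psi0 hp2, dB_psi0 hq2]
      simp only [FF]; push_cast
      field_simp; ring
    rw [h2] at h1
    have h3 : (α : ℂ) = 1 / (p:ℂ) + 1 / (q:ℂ) := by simp [hαd]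
    rw [← h3] at h1
    have := hne τ
    simp only [hJ]
    generalize ∫ z, (FF p q z : ℂ) * psi0 p q z * ee p q τ z = X at *
    generalize ∫ z, psi0 p q z * ee p q τ z = Y at *
    field_simp
    linear_combination (-1) * h1
  set g : ℝ → ℂ := fun τ => J τ * (1 - Complex.I * τ) ^ (α : ℂ) with hgd
  have hgder : ∀ τ, HasDerivAt g 0 τ := by
    intro τ
    have h1 : HasDerivAt (fun τ : ℝ => (1 - Complex.I * τ : ℂ)) (-(Complex.I * 1)) τ :=
      ((Complex.ofRealCLM.hasDerivAt (x := τ)).const_mul Complex.I).const_sub 1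
    have h2 : HasDerivAt (fun τ : ℝ => (1 - Complex.I * τ : ℂ) ^ (α : ℂ))
        ((α : ℂ) * (1 - Complex.I * τ : ℂ) ^ ((α : ℂ) - 1) * (-(Complex.I * 1))) τ := by
      have h3 : HasDerivAt (fun z : ℂ => z ^ (α : ℂ))
          ((α : ℂ) * (1 - Complex.I * τ : ℂ) ^ ((α : ℂ) - 1)) (1 - Complex.I * τ : ℂ) := by
        have := (hasDerivAt_id (1 - Complex.I * τ : ℂ)).cpow_const (c := (α : ℂ)) (by
          left; simp)
        simpa using this
      exact h3.comp τ h1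
    refine ((hJd τ).mul h2).congr_deriv ?_
    rw [Complex.cpow_sub _ _ (hne τ), Complex.cpow_one]
    have := hne τ
    field_simp
    ring
  have hconst : ∀ τ, g τ = g 0 :=
    fun τ => is_const_of_deriv_eq_zero (fun t => (hgder t).differentiableAt)
      (fun t => (hgder t).deriv) τ 0
  have hJ0 : g 0 = ((4 * Real.Gamma (1 / (p:ℝ) + 1) * Real.Gamma (1 / (q:ℝ) + 1) : ℝ) : ℂ) := by
    rw [← psi0_integral hp2 hq2 hp hq]
    simp [hgd, hJ, ee]
  set C := 4 * Real.Gamma (1 / (p:ℝ) + 1) * Real.Gamma (1 / (q:ℝ) + 1)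
  have hC : 0 < C := by
    have := Real.Gamma_pos_of_pos (by positivity : 0 < 1 / (p:ℝ) + 1)
    have := Real.Gamma_pos_of_pos (by positivity : 0 < 1 / (q:ℝ) + 1)
    positivity
  have hnorm : ∀ τ > 0, ‖((τ ^ α : ℝ) : ℂ) * J τ‖ = (‖(1 - Complex.I * τ : ℂ)‖ / τ) ^ (-α) * C := by
    intro τ hτ
    have h1 : ‖g τ‖ = C := by rw [hconst, hJ0, Complex.norm_real, Real.norm_of_nonneg hC.le]
    simp only [hgd] at h1
    have hpos : 0 < ‖(1 - Complex.I * τ : ℂ)‖ := norm_pos_iff.2 (hne τ)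
    rw [norm_mul, Complex.norm_cpow_real] at h1
    rw [norm_mul, Complex.norm_real, Real.norm_of_nonneg (by positivity), ← h1,
      Real.rpow_neg (by positivity), Real.div_rpow (by positivity) hτ.le]
    have : 0 < ‖(1 - Complex.I * τ : ℂ)‖ ^ α := by positivity
    have : 0 < τ ^ α := by positivity
    field_simp
  have hl1 : Tendsto (fun τ : ℝ => ‖(1 - Complex.I * τ : ℂ)‖ / τ) atTop (𝓝 1) := by
    have h1 : Tendsto (fun τ : ℝ => ‖((τ⁻¹ : ℝ) : ℂ) - Complex.I‖) atTop (𝓝 ‖((0:ℝ) : ℂ) - Complex.I‖) := by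
      refine Tendsto.norm (Tendsto.sub_const ?_ _)
      exact (Complex.continuous_ofReal.tendsto _).comp tendsto_inv_atTop_zero
    simp only [Complex.ofReal_zero, zero_sub, norm_neg, Complex.norm_I] at h1
    refine h1.congr' ?_
    filter_upwards [eventually_gt_atTop 0] with τ hτ
    have hτc : (τ : ℂ) ≠ 0 := by exact_mod_cast hτ.ne'
    have hn : ‖(τ:ℂ)‖ = τ := by rw [Complex.norm_real, Real.norm_of_nonneg hτ.le]
    have h9 : ‖(1 - Complex.I * τ : ℂ) / (τ:ℂ)‖ = ‖(1 - Complex.I * τ : ℂ)‖ / τ := by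
      rw [norm_div, hn]
    rw [← h9]
    congr 1
    push_cast
    field_simp
  have hl2 : Tendsto (fun τ : ℝ => ‖((τ ^ α : ℝ) : ℂ) * J τ‖) atTop (𝓝 ((1:ℝ) ^ (-α) * C)) := by
    refine ((hl1.rpow_const (Or.inl one_ne_zero)).mul_const C).congr' ?_
    filter_upwards [eventually_gt_atTop 0] with τ hτ
    exact (hnorm τ hτ).symm
  have := tendsto_nhds_unique hlim.norm hl2
  rw [this, Real.one_rpow, one_mul]

lemma good_of_compact {p q : ℕ} {ψ : ℝ × ℝ → ℂ} (h : ContDiff ℝ 1 ψ)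
    (hs : HasCompactSupport ψ) : Good p q ψ := by
  have hF := FF_continuous p q
  have hA : HasCompactSupport (dA ψ) := by
    have : HasCompactSupport (fun z => fderiv ℝ ψ z (1,0)) := hs.fderiv_apply ℝ (1,0)
    exact this.mul_left
  have hB : HasCompactSupport (dB ψ) := by
    have : HasCompactSupport (fun z => fderiv ℝ ψ z (0,1)) := hs.fderiv_apply ℝ (0,1)
    exact this.mul_left
  have hcA := dA_continuous h
  have hcB := dB_continuous h
  have hc := h.continuous
  refine ⟨h, hc.bounded_above_of_compact_support hs, hcA.bounded_above_of_compact_support hA,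
    hcB.bounded_above_of_compact_support hB, hc.integrable_of_hasCompactSupport hs, ?_,
    hcA.integrable_of_hasCompactSupport hA, hcB.integrable_of_hasCompactSupport hB⟩
  refine Continuous.integrable_of_hasCompactSupport (by fun_prop) hs.mul_left

lemma dE_good {p q : ℕ} {ψ : ℝ × ℝ → ℂ} (h : ContDiff ℝ 2 ψ)
    (hs : HasCompactSupport ψ) : Good p q (dE p q ψ) := by
  have hA : HasCompactSupport (dA ψ) := by
    have : HasCompactSupport (fun z => fderiv ℝ ψ z (1,0)) := hs.fderiv_apply ℝ (1,0)
    exact this.mul_left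
  have hB : HasCompactSupport (dB ψ) := by
    have : HasCompactSupport (fun z => fderiv ℝ ψ z (0,1)) := hs.fderiv_apply ℝ (0,1)
    exact this.mul_left
  have hf : ContDiff ℝ 1 (fderiv ℝ ψ) := h.fderiv_right (by norm_num)
  have h1 : ContDiff ℝ 1 (fun z : ℝ × ℝ => (z.1 : ℂ)) :=
    Complex.ofRealCLM.contDiff.comp contDiff_fst
  have h2 : ContDiff ℝ 1 (fun z : ℝ × ℝ => (z.2 : ℂ)) :=
    Complex.ofRealCLM.contDiff.comp contDiff_snd
  refine good_of_compact ?_ ?_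
  · unfold dE dA dB
    exact ((h1.mul (hf.clm_apply contDiff_const)).div_const _).add
      ((h2.mul (hf.clm_apply contDiff_const)).div_const _)
  · have e : dE p q ψ = (fun z => dA ψ z * (p:ℂ)⁻¹) + (fun z => dB ψ z * (q:ℂ)⁻¹) := by
      ext z; simp [dE, div_eq_mul_inv]
    rw [e]
    exact (hA.mul_right (f' := fun _ => (p:ℂ)⁻¹)).add (hB.mul_right (f' := fun _ => (q:ℂ)⁻¹))

lemma J_props {p q : ℕ} (hp2 : 2 ≤ p) (hq2 : 2 ≤ q) (hp : Even p) (hq : Even q)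
    (hα : 1 / (p:ℝ) + 1 / (q:ℝ) < 1) {ψ : ℝ × ℝ → ℂ} (h : ContDiff ℝ 2 ψ)
    (hs : HasCompactSupport ψ) (h0 : ψ 0 = 1) :
    ∃ (J J' : ℝ → ℂ) (c : ℂ), (∀ τ, J τ = ∫ z, ψ z * ee p q τ z) ∧
      (∀ τ, HasDerivAt J (J' τ) τ) ∧
      ‖c‖ = 4 * Real.Gamma (1/(p:ℝ) + 1) * Real.Gamma (1/(q:ℝ) + 1) ∧
      Tendsto (fun τ : ℝ => ((τ ^ (1 / (p:ℝ) + 1 / (q:ℝ)) : ℝ) : ℂ) * J τ) atTop (𝓝 c) ∧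
      Tendsto (fun τ : ℝ => ((τ ^ (1 + (1 / (p:ℝ) + 1 / (q:ℝ))) : ℝ) : ℂ) * J' τ) atTop
        (𝓝 (-((1 / (p:ℝ) + 1 / (q:ℝ) : ℝ) : ℂ) * c)) := by
  have hg := good_of_compact (p := p) (q := q) (h.of_le (by norm_num)) hs
  have hg' := dE_good (p := p) (q := q) h hs
  have a1 := asym hp2 hq2 hp hq hα hg
  have a2 := asym hp2 hq2 hp hq hα hg'
  rw [h0, one_mul] at a1
  have h00 : dE p q ψ 0 = 0 := by simp [dE, dA, dB]
  rw [h00, zero_mul] at a2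
  refine ⟨fun τ => ∫ z, ψ z * ee p q τ z, _, ∫ z, kk p q z, fun τ => rfl, fun τ => deriv_J hg τ,
    kk_norm hp2 hq2 hp hq hα, a1, ?_⟩
  have a3 := (a1.const_mul (-((1 / (p:ℝ) + 1 / (q:ℝ) : ℝ) : ℂ))).sub a2
  rw [sub_zero] at a3
  refine a3.congr' ?_
  filter_upwards [eventually_gt_atTop 0] with τ hτ
  have := ibp hp2 hq2 hp hq τ (hg.cd.differentiable (by norm_num)) hg.i0 hg.iF hg.iA hg.iB
  rw [Real.rpow_add hτ 1 (1 / (p:ℝ) + 1 / (q:ℝ)), Real.rpow_one]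
  push_cast at this ⊢
  linear_combination (-((τ ^ (1 / (p:ℝ) + 1 / (q:ℝ)) : ℝ) : ℂ)) * this

lemma integral_E2 (G : E2 → ℂ) : ∫ v : E2, G v = ∫ z : ℝ × ℝ, G (pt z.1 z.2) := by
  have h1 := (EuclideanSpace.volume_preserving_symm_measurableEquiv_toLp (Fin 2)).symm
  have h2 := (volume_preserving_finTwoArrow ℝ).symm
  rw [← h1.integral_comp' (g := G), ← h2.integral_comp' ]
  rfl

lemma pt_contDiff : ContDiff ℝ (⊤ : ℕ∞) (fun z : ℝ × ℝ => pt z.1 z.2) := by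
  rw [contDiff_euclidean]
  intro i
  fin_cases i
  · exact contDiff_fst
  · exact contDiff_snd

lemma I_props {p q : ℕ} (hp2 : 2 ≤ p) (hq2 : 2 ≤ q) (hp : Even p) (hq : Even q)
    (hα : 1 / (p:ℝ) + 1 / (q:ℝ) < 1) (φ : E2 → ℝ)
    (hφ_smooth : ContDiff ℝ (⊤ : ℕ∞) φ)
    (hφ_supp : HasCompactSupport φ)
    (hφ_one : φ 0 = 1)
    (I : ℝ → ℂ)
    (hI : ∀ τ : ℝ, I τ = ∫ v : E2,
      Complex.exp (Complex.I * (τ:ℂ) * (((v 0) ^ p + (v 1) ^ q + 1 : ℝ) : ℂ)) * (φ v : ℂ)) :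
    ∃ (J J' : ℝ → ℂ) (c : ℂ), (∀ τ : ℝ, I τ = Complex.exp (Complex.I * τ) * J τ) ∧
      (∀ τ, HasDerivAt J (J' τ) τ) ∧
      ‖c‖ = 4 * Real.Gamma (1/(p:ℝ) + 1) * Real.Gamma (1/(q:ℝ) + 1) ∧
      Tendsto (fun τ : ℝ => ((τ ^ (1 / (p:ℝ) + 1 / (q:ℝ)) : ℝ) : ℂ) * J τ) atTop (𝓝 c) ∧
      Tendsto (fun τ : ℝ => ((τ ^ (1 + (1 / (p:ℝ) + 1 / (q:ℝ))) : ℝ) : ℂ) * J' τ) atTop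
        (𝓝 (-((1 / (p:ℝ) + 1 / (q:ℝ) : ℝ) : ℂ) * c)) := by
  have hcd : ContDiff ℝ 2 (fun z : ℝ × ℝ => ((φ (pt z.1 z.2) : ℝ) : ℂ)) := by
    have h1 : ContDiff ℝ (⊤ : ℕ∞) (fun z : ℝ × ℝ => φ (pt z.1 z.2)) := hφ_smooth.comp pt_contDiff
    exact (Complex.ofRealCLM.contDiff.comp h1).of_le (WithTop.coe_le_coe.2 (le_top : (2:ℕ∞) ≤ ⊤))
  have hs : HasCompactSupport (fun z : ℝ × ℝ => ((φ (pt z.1 z.2) : ℝ) : ℂ)) := by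
    have e : Topology.IsClosedEmbedding (fun z : ℝ × ℝ => pt z.1 z.2) := by
      refine Topology.IsClosedEmbedding.of_continuous_injective_isClosedMap ?_ ?_ ?_
      · exact pt_contDiff.continuous
      · intro a b hab
        have h0 := congrFun (congrArg WithLp.ofLp hab) 0
        have h1 := congrFun (congrArg WithLp.ofLp hab) 1
        exact Prod.ext h0 h1
      · intro S hS
        have : (fun z : ℝ × ℝ => pt z.1 z.2) '' S = (fun v : E2 => ((v 0, v 1) : ℝ × ℝ)) ⁻¹' S := by
          ext v
          constructor
          · rintro ⟨z, hz, rfl⟩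
            exact hz
          · intro hv
            refine ⟨(v 0, v 1), hv, ?_⟩
            ext i; fin_cases i <;> rfl
        rw [this]
        exact hS.preimage (by fun_prop)
    exact (hφ_supp.comp_isClosedEmbedding e).comp_left (g := fun x : ℝ => (x : ℂ)) (by simp)
  obtain ⟨J, J', c, h1, h2, h3, h4, h5⟩ := J_props hp2 hq2 hp hq hα hcd hs (by
    have : pt (0:ℝ×ℝ).1 (0:ℝ×ℝ).2 = 0 := by ext i; fin_cases i <;> rfl
    simp only [this, hφ_one]; simp)
  refine ⟨J, J', c, fun τ => ?_, h2, h3, h4, h5⟩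
  rw [hI, integral_E2, h1, ← integral_const_mul]
  congr 1; ext z
  have e0 : (pt z.1 z.2) 0 = z.1 := rfl
  have e1 : (pt z.1 z.2) 1 = z.2 := rfl
  rw [e0, e1]
  have : Complex.exp (Complex.I * (τ:ℂ) * ((z.1 ^ p + z.2 ^ q + 1 : ℝ) : ℂ)) =
      Complex.exp (Complex.I * τ) * ee p q τ z := by
    rw [ee, ← Complex.exp_add]
    congr 1
    simp only [FF]; push_cast; ring
  rw [this]; ring

/-- The spiral curve in the complex plane. -/
def gam (J : ℝ → ℂ) (τ : ℝ) : ℂ := Complex.exp (Complex.I * τ) * J τ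

lemma gam_norm (J : ℝ → ℂ) (τ : ℝ) : ‖gam J τ‖ = ‖J τ‖ := by
  rw [gam, norm_mul, mul_comm Complex.I, Complex.norm_exp_ofReal_mul_I, one_mul]

/-- angular measure of a set at radius `r` -/
def angm (S : Set ℂ) (r : ℝ) : ℝ≥0∞ :=
  volume {θ : ℝ | θ ∈ Ioo (-Real.pi) Real.pi ∧ Complex.polarCoord.symm (r, θ) ∈ S}

lemma polar_exp (r θ : ℝ) : Complex.polarCoord.symm (r, θ) = r * Complex.exp (Complex.I * θ) := by
  rw [Complex.polarCoord_symm_apply, mul_comm Complex.I, Complex.exp_mul_I]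
  simp

lemma angm_le (S : Set ℂ) (r : ℝ) : angm S r ≤ ENNReal.ofReal (2 * Real.pi) := by
  unfold angm
  refine (measure_mono (fun θ h => h.1)).trans ?_
  rw [Real.volume_Ioo]
  apply ENNReal.ofReal_le_ofReal; linarith

lemma angm_eq {S : Set ℂ} (hS : MeasurableSet S) (z : ℂ) :
    angm S ‖z‖ = volume {s : ℝ | s ∈ Ioc (-Real.pi) Real.pi ∧ Complex.exp (Complex.I * s) * z ∈ S} := by
  set A : Set ℝ := {θ : ℝ | (‖z‖ : ℂ) * Complex.exp (Complex.I * θ) ∈ S} with hA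
  have hAm : MeasurableSet A := by
    have : Continuous (fun θ : ℝ => (‖z‖ : ℂ) * Complex.exp (Complex.I * θ)) := by fun_prop
    exact this.measurable hS
  have h1 : angm S ‖z‖ = volume (A ∩ Ioc (-Real.pi) (-Real.pi + 2 * Real.pi)) := by
    unfold angm
    have e : {θ : ℝ | θ ∈ Ioo (-Real.pi) Real.pi ∧ Complex.polarCoord.symm (‖z‖, θ) ∈ S}
        = A ∩ Ioo (-Real.pi) Real.pi := by
      ext θ
      simp only [mem_setOf_eq, polar_exp, hA, mem_inter_iff]
      tauto
    rw [e, show -Real.pi + 2 * Real.pi = Real.pi by ring]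
    exact measure_congr (Filter.EventuallyEq.rfl.inter Ioo_ae_eq_Ioc)
  have hper : ∀ g : AddSubgroup.zmultiples (2 * Real.pi), (fun x : ℝ => g +ᵥ x) ⁻¹' A = A := by
    rintro ⟨g, n, rfl⟩
    ext x
    simp only [mem_preimage, hA, mem_setOf_eq]
    have : Complex.exp (Complex.I * (((⟨n • (2 * Real.pi), n, rfl⟩ :
        AddSubgroup.zmultiples (2 * Real.pi)) +ᵥ x : ℝ) : ℂ)) = Complex.exp (Complex.I * x) := by
      rw [AddSubgroup.vadd_def, Complex.exp_eq_exp_iff_exists_int]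
      refine ⟨n, ?_⟩
      simp only [vadd_eq_add, zsmul_eq_mul]
      push_cast
      ring
    rw [← this]
  have h2 := (isAddFundamentalDomain_Ioc Real.two_pi_pos (-Real.pi) volume).measure_set_eq
    (isAddFundamentalDomain_Ioc Real.two_pi_pos (-Real.pi + Complex.arg z) volume) hAm hper
  rw [h1, h2]
  have h3 : {s : ℝ | s ∈ Ioc (-Real.pi) Real.pi ∧ Complex.exp (Complex.I * s) * z ∈ S} =
      (fun s => s + Complex.arg z) ⁻¹'
        (A ∩ Ioc (-Real.pi + Complex.arg z) (-Real.pi + Complex.arg z + 2 * Real.pi)) := by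
    ext s
    simp only [mem_setOf_eq, mem_preimage, mem_inter_iff, hA, mem_Ioc]
    have : (‖z‖ : ℂ) * Complex.exp (Complex.I * ((s + Complex.arg z : ℝ) : ℂ)) =
        Complex.exp (Complex.I * s) * z := by
      conv_rhs => rw [← Complex.norm_mul_exp_arg_mul_I z]
      push_cast
      rw [mul_add, Complex.exp_add, mul_comm (Complex.arg z : ℂ)]
      ring
    rw [this]
    constructor
    · rintro ⟨⟨a, b⟩, c⟩; exact ⟨c, by linarith, by linarith⟩
    · rintro ⟨c, a, b⟩; exact ⟨⟨by linarith, by linarith⟩, c⟩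
  rw [h3, measure_preimage_add_right]

lemma vol_mod_le {b : ℝ} {A : Set ℝ} (hA : ∀ s ∈ A, s ∈ Ioc (-Real.pi) Real.pi ∧
    ∃ k : ℤ, |s + 2 * Real.pi * k| ≤ b) : volume A ≤ ENNReal.ofReal (2 * b) := by
  by_cases hb : Real.pi ≤ b
  · refine (measure_mono (fun s hs => (hA s hs).1)).trans ?_
    rw [Real.volume_Ioc]
    apply ENNReal.ofReal_le_ofReal; linarith
  · push Not at hb
    have : A ⊆ Icc (-b) b := by
      intro s hs
      obtain ⟨⟨h1, h2⟩, k, hk⟩ := hA s hs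
      have hπ := Real.pi_pos
      rw [abs_le] at hk
      have hk0 : k = 0 := by
        have h3 : (k:ℝ) < 1 := by
          by_contra h; push Not at h
          nlinarith
        have h4 : (-1:ℝ) < k := by
          by_contra h; push Not at h
          nlinarith
        have h3' : k < 1 := by exact_mod_cast h3
        have h4' : -1 < k := by exact_mod_cast h4
        omega
      simp only [hk0, Int.cast_zero, mul_zero, add_zero] at hk
      exact hk
    refine (measure_mono this).trans ?_
    rw [Real.volume_Icc]
    apply ENNReal.ofReal_le_ofReal; linarith

lemma exists_mod (u : ℝ) : ∃ n : ℤ, |u - 2 * Real.pi * n| ≤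
    Real.pi / 2 * ‖Complex.exp (Complex.I * u) - 1‖ := by
  refine ⟨round (u / (2 * Real.pi)), ?_⟩
  set n := round (u / (2 * Real.pi))
  have hπ := Real.pi_pos
  have h1 := abs_sub_round (u / (2 * Real.pi))
  have h2 : |u - 2 * Real.pi * n| ≤ Real.pi := by
    have : u - 2 * Real.pi * n = (u / (2 * Real.pi) - n) * (2 * Real.pi) := by field_simp
    rw [this, abs_mul, abs_of_pos Real.two_pi_pos]
    nlinarith
  have h3 : Complex.exp (Complex.I * u) = Complex.exp (Complex.I * ((u - 2 * Real.pi * n : ℝ) : ℂ)) := by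
    rw [Complex.exp_eq_exp_iff_exists_int]
    exact ⟨n, by push_cast; ring⟩
  rw [h3, Complex.norm_exp_I_mul_ofReal_sub_one]
  set δ := u - 2 * Real.pi * n
  have h4 : |δ / 2| ≤ Real.pi / 2 := by
    rw [abs_div, abs_two]; linarith
  have h5 := Real.mul_abs_le_abs_sin h4
  rw [abs_div, abs_two] at h5
  rw [Real.norm_eq_abs, abs_mul, abs_two]
  have : |δ| = Real.pi / 2 * (2 * (2 / Real.pi * (|δ| / 2))) := by field_simp
  rw [this]
  gcongr

lemma rpow_diff {a x y m : ℝ} (ha : 0 < a) (hm : 0 < m) (hx : m ≤ x) (hy : m ≤ y) :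
    |x ^ (-a) - y ^ (-a)| ≤ a * m ^ (-a - 1) * |x - y| := by
  have := Convex.norm_image_sub_le_of_norm_hasDerivWithin_le (𝕜 := ℝ)
    (f := fun x : ℝ => x ^ (-a)) (f' := fun x => (-a) * x ^ (-a - 1)) (s := Ici m)
    (C := a * m ^ (-a - 1)) (x := y) (y := x)
    (fun t ht => (Real.hasDerivAt_rpow_const (Or.inl (hm.trans_le ht).ne')).hasDerivWithinAt) ?_
    (convex_Ici m) hy hx
  · simpa [Real.norm_eq_abs] using this
  · intro t ht
    have ht0 : 0 < t := hm.trans_le ht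
    rw [norm_mul, norm_neg, Real.norm_of_nonneg ha.le, Real.norm_of_nonneg (by positivity)]
    exact mul_le_mul_of_nonneg_left (Real.rpow_le_rpow_of_nonpos hm ht (by linarith)) ha.le

lemma angm_upper {J : ℝ → ℂ} {α ω₁ T₁ M σ ε τ₁ : ℝ} (hα : 0 < α) (hω : 0 < ω₁) (hM0 : 0 ≤ M)
    (hJ : 0 < ‖J σ‖)
    (hM : ∀ σ ≥ T₁, ∀ τ ≥ T₁, ‖J σ - J τ‖ ≤ M * |‖J σ‖ - ‖J τ‖|)
    (hw : ∀ σ ≥ T₁, ∀ τ ≥ T₁, ω₁ * |σ - τ| ≤ |‖J σ‖ ^ (-(1/α)) - ‖J τ‖ ^ (-(1/α))|)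
    (hσ : T₁ ≤ σ) (hε : 0 < ε) (hεr : ε ≤ ‖J σ‖ / 2)
    (hτ : ∀ τ ≥ τ₁, ‖J τ‖ < ‖J σ‖ + ε → T₁ ≤ τ) :
    angm (thickening ε (gam J '' Ici τ₁)) ‖J σ‖ ≤
      ENNReal.ofReal (2 * (1 / (α * ω₁) * ε * (‖J σ‖ - ε) ^ (-(1/α) - 1)
        + Real.pi / 2 * (1 + M) * ε / ‖J σ‖)) := by
  rw [← gam_norm, angm_eq isOpen_thickening.measurableSet, gam_norm]
  apply vol_mod_le
  rintro s ⟨hs1, hs2⟩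
  refine ⟨hs1, ?_⟩
  rw [mem_thickening_iff] at hs2
  obtain ⟨_, ⟨τ, hττ, rfl⟩, hd⟩ := hs2
  rw [dist_eq_norm] at hd
  have hnn : |‖J σ‖ - ‖J τ‖| < ε := by
    have h1 := abs_norm_sub_norm_le (Complex.exp (Complex.I * s) * gam J σ) (gam J τ)
    rw [norm_mul, mul_comm Complex.I, Complex.norm_exp_ofReal_mul_I, one_mul, gam_norm, gam_norm,
      mul_comm (s:ℂ)] at h1
    exact h1.trans_lt hd
  have hnn' := abs_lt.1 hnn
  have hτT : T₁ ≤ τ := hτ τ hττ (by linarith)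
  have hD : |σ - τ| ≤ 1 / (α * ω₁) * ε * (‖J σ‖ - ε) ^ (-(1/α) - 1) := by
    have h1 := hw σ hσ τ hτT
    have h2 := rpow_diff (a := 1/α) (m := ‖J σ‖ - ε) (x := ‖J σ‖) (y := ‖J τ‖) (by positivity)
      (by linarith) (by linarith) (by linarith)
    have h3 : 0 ≤ 1 / α * (‖J σ‖ - ε) ^ (-(1/α) - 1) := by
      have : 0 ≤ ‖J σ‖ - ε := by linarith
      positivity
    have h4 : ω₁ * |σ - τ| ≤ 1 / α * (‖J σ‖ - ε) ^ (-(1/α) - 1) * ε :=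
      (h1.trans h2).trans (mul_le_mul_of_nonneg_left hnn.le h3)
    have h5 : 1 / (α * ω₁) * ε * (‖J σ‖ - ε) ^ (-(1/α) - 1)
        = (1 / α * (‖J σ‖ - ε) ^ (-(1/α) - 1) * ε) / ω₁ := by field_simp
    rw [h5, le_div_iff₀ hω]; linarith
  obtain ⟨n, hn⟩ := exists_mod (s + σ - τ)
  refine ⟨-n, ?_⟩
  have hang : ‖Complex.exp (Complex.I * ((s + σ - τ : ℝ) : ℂ)) - 1‖ ≤ (1 + M) * ε / ‖J σ‖ := by
    rw [le_div_iff₀ hJ, ← norm_mul]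
    have h1 : (Complex.exp (Complex.I * ((s + σ - τ : ℝ) : ℂ)) - 1) * J σ =
        Complex.exp (Complex.I * ((-τ : ℝ) : ℂ)) *
          ((Complex.exp (Complex.I * s) * gam J σ - gam J τ)) - (J σ - J τ) := by
      simp only [gam]
      have e1 : Complex.exp (Complex.I * ((s + σ - τ : ℝ) : ℂ)) =
        Complex.exp (Complex.I * ((-τ : ℝ) : ℂ)) * Complex.exp (Complex.I * s) * Complex.exp (Complex.I * σ) := by
        rw [← Complex.exp_add, ← Complex.exp_add]; congr 1; push_cast; ring
      have e2 : Complex.exp (Complex.I * ((-τ : ℝ) : ℂ)) * Complex.exp (Complex.I * τ) = 1 := by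
        rw [← Complex.exp_add]; simp
      rw [e1]
      linear_combination (J τ) * e2
    rw [h1]
    refine (norm_sub_le _ _).trans ?_
    rw [norm_mul, mul_comm Complex.I ((-τ : ℝ) : ℂ), Complex.norm_exp_ofReal_mul_I, one_mul]
    have h2 := hM σ hσ τ hτT
    have h3 : M * |‖J σ‖ - ‖J τ‖| ≤ M * ε := mul_le_mul_of_nonneg_left hnn.le hM0
    linarith
  have h6 : s + 2 * Real.pi * ((-n : ℤ) : ℝ) = (s + σ - τ - 2 * Real.pi * n) - (σ - τ) := by
    push_cast; ring
  rw [h6]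
  refine (abs_sub _ _).trans ?_
  have h7 : Real.pi / 2 * (1 + M) * ε / ‖J σ‖ = Real.pi / 2 * ((1 + M) * ε / ‖J σ‖) := by ring
  rw [h7]
  have h8 : Real.pi / 2 * ‖Complex.exp (Complex.I * ((s + σ - τ : ℝ) : ℂ)) - 1‖ ≤
    Real.pi / 2 * ((1 + M) * ε / ‖J σ‖) := by
    have := Real.pi_pos
    gcongr
  linarith

lemma angm_lower {J : ℝ → ℂ} {P σ ε τ₁ : ℝ} (hP : 0 < P)
    (hlow : ∀ s : ℝ, |s| ≤ Real.pi → ‖J σ - J (σ + s)‖ ≤ P * |s|)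
    (hσ : τ₁ + Real.pi ≤ σ) :
    ENNReal.ofReal (min (2 * Real.pi) (2 * (ε / P))) ≤
      angm (thickening ε (gam J '' Ici τ₁)) ‖J σ‖ := by
  rw [← gam_norm, angm_eq isOpen_thickening.measurableSet]
  set c := min Real.pi (ε / P) with hc
  have hsub : Ioo (-c) c ⊆ {s : ℝ | s ∈ Ioc (-Real.pi) Real.pi ∧
      Complex.exp (Complex.I * s) * gam J σ ∈ thickening ε (gam J '' Ici τ₁)} := by
    rintro s ⟨h1, h2⟩
    have hcπ : c ≤ Real.pi := min_le_left _ _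
    have habs : |s| < c := abs_lt.2 ⟨h1, h2⟩
    refine ⟨⟨by linarith, by linarith⟩, ?_⟩
    rw [mem_thickening_iff]
    refine ⟨gam J (σ + s), ⟨σ + s, ?_, rfl⟩, ?_⟩
    · have : -Real.pi ≤ s := by linarith
      simp only [mem_Ici]; linarith
    · rw [dist_eq_norm]
      have e : Complex.exp (Complex.I * s) * gam J σ - gam J (σ + s) =
          Complex.exp (Complex.I * ((σ + s : ℝ) : ℂ)) * (J σ - J (σ + s)) := by
        simp only [gam]; push_cast; rw [mul_add, Complex.exp_add]; ring
      rw [e, norm_mul, mul_comm Complex.I, Complex.norm_exp_ofReal_mul_I, one_mul]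
      refine (hlow s (by linarith)).trans_lt ?_
      have : |s| < ε / P := habs.trans_le (min_le_right _ _)
      rw [lt_div_iff₀ hP] at this
      linarith
  refine le_trans (le_of_eq ?_) (measure_mono hsub)
  rw [Real.volume_Ioo]
  congr 1
  rw [hc, ← mul_min_of_nonneg _ _ (by norm_num : (0:ℝ) ≤ 2)]
  ring

lemma vol_polar {S : Set ℂ} (hS : MeasurableSet S) :
    volume S = ∫⁻ r in Ioi (0:ℝ), ENNReal.ofReal r * angm S r := by
  have h1 := Complex.lintegral_comp_polarCoord_symm (S.indicator (fun _ => (1:ℝ≥0∞)))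
  rw [lintegral_indicator hS, lintegral_const, one_mul, Measure.restrict_apply_univ] at h1
  rw [← h1, polarCoord_target, Measure.volume_eq_prod, ← Measure.prod_restrict]
  have hm : Measurable (fun p : ℝ × ℝ => Complex.polarCoord.symm p) := by
    have : (fun p : ℝ × ℝ => Complex.polarCoord.symm p) =
      fun p : ℝ × ℝ => (p.1 : ℂ) * Complex.exp (Complex.I * p.2) := by
      ext p; exact polar_exp p.1 p.2
    rw [this]; fun_prop
  have hm2 : Measurable (fun p : ℝ × ℝ => ENNReal.ofReal p.1 •
      S.indicator (fun _ => (1:ℝ≥0∞)) (Complex.polarCoord.symm p)) := by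
    refine Measurable.smul (ENNReal.measurable_ofReal.comp measurable_fst) ?_
    exact (measurable_const.indicator hS).comp hm
  rw [lintegral_prod _ hm2.aemeasurable]
  refine lintegral_congr fun r => ?_
  simp only [smul_eq_mul]
  have hm3 : MeasurableSet {θ : ℝ | Complex.polarCoord.symm (r, θ) ∈ S} :=
    hm.comp (measurable_const.prodMk measurable_id) hS
  rw [lintegral_const_mul _ ?_]
  · congr 1
    have : (fun θ : ℝ => S.indicator (fun _ => (1:ℝ≥0∞)) (Complex.polarCoord.symm (r, θ))) =
        {θ : ℝ | Complex.polarCoord.symm (r, θ) ∈ S}.indicator (fun _ => 1) := by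
      ext θ; simp [indicator]
    rw [this, lintegral_indicator hm3, lintegral_const, one_mul, Measure.restrict_apply_univ,
      Measure.restrict_apply hm3, angm]
    congr 1
    ext θ
    simp only [mem_inter_iff, mem_ofPred_eq]
    tauto
  · exact (measurable_const.indicator hS).comp (hm.comp (measurable_const.prodMk measurable_id))

lemma vol_scaled {S : Set ℂ} (hS : MeasurableSet S) {l : ℝ} (hl : 0 < l) :
    volume S / ENNReal.ofReal (l ^ 2) = ∫⁻ x in Ioi (0:ℝ), ENNReal.ofReal x * angm S (l * x) := by
  have h1 := Measure.addHaar_preimage_smul (volume : Measure ℂ) hl.ne' S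
  rw [Complex.finrank_real_complex, abs_of_pos (by positivity)] at h1
  have hS' : MeasurableSet ((fun z : ℂ => l • z) ⁻¹' S) := measurable_const_smul l hS
  have h2 := vol_polar hS'
  have h3 : ∀ x, angm ((fun z : ℂ => l • z) ⁻¹' S) x = angm S (l * x) := by
    intro x
    unfold angm
    congr 1
    ext θ
    simp only [mem_ofPred_eq, mem_preimage, polar_exp, Complex.real_smul]
    push_cast
    rw [mul_assoc]
  simp only [h3] at h2
  rw [← h2]
  erw [h1]
  rw [ENNReal.ofReal_inv_of_pos (by positivity), ENNReal.div_eq_inv_mul]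

lemma angm_measurable {S : Set ℂ} (hS : MeasurableSet S) : Measurable (angm S) := by
  have hm : Measurable (fun p : ℝ × ℝ => Complex.polarCoord.symm p) := by
    have : (fun p : ℝ × ℝ => Complex.polarCoord.symm p) =
      fun p : ℝ × ℝ => (p.1 : ℂ) * Complex.exp (Complex.I * p.2) := by
      ext p; exact polar_exp p.1 p.2
    rw [this]; fun_prop
  have h : MeasurableSet {p : ℝ × ℝ | p.2 ∈ Ioo (-Real.pi) Real.pi ∧ Complex.polarCoord.symm p ∈ S} :=
    (measurable_snd measurableSet_Ioo).inter (hm hS)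
  exact measurable_measure_prodMk_left h

/-- Abstract properties of the modulus and of the speed of a power spiral. -/
structure Spir (α ω T M : ℝ) (J : ℝ → ℂ) : Prop where
  cont : Continuous J
  ne : ∀ τ ≥ T, 0 < ‖J τ‖
  anti : StrictAntiOn (fun τ => ‖J τ‖) (Ici T)
  lim : Tendsto (fun τ => ‖J τ‖) atTop (𝓝 0)
  hM0 : 0 ≤ M
  hM : ∀ σ ≥ T, ∀ τ ≥ T, ‖J σ - J τ‖ ≤ M * |‖J σ‖ - ‖J τ‖|
  hw0 : ∀ σ ≥ T, ∀ τ ≥ T, ω / 2 * |σ - τ| ≤ |‖J σ‖ ^ (-(1/α)) - ‖J τ‖ ^ (-(1/α))|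
  hw : ∀ ω₁ < ω, ∃ T₁ ≥ T, ∀ σ ≥ T₁, ∀ τ ≥ T₁,
    ω₁ * |σ - τ| ≤ |‖J σ‖ ^ (-(1/α)) - ‖J τ‖ ^ (-(1/α))|
  hlow : ∀ v > α * ω, ∀ᶠ σ in atTop, ∀ s : ℝ, |s| ≤ Real.pi →
    ‖J σ - J (σ + s)‖ ≤ v * ‖J σ‖ ^ (1 + 1/α) * |s|

lemma Spir.exists_param {α ω T M : ℝ} {J : ℝ → ℂ} (h : Spir α ω T M J) {S r : ℝ} (hS : T ≤ S)
    (hr0 : 0 < r) (hr : r ≤ ‖J S‖) : ∃ σ ≥ S, ‖J σ‖ = r := by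
  obtain ⟨N, hN⟩ := ((h.lim.eventually (gt_mem_nhds hr0)).and (eventually_ge_atTop S)).exists
  have := intermediate_value_Icc' hN.2 (f := fun τ => ‖J τ‖) h.cont.norm.continuousOn
  obtain ⟨σ, hσ, e⟩ := this ⟨hN.1.le, hr⟩
  exact ⟨σ, hσ.1, e⟩

lemma Spir.dom {α ω T M : ℝ} {J : ℝ → ℂ} (h : Spir α ω T M J) (hα : 0 < α) (hω : 0 < ω) :
    ∃ K > 0, ∀ τ₁ ≥ T, ∀ r > 0, r ≤ ‖J T‖ → ∀ ε > 0,
      angm (thickening ε (gam J '' Ici τ₁)) r ≤ ENNReal.ofReal (K * (ε * r ^ (-(1 + 1/α)))) := by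
  have hT0 := h.ne T le_rfl
  have hM0 := h.hM0
  have hπ := Real.pi_pos
  set R := ‖J T‖ ^ (1/α) with hR
  have hR0 : 0 < R := by positivity
  set K1 := 2 * (1 / (α * (ω/2)) * 2 ^ (1 + 1/α) + Real.pi / 2 * (1 + M) * R) with hK1
  set K2 := 4 * Real.pi * R with hK2
  have hK10 : 0 < K1 := by positivity
  have hK20 : 0 < K2 := by positivity
  refine ⟨K1 + K2, by positivity, fun τ₁ hτ₁ r hr0 hr ε hε => ?_⟩
  have hX : 0 < ε * r ^ (-(1 + 1/α)) := by positivity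
  have hrR : ε / r ≤ R * (ε * r ^ (-(1 + 1/α))) := by
    have e : r ^ (-(1 + 1/α)) = r⁻¹ * (r ^ (1/α))⁻¹ := by
      rw [Real.rpow_neg hr0.le, Real.rpow_add hr0, Real.rpow_one, mul_inv]
    have h1 : r ^ (1/α) ≤ R := Real.rpow_le_rpow hr0.le hr (by positivity)
    have h2 : 0 < r ^ (1/α) := by positivity
    rw [e]
    have : R * (ε * (r⁻¹ * (r ^ (1/α))⁻¹)) = ε / r * (R / r ^ (1/α)) := by field_simp
    rw [this]
    have h3 : 1 ≤ R / r ^ (1/α) := (one_le_div h2).2 h1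
    have h4 : 0 < ε / r := by positivity
    nlinarith
  by_cases hc : ε ≤ r / 2
  · obtain ⟨σ, hσ, hσr⟩ := h.exists_param le_rfl hr0 hr
    subst hσr
    have := angm_upper (τ₁ := τ₁) hα (by positivity : 0 < ω/2) hM0 hr0 h.hM h.hw0 hσ hε hc
      (fun τ hτ _ => hτ₁.trans hτ)
    refine this.trans (ENNReal.ofReal_le_ofReal ?_)
    have h5 : (‖J σ‖ - ε) ^ (-(1/α) - 1) ≤ 2 ^ (1 + 1/α) * ‖J σ‖ ^ (-(1 + 1/α)) := by
      have : -(1/α) - 1 = -(1 + 1/α) := by ring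
      rw [this]
      have h6 : (2:ℝ) ^ (1 + 1/α) * ‖J σ‖ ^ (-(1 + 1/α)) = (‖J σ‖ / 2) ^ (-(1 + 1/α)) := by
        rw [Real.div_rpow hr0.le (by norm_num), Real.rpow_neg (by norm_num : (0:ℝ) ≤ 2), div_inv_eq_mul,
          mul_comm]
      rw [h6]
      refine Real.rpow_le_rpow_of_nonpos (by positivity) (by linarith) ?_
      have : 0 < 1 + 1/α := by positivity
      linarith
    have h7 : 1 / (α * (ω/2)) * ε * (‖J σ‖ - ε) ^ (-(1/α) - 1) ≤
        1 / (α * (ω/2)) * ε * (2 ^ (1 + 1/α) * ‖J σ‖ ^ (-(1 + 1/α))) := by gcongr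
    have h8 : Real.pi / 2 * (1 + M) * ε / ‖J σ‖ ≤
        Real.pi / 2 * (1 + M) * (R * (ε * ‖J σ‖ ^ (-(1 + 1/α)))) := by
      rw [mul_div_assoc]; gcongr
    calc _ ≤ K1 * (ε * ‖J σ‖ ^ (-(1 + 1/α))) := by rw [hK1]; linarith
      _ ≤ _ := by gcongr; linarith
  · push Not at hc
    refine (angm_le _ _).trans (ENNReal.ofReal_le_ofReal ?_)
    have h9 : 1 ≤ 2 * (ε / r) := by
      rw [← mul_div_assoc, le_div_iff₀ hr0]; linarith
    calc 2 * Real.pi ≤ 2 * Real.pi * (2 * (ε / r)) := by nlinarith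
      _ ≤ 2 * Real.pi * (2 * (R * (ε * r ^ (-(1 + 1/α))))) := by gcongr
      _ = K2 * (ε * r ^ (-(1 + 1/α))) := by rw [hK2]; ring
      _ ≤ _ := by gcongr; linarith

lemma Spir.zero {α ω T M : ℝ} {J : ℝ → ℂ} (h : Spir α ω T M J) {τ₁ r ε : ℝ} (hτ₁ : T + 1 ≤ τ₁)
    (hr : ‖J T‖ < r) (hε : ε < ‖J T‖ - ‖J (T+1)‖) :
    angm (thickening ε (gam J '' Ici τ₁)) r = 0 := by
  unfold angm
  convert measure_empty (μ := (volume : Measure ℝ))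
  rw [eq_empty_iff_forall_notMem]
  rintro θ ⟨_, hθ⟩
  rw [mem_thickening_iff] at hθ
  obtain ⟨_, ⟨τ, hτ, rfl⟩, hd⟩ := hθ
  rw [dist_eq_norm] at hd
  have h1 := (norm_sub_norm_le (Complex.polarCoord.symm (r, θ)) (gam J τ)).trans_lt hd
  have h0 : 0 ≤ ‖J T‖ := norm_nonneg _
  rw [gam_norm, Complex.norm_polarCoord_symm, abs_of_pos (h0.trans_lt hr)] at h1
  have hτ' : τ₁ ≤ τ := hτ
  have h2 : ‖J τ‖ ≤ ‖J (T+1)‖ := h.anti.antitoneOn (by simp) (by simp; linarith) (by linarith)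
  linarith

lemma kap_scale {α ε x : ℝ} (hα : 0 < α) (hε : 0 < ε) (hx : 0 < x) :
    ε * (ε ^ (α/(1+α)) * x) ^ (-(1 + 1/α)) = x ^ (-(1 + 1/α)) := by
  rw [Real.mul_rpow (by positivity) hx.le, ← Real.rpow_mul hε.le]
  have : α/(1+α) * -(1 + 1/α) = -1 := by field_simp; ring
  rw [this, Real.rpow_neg_one]
  field_simp

lemma kap_tendsto {α x : ℝ} (hα : 0 < α) : 
    Tendsto (fun ε : ℝ => ε ^ (α/(1+α)) * x) (𝓝[>] 0) (𝓝 0) := by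
  have h := (Real.continuousAt_rpow_const (0:ℝ) (α/(1+α)) (Or.inr (by positivity))).tendsto
  rw [Real.zero_rpow (by positivity)] at h
  simpa using (h.mono_left nhdsWithin_le_nhds).mul_const x

lemma kap_ratio {α x : ℝ} (hα : 0 < α) (hx : 0 < x) : 
    Tendsto (fun ε : ℝ => ε / (ε ^ (α/(1+α)) * x)) (𝓝[>] 0) (𝓝 0) := by
  have h := (Real.continuousAt_rpow_const (0:ℝ) (1/(1+α)) (Or.inr (by positivity))).tendsto
  rw [Real.zero_rpow (by positivity)] at h
  have h2 := (h.mono_left (nhdsWithin_le_nhds (s := Ioi 0))).div_const x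
  rw [zero_div] at h2
  refine h2.congr' ?_
  filter_upwards [self_mem_nhdsWithin] with ε hε
  have hε : 0 < ε := hε
  have e : ε = ε ^ (1/(1+α)) * ε ^ (α/(1+α)) := by
    rw [← Real.rpow_add hε]
    have : 1/(1+α) + α/(1+α) = 1 := by field_simp
    rw [this, Real.rpow_one]
  have : 0 < ε ^ (α/(1+α)) := by positivity
  field_simp
  exact e.symm

lemma Spir.pointwise {α ω T M : ℝ} {J : ℝ → ℂ} (h : Spir α ω T M J) (hα : 0 < α) (hω : 0 < ω)
    {τ₁ : ℝ} (hτ₁ : T ≤ τ₁) {x : ℝ} (hx : 0 < x) :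
    Tendsto (fun ε : ℝ => angm (thickening ε (gam J '' Ici τ₁)) (ε ^ (α/(1+α)) * x)) (𝓝[>] 0)
      (𝓝 (ENNReal.ofReal (min (2 * Real.pi) (2 / (α * ω) * x ^ (-(1 + 1/α)))))) := by
  set X := x ^ (-(1 + 1/α)) with hX
  have hX0 : 0 < X := by positivity
  have hκ := kap_tendsto (x := x) hα
  have hrat := kap_ratio hα hx
  have hpos : ∀ᶠ ε : ℝ in 𝓝[>] 0, 0 < ε := self_mem_nhdsWithin
  have hid : Tendsto (fun ε : ℝ => ε) (𝓝[>] 0) (𝓝 0) := nhdsWithin_le_nhds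
  rw [tendsto_order]
  constructor
  · intro a ha
    have hc : Tendsto (fun v : ℝ => ENNReal.ofReal (min (2 * Real.pi) (2 / v * X))) (𝓝[>] (α * ω))
        (𝓝 (ENNReal.ofReal (min (2 * Real.pi) (2 / (α * ω) * X)))) := by
      refine ENNReal.tendsto_ofReal (Tendsto.min tendsto_const_nhds ?_)
      refine Tendsto.mul_const _ (Tendsto.div tendsto_const_nhds nhdsWithin_le_nhds (by positivity))
    obtain ⟨v, hva, hv⟩ := ((hc.eventually (lt_mem_nhds ha)).and self_mem_nhdsWithin).exists
    have hv : α * ω < v := hv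
    have hv0 : 0 < v := lt_trans (by positivity) hv
    obtain ⟨N0, hN0⟩ := eventually_atTop.1 (h.hlow v hv)
    set N := max N0 (max T (τ₁ + Real.pi)) with hN
    have hNT : T ≤ N := (le_max_left _ _).trans (le_max_right _ _)
    have hNτ : τ₁ + Real.pi ≤ N := (le_max_right _ _).trans (le_max_right _ _)
    filter_upwards [hpos, hκ.eventually (gt_mem_nhds (h.ne N hNT))] with ε hε hr
    have hr0 : 0 < ε ^ (α/(1+α)) * x := by positivity
    obtain ⟨σ, hσ, hσr⟩ := h.exists_param hNT hr0 hr.le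
    have h1 := angm_lower (ε := ε) (τ₁ := τ₁) (P := v * ‖J σ‖ ^ (1 + 1/α)) 
      (by rw [hσr]; positivity) (hN0 σ ((le_max_left _ _).trans hσ)) (hNτ.trans hσ)
    rw [hσr] at h1
    refine hva.trans_le (le_trans (le_of_eq ?_) h1)
    congr 2
    have e := kap_scale hα hε hx
    rw [hX, ← e, Real.rpow_neg hr0.le]
    have : 0 < (ε ^ (α/(1+α)) * x) ^ (1 + 1/α) := by positivity
    field_simp
  · intro b hb
    have hc : Tendsto (fun v : ℝ => ENNReal.ofReal (min (2 * Real.pi) (2 / (α * v) * X))) (𝓝[<] ω)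
        (𝓝 (ENNReal.ofReal (min (2 * Real.pi) (2 / (α * ω) * X)))) := by
      refine ENNReal.tendsto_ofReal (Tendsto.min tendsto_const_nhds ?_)
      refine Tendsto.mul_const _ (Tendsto.div tendsto_const_nhds 
        (Tendsto.const_mul _ nhdsWithin_le_nhds) (by positivity))
    obtain ⟨ω₁, ⟨hωb, hω₁⟩, hω₁0⟩ := (((hc.eventually (gt_mem_nhds hb)).and
      self_mem_nhdsWithin).and (nhdsWithin_le_nhds (lt_mem_nhds hω))).exists
    have hω₁ : ω₁ < ω := hω₁
    have hω₁0 : 0 < ω₁ := hω₁0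
    obtain ⟨T₁, hT₁, hw⟩ := h.hw ω₁ hω₁
    have hg : Tendsto (fun ε : ℝ => 2 * (1 / (α * ω₁) * (X * (1 - ε / (ε ^ (α/(1+α)) * x)) ^ (-(1 + 1/α)))
        + Real.pi / 2 * (1 + M) * (ε / (ε ^ (α/(1+α)) * x)))) (𝓝[>] 0)
        (𝓝 (2 * (1 / (α * ω₁) * (X * (1 - 0) ^ (-(1 + 1/α))) + Real.pi / 2 * (1 + M) * 0))) := by
      refine Tendsto.const_mul _ (Tendsto.add ?_ (Tendsto.const_mul _ hrat))
      refine Tendsto.const_mul _ (Tendsto.const_mul _ ?_)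
      exact (tendsto_const_nhds.sub hrat).rpow_const (Or.inl (by norm_num))
    have hg2 := ENNReal.tendsto_ofReal (Tendsto.min 
      (tendsto_const_nhds (x := 2 * Real.pi)) hg)
    have e0 : 2 * (1 / (α * ω₁) * (X * (1 - 0) ^ (-(1 + 1/α))) + Real.pi / 2 * (1 + M) * 0) =
      2 / (α * ω₁) * X := by
      rw [sub_zero, Real.one_rpow]; ring
    rw [e0] at hg2
    have hκ2 : Tendsto (fun ε : ℝ => ε ^ (α/(1+α)) * x + ε) (𝓝[>] 0) (𝓝 0) := by
      simpa using hκ.add hid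
    filter_upwards [hpos, hκ2.eventually (gt_mem_nhds (h.ne T₁ hT₁)),
      hrat.eventually (gt_mem_nhds (by norm_num : (0:ℝ) < 1/2)), 
      hg2.eventually (gt_mem_nhds hωb)] with ε hε hr hε2 hfin
    have hr0 : 0 < ε ^ (α/(1+α)) * x := by positivity
    obtain ⟨σ, hσ, hσr⟩ := h.exists_param hT₁ hr0 (by linarith)
    rw [div_lt_iff₀ hr0] at hε2
    have h1 := angm_upper (ε := ε) (τ₁ := τ₁) hα hω₁0 h.hM0 (by rw [hσr]; exact hr0)
      (fun a ha b hb => h.hM a (hT₁.trans ha) b (hT₁.trans hb)) hw hσ hε (by rw [hσr]; linarith)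
      (by
        intro τ hτ hlt
        by_contra hcon
        push Not at hcon
        have := h.anti (mem_Ici.2 (hτ₁.trans hτ)) (mem_Ici.2 hT₁) hcon
        simp only at this
        rw [hσr] at hlt
        linarith)
    rw [hσr] at h1
    refine lt_of_le_of_lt ?_ hfin
    rw [ENNReal.ofReal_min]
    refine le_min (angm_le _ _) (h1.trans (le_of_eq ?_))
    congr 1
    have e := kap_scale hα hε hx
    set r := ε ^ (α/(1+α)) * x with hrdef
    have e1 : r - ε = r * (1 - ε / r) := by field_simp
    have e2 : 0 ≤ 1 - ε / r := by
      rw [sub_nonneg, div_le_one hr0]; linarith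
    have e3 : ε * (r - ε) ^ (-(1/α) - 1) = X * (1 - ε / r) ^ (-(1 + 1/α)) := by
      have : -(1/α) - 1 = -(1 + 1/α) := by ring
      rw [this, e1, Real.mul_rpow hr0.le e2, hX, ← e]; ring
    rw [mul_assoc (1 / (α * ω₁)), e3]
    ring

lemma int_min {α B : ℝ} (hα : 0 < α) (hα1 : α < 1) (hB : 0 < B) :
    ∫⁻ x in Ioi (0:ℝ), ENNReal.ofReal x * ENNReal.ofReal (min (2 * Real.pi) (B * x ^ (-(1 + 1/α)))) =
      ENNReal.ofReal (Real.pi * (B / (2 * Real.pi)) ^ (2 * (α / (1 + α))) * ((1 + α) / (1 - α))) := by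
  have hπ := Real.pi_pos
  set x0 := (B / (2 * Real.pi)) ^ (α / (1 + α)) with hx0d
  have hx0 : 0 < x0 := by positivity
  have hx0p : x0 ^ (1 + 1/α) = B / (2 * Real.pi) := by
    rw [hx0d, ← Real.rpow_mul (by positivity)]
    have : α / (1 + α) * (1 + 1/α) = 1 := by field_simp; ring
    rw [this, Real.rpow_one]
  have hp : 0 < 1 + 1/α := by positivity
  have hp2 : 1 < 1 / α := by rw [lt_div_iff₀ hα]; linarith
  have hsplit : Ioi (0:ℝ) = Ioc 0 x0 ∪ Ioi x0 := (Ioc_union_Ioi_eq_Ioi hx0.le).symm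
  rw [hsplit, lintegral_union measurableSet_Ioi (by
    rw [Set.disjoint_left]; intro a ha hb; exact absurd ha.2 (not_le.2 hb))]
  have h1 : ∫⁻ x in Ioc 0 x0, ENNReal.ofReal x * ENNReal.ofReal (min (2 * Real.pi) (B * x ^ (-(1 + 1/α))))
      = ENNReal.ofReal (Real.pi * x0 ^ 2) := by
    have e : ∀ x ∈ Ioc 0 x0, ENNReal.ofReal x * ENNReal.ofReal (min (2 * Real.pi) (B * x ^ (-(1 + 1/α))))
        = ENNReal.ofReal (2 * Real.pi * x) := by
      rintro x ⟨hx, hxx⟩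
      rw [← ENNReal.ofReal_mul hx.le, min_eq_left, mul_comm]
      have : x ^ (1 + 1/α) ≤ B / (2 * Real.pi) := by
        rw [← hx0p]; exact Real.rpow_le_rpow hx.le hxx hp.le
      rw [le_div_iff₀ (by positivity)] at this
      rw [Real.rpow_neg hx.le, ← div_eq_mul_inv, le_div_iff₀ (by positivity)]
      linarith
    rw [setLIntegral_congr_fun measurableSet_Ioc e, ← ofReal_integral_eq_lintegral_ofReal]
    · congr 1
      rw [← intervalIntegral.integral_of_le hx0.le, intervalIntegral.integral_const_mul, integral_id]
      ring
    · have : ContinuousOn (fun x : ℝ => 2 * Real.pi * x) (Icc 0 x0) := by fun_prop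
      exact (this.integrableOn_Icc).mono_set Ioc_subset_Icc_self
    · refine (ae_restrict_iff' measurableSet_Ioc).2 (Eventually.of_forall fun x hx => ?_)
      have := hx.1
      simp only [Pi.zero_apply]; positivity
  have h2 : ∫⁻ x in Ioi x0, ENNReal.ofReal x * ENNReal.ofReal (min (2 * Real.pi) (B * x ^ (-(1 + 1/α))))
      = ENNReal.ofReal (Real.pi * x0 ^ 2 * (2 * α / (1 - α))) := by
    have e : ∀ x ∈ Ioi x0, ENNReal.ofReal x * ENNReal.ofReal (min (2 * Real.pi) (B * x ^ (-(1 + 1/α))))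
        = ENNReal.ofReal (B * x ^ (-(1/α))) := by
      intro x hxx
      have hxx : x0 < x := hxx
      have hx : 0 < x := hx0.trans hxx
      rw [← ENNReal.ofReal_mul hx.le, min_eq_right]
      · congr 1
        have : x ^ (-(1/α)) = x ^ (1:ℝ) * x ^ (-(1 + 1/α)) := by
          rw [← Real.rpow_add hx]; congr 1; ring
        rw [this, Real.rpow_one]; ring
      have : B / (2 * Real.pi) ≤ x ^ (1 + 1/α) := by
        rw [← hx0p]; exact Real.rpow_le_rpow hx0.le hxx.le hp.le
      rw [div_le_iff₀ (by positivity)] at this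
      rw [Real.rpow_neg hx.le, ← div_eq_mul_inv, div_le_iff₀ (by positivity)]
      linarith
    rw [setLIntegral_congr_fun measurableSet_Ioi e, ← ofReal_integral_eq_lintegral_ofReal]
    · congr 1
      rw [integral_const_mul, integral_Ioi_rpow_of_lt (by linarith) hx0]
      have hB' : B = 2 * Real.pi * x0 ^ (1 + 1/α) := by rw [hx0p]; field_simp
      have e3 : x0 ^ (1 + 1/α) * x0 ^ (-(1/α) + 1) = x0 ^ 2 := by
        rw [← Real.rpow_add hx0, ← Real.rpow_natCast]; congr 1; push_cast; ring
      have h4 : -(1/α) + 1 ≠ 0 := by linarith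
      have h5 : 1 - α ≠ 0 := by linarith
      calc B * (-x0 ^ (-(1/α) + 1) / (-(1/α) + 1)) 
          = 2 * Real.pi * (x0 ^ (1 + 1/α) * x0 ^ (-(1/α) + 1)) * (-1 / (-(1/α) + 1)) := by
            rw [hB']; ring
        _ = Real.pi * x0 ^ 2 * (2 * α / (1 - α)) := by
          rw [e3]
          have : -1 / (-(1/α) + 1) = α / (1 - α) := by
            rw [div_eq_div_iff h4 h5]; field_simp; ring
          rw [this]; ring
    · exact ((integrableOn_Ioi_rpow_of_lt (by linarith) hx0).const_mul B)
    · refine (ae_restrict_iff' measurableSet_Ioi).2 (Eventually.of_forall fun x hx => ?_)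
      have : 0 < x := hx0.trans hx
      simp only [Pi.zero_apply]; positivity
  have h5 : 0 < 1 - α := by linarith
  rw [h1, h2, ← ENNReal.ofReal_add (by positivity) (by positivity)]
  congr 1
  have e6 : (B / (2 * Real.pi)) ^ (2 * (α / (1 + α))) = x0 ^ 2 := by
    rw [hx0d, ← Real.rpow_natCast, ← Real.rpow_mul (by positivity)]; congr 1; push_cast; ring
  rw [e6]
  field_simp
  ring

lemma Spir.vol {α ω T M : ℝ} {J : ℝ → ℂ} (h : Spir α ω T M J) (hα : 0 < α) (hα1 : α < 1)
    (hω : 0 < ω) {τ₁ : ℝ} (hτ₁ : T + 1 ≤ τ₁) :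
    Tendsto (fun ε : ℝ => volume (thickening ε (gam J '' Ici τ₁)) / 
      ENNReal.ofReal ((ε ^ (α/(1+α))) ^ 2)) (𝓝[>] 0)
      (𝓝 (ENNReal.ofReal (Real.pi * ((2 / (α * ω)) / (2 * Real.pi)) ^ (2 * (α / (1 + α)))
        * ((1 + α) / (1 - α))))) := by
  have hpos : ∀ᶠ ε : ℝ in 𝓝[>] 0, 0 < ε := self_mem_nhdsWithin
  rw [← int_min hα hα1 (by positivity)]
  have hE : (fun ε : ℝ => ∫⁻ x in Ioi (0:ℝ), ENNReal.ofReal x * 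
      angm (thickening ε (gam J '' Ici τ₁)) (ε ^ (α/(1+α)) * x)) =ᶠ[𝓝[>] 0] 
      (fun ε : ℝ => volume (thickening ε (gam J '' Ici τ₁)) / 
        ENNReal.ofReal ((ε ^ (α/(1+α))) ^ 2)) := by
    filter_upwards [hpos] with ε hε
    rw [vol_scaled isOpen_thickening.measurableSet (by positivity)]
  refine Tendsto.congr' hE ?_
  obtain ⟨K, hK, hdom⟩ := h.dom hα hω
  refine tendsto_lintegral_filter_of_dominated_convergence 
    (fun x => ENNReal.ofReal x * ENNReal.ofReal (min (2 * Real.pi) (K * x ^ (-(1 + 1/α))))) ?_ ?_ ?_ ?_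
  · refine Eventually.of_forall fun ε => ?_
    have := angm_measurable (isOpen_thickening (δ := ε) (E := gam J '' Ici τ₁)).measurableSet
    exact ENNReal.measurable_ofReal.mul (this.comp (measurable_const_mul _))
  · have hgap : 0 < ‖J T‖ - ‖J (T+1)‖ := by
      have := h.anti (a := T) (b := T + 1) (by simp) (by simp) (by linarith)
      simp only at this
      linarith
    filter_upwards [hpos, nhdsWithin_le_nhds (gt_mem_nhds hgap)] with ε hε hε2
    refine (ae_restrict_iff' measurableSet_Ioi).2 (Eventually.of_forall fun x hx => ?_)
    have hx : 0 < x := hx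
    gcongr
    by_cases hr : ε ^ (α/(1+α)) * x ≤ ‖J T‖
    · rw [ENNReal.ofReal_min]
      refine le_min (angm_le _ _) ?_
      have := hdom τ₁ (by linarith) (ε ^ (α/(1+α)) * x) (by positivity) hr ε hε
      rwa [kap_scale hα hε hx] at this
    · push Not at hr
      rw [h.zero hτ₁ hr hε2]
      exact zero_le
  · rw [int_min hα hα1 hK]
    exact ENNReal.ofReal_ne_top
  · refine (ae_restrict_iff' measurableSet_Ioi).2 (Eventually.of_forall fun x hx => ?_)
    exact ENNReal.Tendsto.const_mul (h.pointwise hα hω (by linarith) hx) (Or.inr ENNReal.ofReal_ne_top)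

lemma norm_deriv {J : ℝ → ℂ} {J' : ℂ} {τ : ℝ} (h : HasDerivAt J J' τ) (h0 : J τ ≠ 0) :
    HasDerivAt (fun t => ‖J t‖) (inner ℝ (J τ) J' / ‖J τ‖) τ := by
  have hn : ‖J τ‖ ≠ 0 := norm_ne_zero_iff.2 h0
  have h1 := h.norm_sq.sqrt (pow_ne_zero 2 hn)
  have e : (fun t => √(‖J t‖ ^ 2)) = fun t => ‖J t‖ := by
    ext t; exact Real.sqrt_sq (norm_nonneg _)
  rw [e, Real.sqrt_sq (norm_nonneg _)] at h1
  convert h1 using 1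
  field_simp

lemma abs_lower {w w' : ℝ → ℝ} {T₁ ω₁ : ℝ} (hw : ∀ t ≥ T₁, HasDerivAt w (w' t) t)
    (h : ∀ t ≥ T₁, ω₁ ≤ w' t) : ∀ σ ≥ T₁, ∀ τ ≥ T₁, ω₁ * |σ - τ| ≤ |w σ - w τ| := by
  have key : ∀ σ ∈ Ici T₁, ∀ τ ∈ Ici T₁, σ ≤ τ → ω₁ * (τ - σ) ≤ w τ - w σ := by
    refine Convex.mul_sub_le_image_sub_of_le_deriv (convex_Ici T₁)
      (fun t ht => (hw t ht).continuousAt.continuousWithinAt)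
      (fun t ht => (hw t (interior_subset ht)).differentiableAt.differentiableWithinAt) ?_
    intro t ht
    rw [(hw t (interior_subset ht)).deriv]
    exact h t (interior_subset ht)
  intro σ hσ τ hτ
  rcases le_total σ τ with hle | hle
  · rw [abs_sub_comm σ τ, abs_of_nonneg (sub_nonneg.2 hle), abs_sub_comm]
    exact (key σ hσ τ hτ hle).trans (le_abs_self _)
  · rw [abs_of_nonneg (sub_nonneg.2 hle)]
    exact (key τ hτ σ hσ hle).trans (le_abs_self _)

lemma arc_le {J J' : ℝ → ℂ} {ρ' : ℝ → ℝ} {T M : ℝ} (hM0 : 0 ≤ M) (hJ : ∀ t, HasDerivAt J (J' t) t)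
    (hρ : ∀ t ≥ T, HasDerivAt (fun t => ‖J t‖) (ρ' t) t) (h : ∀ t ≥ T, ‖J' t‖ ≤ M * (-ρ' t)) :
    ∀ σ ≥ T, ∀ τ ≥ T, ‖J σ - J τ‖ ≤ M * |‖J σ‖ - ‖J τ‖| := by
  have key : ∀ σ ≥ T, ∀ τ, σ ≤ τ → ‖J τ - J σ‖ ≤ M * (‖J σ‖ - ‖J τ‖) := by
    intro σ hσ τ hle
    refine image_norm_le_of_norm_deriv_right_le_deriv_boundary' (f := fun t => J t - J σ)
      (a := σ) (b := τ) (f' := J') (B := fun t => M * (‖J σ‖ - ‖J t‖)) (B' := fun t => M * (-ρ' t))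
      ?_ ?_ (by simp) ?_ ?_ ?_ (right_mem_Icc.2 hle)
    · exact fun t _ => ((hJ t).continuousAt.sub continuousAt_const).continuousWithinAt
    · exact fun t _ => ((hJ t).sub_const _).hasDerivWithinAt
    · exact fun t ht => (continuousAt_const.mul (continuousAt_const.sub
        (hJ t).continuousAt.norm)).continuousWithinAt
    · intro t ht
      have := (((hρ t (hσ.trans ht.1)).const_sub (‖J σ‖)).const_mul M).hasDerivWithinAt (s := Ici t)
      exact this
    · exact fun t ht => h t (hσ.trans ht.1)
  have hM : ∀ σ ≥ T, ∀ τ, σ ≤ τ → M * (‖J σ‖ - ‖J τ‖) ≤ M * |‖J σ‖ - ‖J τ‖| :=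
    fun σ hσ τ hle => mul_le_mul_of_nonneg_left (le_abs_self _) hM0
  intro σ hσ τ hτ
  rcases le_total σ τ with hle | hle
  · rw [norm_sub_rev]
    exact (key σ hσ τ hle).trans (hM σ hσ τ hle)
  · rw [abs_sub_comm]
    exact (key τ hτ σ hle).trans (hM τ hτ σ hle)

lemma exists_spir {α : ℝ} (hα : 0 < α) {J J' : ℝ → ℂ} {c : ℂ} (hc : c ≠ 0)
    (hd : ∀ τ, HasDerivAt J (J' τ) τ)
    (h1 : Tendsto (fun τ : ℝ => ((τ ^ α : ℝ) : ℂ) * J τ) atTop (𝓝 c))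
    (h2 : Tendsto (fun τ : ℝ => ((τ ^ (1 + α) : ℝ) : ℂ) * J' τ) atTop (𝓝 (-(α : ℂ) * c))) :
    ∃ T > 0, ∃ M, Spir α (‖c‖ ^ (-(1/α))) T M J := by
  have hC : 0 < ‖c‖ := norm_pos_iff.2 hc
  set C := ‖c‖ with hCd
  set ω := C ^ (-(1/α)) with hω
  have hω0 : 0 < ω := by positivity
  have hpos : ∀ᶠ τ : ℝ in atTop, 0 < τ := eventually_gt_atTop 0
  have L1 : Tendsto (fun τ : ℝ => τ ^ α * ‖J τ‖) atTop (𝓝 C) := by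
    refine h1.norm.congr' ?_
    filter_upwards [hpos] with τ hτ
    rw [norm_mul, Complex.norm_real, Real.norm_of_nonneg (by positivity)]
  have L3 : Tendsto (fun τ : ℝ => τ ^ (1 + α) * ‖J' τ‖) atTop (𝓝 (α * C)) := by
    have := h2.norm
    rw [norm_mul, norm_neg, Complex.norm_real, Real.norm_of_nonneg hα.le] at this
    refine this.congr' ?_
    filter_upwards [hpos] with τ hτ
    rw [norm_mul, Complex.norm_real, Real.norm_of_nonneg (by positivity)]
  set ρ' : ℝ → ℝ := fun τ => inner ℝ (J τ) (J' τ) / ‖J τ‖ with hρ'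
  have hJpos : ∀ᶠ τ : ℝ in atTop, 0 < ‖J τ‖ := by
    filter_upwards [hpos, L1.eventually (lt_mem_nhds hC)] with τ hτ h
    have : 0 < τ ^ α := by positivity
    exact (pos_iff_pos_of_mul_pos h).1 this
  have L2 : Tendsto (fun τ : ℝ => τ ^ (1 + α) * ρ' τ) atTop (𝓝 (-(α * C))) := by
    have h3 : Tendsto (fun τ : ℝ => inner ℝ (((τ ^ α : ℝ) : ℂ) * J τ) (((τ ^ (1 + α) : ℝ) : ℂ) * J' τ)
      / (τ ^ α * ‖J τ‖)) atTop (𝓝 (inner ℝ c (-(α : ℂ) * c) / C)) := (h1.inner h2).div L1 hC.ne'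
    have e : inner ℝ c (-(α : ℂ) * c) / C = -(α * C) := by
      have : -(α : ℂ) * c = (-α) • c := by rw [Complex.real_smul]; push_cast; ring
      rw [this, real_inner_smul_right, real_inner_self_eq_norm_sq, ← hCd]
      field_simp
    rw [e] at h3
    refine h3.congr' ?_
    filter_upwards [hpos, hJpos] with τ hτ hJ
    have : 0 < τ ^ α := by positivity
    rw [← Complex.real_smul, ← Complex.real_smul, real_inner_smul_right, real_inner_smul_left, hρ']
    field_simp
  have hρd : ∀ τ, 0 < ‖J τ‖ → HasDerivAt (fun t => ‖J t‖) (ρ' τ) τ := fun τ hτ =>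
    norm_deriv (hd τ) (norm_pos_iff.1 hτ)
  have hρneg : ∀ᶠ τ : ℝ in atTop, ρ' τ < 0 := by
    have : -(α * C) < 0 := by have : 0 < α * C := by positivity
                              linarith
    filter_upwards [hpos, L2.eventually (gt_mem_nhds this)] with τ hτ h
    have : 0 < τ ^ (1 + α) := by positivity
    by_contra hcon; push Not at hcon
    have := mul_nonneg this.le hcon
    linarith
  have hMev : ∀ᶠ τ : ℝ in atTop, ‖J' τ‖ ≤ 2 * (-ρ' τ) := by
    have h4 := L3.add (L2.const_mul 2)
    have : α * C + 2 * -(α * C) < 0 := by have : 0 < α * C := by positivity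
                                          linarith
    filter_upwards [hpos, h4.eventually (gt_mem_nhds this)] with τ hτ h
    have hp : 0 < τ ^ (1 + α) := by positivity
    by_contra hcon; push Not at hcon
    have : 0 ≤ τ ^ (1 + α) * (‖J' τ‖ + 2 * ρ' τ) := mul_nonneg hp.le (by linarith)
    linarith
  set w' : ℝ → ℝ := fun τ => ρ' τ * (-(1/α)) * ‖J τ‖ ^ (-(1/α) - 1) with hw'
  have hwd : ∀ τ, 0 < ‖J τ‖ → HasDerivAt (fun t => ‖J t‖ ^ (-(1/α))) (w' τ) τ := fun τ hτ =>
    (hρd τ hτ).rpow_const (Or.inl hτ.ne')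
  have Lw : Tendsto w' atTop (𝓝 ω) := by
    have h5 : Tendsto (fun τ : ℝ => (τ ^ (1 + α) * ρ' τ) * (-(1/α)) * (τ ^ α * ‖J τ‖) ^ (-(1/α) - 1))
      atTop (𝓝 ((-(α * C)) * (-(1/α)) * C ^ (-(1/α) - 1))) :=
      (L2.mul_const _).mul (L1.rpow_const (Or.inl hC.ne'))
    have e : (-(α * C)) * (-(1/α)) * C ^ (-(1/α) - 1) = ω := by
      rw [Real.rpow_sub_one hC.ne', ← hω]; field_simp
    rw [e] at h5
    refine h5.congr' ?_
    filter_upwards [hpos, hJpos] with τ hτ hJ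
    rw [Real.mul_rpow (by positivity) hJ.le, ← Real.rpow_mul hτ.le]
    have e2 : τ ^ (1 + α) * τ ^ (α * (-(1/α) - 1)) = 1 := by
      rw [← Real.rpow_add hτ]
      have : 1 + α + α * (-(1/α) - 1) = 0 := by field_simp; ring
      rw [this, Real.rpow_zero]
    rw [hw']
    linear_combination (ρ' τ * (-(1/α)) * ‖J τ‖ ^ (-(1/α) - 1)) * e2
  obtain ⟨T0, hT0⟩ := eventually_atTop.1 (hpos.and (hJpos.and (hρneg.and (hMev.and
    (Lw.eventually (lt_mem_nhds (by linarith : ω / 2 < ω)))))))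
  refine ⟨T0, (hT0 T0 le_rfl).1, 2, ?_⟩
  refine ⟨?_, fun τ hτ => (hT0 τ hτ).2.1, ?_, ?_, by norm_num, ?_, ?_, ?_, ?_⟩
  · exact continuous_iff_continuousAt.2 fun τ => (hd τ).continuousAt
  · refine strictAntiOn_of_deriv_neg (convex_Ici T0)
      (fun t ht => (hd t).continuousAt.norm.continuousWithinAt) ?_
    intro t ht
    have := hT0 t (interior_subset ht)
    rw [(hρd t this.2.1).deriv]
    exact this.2.2.1
  · have h6 := (tendsto_rpow_neg_atTop hα).mul L1
    rw [zero_mul] at h6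
    refine h6.congr' ?_
    filter_upwards [hpos] with τ hτ
    have : 0 < τ ^ α := by positivity
    rw [Real.rpow_neg hτ.le]; field_simp
  · exact arc_le (by norm_num) hd (fun t ht => hρd t (hT0 t ht).2.1) (fun t ht => (hT0 t ht).2.2.2.1)
  · exact abs_lower (fun t ht => hwd t (hT0 t ht).2.1) (fun t ht => (hT0 t ht).2.2.2.2.le)
  · intro ω₁ hω₁
    obtain ⟨T1, hT1⟩ := eventually_atTop.1 (Lw.eventually (lt_mem_nhds hω₁))
    refine ⟨max T0 T1, le_max_left _ _, ?_⟩
    exact abs_lower (fun t ht => hwd t (hT0 t ((le_max_left _ _).trans ht)).2.1)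
      (fun t ht => (hT1 t ((le_max_right _ _).trans ht)).le)
  · intro v hv
    have hπ := Real.pi_pos
    have hlt : α * C < v * C ^ (1 + 1/α) := by
      have e : α * C = α * ω * C ^ (1 + 1/α) := by
        rw [hω, mul_assoc, ← Real.rpow_add hC]
        have : -(1/α) + (1 + 1/α) = 1 := by ring
        rw [this, Real.rpow_one]
      rw [e]
      have : 0 < C ^ (1 + 1/α) := by positivity
      exact mul_lt_mul_of_pos_right hv this
    obtain ⟨a, ha1, ha2⟩ := exists_between hlt
    have ha0 : 0 < a := lt_trans (by positivity) ha1
    obtain ⟨N, hN⟩ := eventually_atTop.1 (hpos.and (L3.eventually (gt_mem_nhds ha1)))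
    have L4 : Tendsto (fun σ : ℝ => a * ((σ - Real.pi) / σ) ^ (-(1 + α))) atTop (𝓝 (a * 1 ^ (-(1 + α)))) := by
      refine Tendsto.const_mul _ (Tendsto.rpow_const ?_ (Or.inl one_ne_zero))
      have : Tendsto (fun σ : ℝ => 1 - Real.pi / σ) atTop (𝓝 (1 - 0)) :=
        tendsto_const_nhds.sub (tendsto_const_nhds.div_atTop tendsto_id)
      rw [sub_zero] at this
      refine this.congr' ?_
      filter_upwards [hpos] with σ hσ
      field_simp
    rw [Real.one_rpow, mul_one] at L4
    have L5 : Tendsto (fun σ : ℝ => v * (σ ^ α * ‖J σ‖) ^ (1 + 1/α)) atTop (𝓝 (v * C ^ (1 + 1/α))) :=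
      Tendsto.const_mul _ (L1.rpow_const (Or.inl hC.ne'))
    filter_upwards [hpos, hJpos, L4.eventually_lt L5 ha2, eventually_ge_atTop (N + Real.pi)]
      with σ hσ hJ hσ2 hσN s hs
    have hNpos : 0 < N := (hN N le_rfl).1
    have hσπ : 0 < σ - Real.pi := by linarith
    have hP : a * (σ - Real.pi) ^ (-(1 + α)) ≤ v * ‖J σ‖ ^ (1 + 1/α) := by
      rw [Real.div_rpow hσπ.le hσ.le, Real.mul_rpow (by positivity) hJ.le, ← Real.rpow_mul hσ.le] at hσ2
      have e : α * (1 + 1/α) = 1 + α := by field_simp; ring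
      rw [e, Real.rpow_neg hσ.le (1 + α)] at hσ2
      have hp : 0 < σ ^ (1 + α) := by positivity
      have h7 : σ ^ (1 + α) * (a * (σ - Real.pi) ^ (-(1 + α))) < σ ^ (1 + α) * (v * ‖J σ‖ ^ (1 + 1/α)) := by
        rw [div_inv_eq_mul] at hσ2
        linarith
      exact (lt_of_mul_lt_mul_left h7 hp.le).le
    rw [abs_le] at hs
    have h8 := Convex.norm_image_sub_le_of_norm_hasDerivWithin_le (𝕜 := ℝ) (f := J) (f' := J')
      (s := Icc (σ - Real.pi) (σ + Real.pi)) (C := a * (σ - Real.pi) ^ (-(1 + α))) (x := σ + s) (y := σ)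
      (fun t _ => (hd t).hasDerivWithinAt) ?_ (convex_Icc _ _)
      ⟨by linarith, by linarith⟩ ⟨by linarith, by linarith⟩
    · refine h8.trans ?_
      have : ‖σ - (σ + s)‖ = |s| := by
        rw [Real.norm_eq_abs, show σ - (σ + s) = -s by ring, abs_neg]
      rw [this]
      gcongr
    · intro t ht
      have h9 := hN t (by linarith [ht.1])
      have ht0 := h9.1
      have h10 : ‖J' t‖ ≤ a * t ^ (-(1 + α)) := by
        rw [Real.rpow_neg ht0.le, ← div_eq_mul_inv, le_div_iff₀ (by positivity)]
        linarith [h9.2]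
      refine h10.trans ?_
      have := Real.rpow_le_rpow_of_nonpos hσπ ht.1 (by linarith : -(1 + α) ≤ 0)
      gcongr

lemma volume_thickening_transfer (g : ℝ → ℂ) (S : Set ℝ) (ε : ℝ) :
    volume (thickening ε ((fun τ => pt (g τ).re (g τ).im) '' S)) =
      volume (thickening ε (g '' S)) := by
  set e := Complex.orthonormalBasisOneI.repr with he
  have h1 : (fun τ => pt (g τ).re (g τ).im) '' S = e '' (g '' S) := by
    rw [image_image]
    refine image_congr fun τ _ => ?_
    ext i
    fin_cases i <;> simp [he, pt, Complex.orthonormalBasisOneI_repr_apply]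
  have h2 : e ⁻¹' (thickening ε (e '' (g '' S))) = thickening ε (g '' S) := by
    ext z
    simp only [mem_preimage, mem_thickening_iff, exists_mem_image, e.isometry.dist_eq]
  have h3 := e.measurePreserving
  rw [h1, ← h2, h3.measure_preimage isOpen_thickening.measurableSet.nullMeasurableSet]

lemma mink_of_tendsto {A : Set E2} {d v : ℝ} (hd0 : 0 ≤ d) (hv : 0 < v)
    (h : Tendsto (fun ε : ℝ => volume (Metric.thickening ε A) / ENNReal.ofReal (ε ^ (2 - d)))
      (𝓝[>] (0:ℝ)) (𝓝 (ENNReal.ofReal v))) :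
    dimBEq A d ∧ lowerMink d A = ENNReal.ofReal v ∧ upperMink d A = ENNReal.ofReal v := by
  have hl : lowerMink d A = ENNReal.ofReal v := h.liminf_eq
  have hu : upperMink d A = ENNReal.ofReal v := h.limsup_eq
  have hpos : ∀ᶠ ε : ℝ in 𝓝[>] 0, 0 < ε := self_mem_nhdsWithin
  have hv' : 0 < ENNReal.ofReal v := ENNReal.ofReal_pos.2 hv
  have hrel : ∀ s : ℝ, ∀ ε : ℝ, 0 < ε → volume (Metric.thickening ε A) / ENNReal.ofReal (ε ^ (2 - s)) =
      volume (Metric.thickening ε A) / ENNReal.ofReal (ε ^ (2 - d)) * ENNReal.ofReal (ε ^ (s - d)) := by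
    intro s ε hε
    have e : ε ^ (2 - d) = ε ^ (2 - s) * ε ^ (s - d) := by
      rw [← Real.rpow_add hε]; congr 1; ring
    have h1 : 0 < ε ^ (2 - s) := by positivity
    have h2 : 0 < ε ^ (s - d) := by positivity
    rw [e, ENNReal.ofReal_mul h1.le]
    have a1 : ENNReal.ofReal (ε ^ (2 - s)) ≠ 0 := (ENNReal.ofReal_pos.2 h1).ne'
    have a2 : ENNReal.ofReal (ε ^ (s - d)) ≠ 0 := (ENNReal.ofReal_pos.2 h2).ne'
    rw [div_eq_mul_inv, div_eq_mul_inv, ENNReal.mul_inv (Or.inl a1) (Or.inl ENNReal.ofReal_ne_top),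
      mul_assoc, mul_assoc, ENNReal.inv_mul_cancel a2 ENNReal.ofReal_ne_top, mul_one]
  have hgt : ∀ s > d, Tendsto (fun ε : ℝ => volume (Metric.thickening ε A) / ENNReal.ofReal (ε ^ (2 - s)))
      (𝓝[>] (0:ℝ)) (𝓝 0) := by
    intro s hs
    have hs' : 0 < s - d := by linarith
    have h0 := (Real.continuousAt_rpow_const (0:ℝ) (s - d) (Or.inr hs'.le)).tendsto
    rw [Real.zero_rpow hs'.ne'] at h0
    have h3 := ENNReal.tendsto_ofReal (h0.mono_left (nhdsWithin_le_nhds (s := Ioi 0)))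
    rw [ENNReal.ofReal_zero] at h3
    have h4 := ENNReal.Tendsto.mul h (Or.inr ENNReal.zero_ne_top) h3 (Or.inr ENNReal.ofReal_ne_top)
    rw [mul_zero] at h4
    refine h4.congr' ?_
    filter_upwards [hpos] with ε hε
    exact (hrel s ε hε).symm
  have hlow : ∀ s ≤ d, lowerMink s A ≠ 0 := by
    intro s hs h0
    have : lowerMink d A ≤ lowerMink s A := by
      unfold lowerMink
      refine liminf_le_liminf ?_
      filter_upwards [hpos, nhdsWithin_le_nhds (gt_mem_nhds (zero_lt_one (α := ℝ)))] with ε hε hε1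
      refine ENNReal.div_le_div_left (ENNReal.ofReal_le_ofReal ?_) _
      exact Real.rpow_le_rpow_of_exponent_ge hε hε1.le (by linarith)
    rw [h0, hl] at this
    exact absurd this (not_le.2 hv')
  have hle : ∀ s, lowerMink s A ≤ upperMink s A := fun s => liminf_le_limsup
  have e1 : {s : ℝ | 0 ≤ s ∧ lowerMink s A = 0} = Ioi d := by
    ext s
    simp only [mem_ofPred_eq, mem_Ioi]
    constructor
    · rintro ⟨_, h0⟩
      by_contra hc; push Not at hc
      exact hlow s hc h0
    · intro hs
      exact ⟨by linarith, (hgt s hs).liminf_eq⟩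
  have e2 : {s : ℝ | 0 ≤ s ∧ upperMink s A = 0} = Ioi d := by
    ext s
    simp only [mem_ofPred_eq, mem_Ioi]
    constructor
    · rintro ⟨_, h0⟩
      by_contra hc; push Not at hc
      exact hlow s hc (le_antisymm ((hle s).trans h0.le) zero_le)
    · intro hs
      exact ⟨by linarith, (hgt s hs).limsup_eq⟩
  refine ⟨⟨?_, ?_⟩, hl, hu⟩
  · rw [lowerDimB, e1, csInf_Ioi]
  · rw [upperDimB, e2, csInf_Ioi]

lemma const_eq {α C : ℝ} (hα : 0 < α) (hC : 0 < C) :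
    Real.pi * ((2 / (α * C ^ (-(1/α)))) / (2 * Real.pi)) ^ (2 * (α / (1 + α)))
        * ((1 + α) / (1 - α)) =
    C ^ (2/(1+α)) * α ^ (-(2*α/(1+α))) * Real.pi ^ ((1-α)/(1+α)) * ((1+α)/(1-α)) := by
  have hπ := Real.pi_pos
  congr 1
  have e1 : (2 / (α * C ^ (-(1/α)))) / (2 * Real.pi) = C ^ (1/α) * α⁻¹ * Real.pi⁻¹ := by
    rw [Real.rpow_neg hC.le]
    have : 0 < C ^ (1/α) := by positivity
    field_simp
  rw [e1, Real.mul_rpow (by positivity) (by positivity), Real.mul_rpow (by positivity) (by positivity),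
    ← Real.rpow_mul hC.le, Real.inv_rpow hα.le, Real.inv_rpow hπ.le, ← Real.rpow_neg hα.le,
    ← Real.rpow_neg hπ.le]
  have a1 : 1/α * (2 * (α / (1 + α))) = 2/(1+α) := by field_simp
  have a2 : -(2 * (α / (1 + α))) = -(2*α/(1+α)) := by ring
  have a3 : Real.pi ^ ((1-α)/(1+α)) = Real.pi * Real.pi ^ (-(2*α/(1+α))) := by
    have : (1-α)/(1+α) = 1 + -(2*α/(1+α)) := by field_simp; ring
    rw [this, Real.rpow_add hπ, Real.rpow_one]
  rw [a1, a2, a3]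
  ring

/-- **Example (normal forms `x^p + y^q`, `p`, `q` even, Minkowski content)**: for even
`p, q ≥ 2`, `(p,q) ≠ (2,2)`, `φ(0,0) = 1`, `β = -1/p - 1/q` and `d = 2/(1-β)`, the curve
defined by the oscillatory integral has box dimension `d` and Minkowski content
`[4 Γ(1/p+1) Γ(1/q+1)]^{2/(1-β)} (-β)^{2β/(1-β)} π^{(1+β)/(1-β)} (1-β)/(1+β)`. -/
theorem minkowski_content_normal_form_even
    (p q : ℕ) (hp : 2 ≤ p) (hq : 2 ≤ q) (hpe : Even p) (hqe : Even q) (hpq : (p, q) ≠ (2, 2))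
    (β d : ℝ) (hβ : β = -(1/(p:ℝ)) - 1/(q:ℝ)) (hd : d = 2/(1-β))
    (φ : E2 → ℝ)
    (hφ_smooth : ContDiff ℝ (⊤ : ℕ∞) φ)
    (hφ_nonneg : ∀ x, 0 ≤ φ x)
    (hφ_supp : HasCompactSupport φ)
    (hφ_zero : (0 : E2) ∈ interior (tsupport φ))
    (hφ_one : φ 0 = 1)
    (I : ℝ → ℂ)
    (hI : ∀ τ : ℝ, I τ = ∫ v : E2,
      Complex.exp (Complex.I * (τ:ℂ) * (((v 0) ^ p + (v 1) ^ q + 1 : ℝ) : ℂ)) * (φ v : ℂ)) :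
    ∃ τ₀ > (0:ℝ), ∀ τ₁ ≥ τ₀,
      dimBEq (curveFrom (fun τ => (I τ).re) (fun τ => (I τ).im) τ₁) d ∧
      lowerMink d (curveFrom (fun τ => (I τ).re) (fun τ => (I τ).im) τ₁) =
        ENNReal.ofReal ((4 * Real.Gamma (1/(p:ℝ) + 1) * Real.Gamma (1/(q:ℝ) + 1)) ^ (2/(1-β)) *
          (-β) ^ (2*β/(1-β)) * Real.pi ^ ((1+β)/(1-β)) * ((1-β)/(1+β))) ∧
      upperMink d (curveFrom (fun τ => (I τ).re) (fun τ => (I τ).im) τ₁) =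
        ENNReal.ofReal ((4 * Real.Gamma (1/(p:ℝ) + 1) * Real.Gamma (1/(q:ℝ) + 1)) ^ (2/(1-β)) *
          (-β) ^ (2*β/(1-β)) * Real.pi ^ ((1+β)/(1-β)) * ((1-β)/(1+β))) := by
  have hp0 : (2:ℝ) ≤ p := by exact_mod_cast hp
  have hq0 : (2:ℝ) ≤ q := by exact_mod_cast hq
  set α : ℝ := 1 / (p:ℝ) + 1 / (q:ℝ) with hαd
  have hα : 0 < α := by positivity
  have hα1 : α < 1 := by
    have h : 2 < p ∨ 2 < q := by
      by_contra hc
      push Not at hc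
      exact hpq (Prod.ext (le_antisymm hc.1 hp) (le_antisymm hc.2 hq))
    have hpi : 1 / (p:ℝ) ≤ 1 / 2 := one_div_le_one_div_of_le (by norm_num) hp0
    have hqi : 1 / (q:ℝ) ≤ 1 / 2 := one_div_le_one_div_of_le (by norm_num) hq0
    rcases h with h | h
    · have : 1 / (p:ℝ) < 1 / 2 := one_div_lt_one_div_of_lt (by norm_num) (by exact_mod_cast h)
      linarith
    · have : 1 / (q:ℝ) < 1 / 2 := one_div_lt_one_div_of_lt (by norm_num) (by exact_mod_cast h)
      linarith
  have hβα : β = -α := by rw [hβ, hαd]; ring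
  obtain ⟨J, J', c, hIJ, hder, hc, hJ1, hJ2⟩ :=
    I_props hp hq hpe hqe hα1 φ hφ_smooth hφ_supp hφ_one I hI
  set C := 4 * Real.Gamma (1/(p:ℝ) + 1) * Real.Gamma (1/(q:ℝ) + 1) with hCd
  have hC : 0 < C := by
    have := Real.Gamma_pos_of_pos (by positivity : 0 < 1 / (p:ℝ) + 1)
    have := Real.Gamma_pos_of_pos (by positivity : 0 < 1 / (q:ℝ) + 1)
    positivity
  have hc0 : c ≠ 0 := norm_pos_iff.1 (by rw [hc]; exact hC)
  obtain ⟨T, hT, M, hS⟩ := exists_spir hα hc0 hder hJ1 hJ2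
  rw [hc] at hS
  refine ⟨T + 1, by linarith, fun τ₁ hτ₁ => ?_⟩
  have hIg : I = gam J := by ext τ; rw [hIJ, gam]
  have hvol := hS.vol hα hα1 (by positivity) hτ₁
  rw [const_eq hα hC] at hvol
  have e1 : 1 - β = 1 + α := by rw [hβα]; ring
  have e2 : 1 + β = 1 - α := by rw [hβα]; ring
  have e3 : 2 * β / (1 - β) = -(2 * α / (1 + α)) := by rw [e1, hβα]; ring
  rw [e3, e1, e2, hβα, neg_neg]
  have h1α : 0 < 1 - α := by linarith
  refine mink_of_tendsto (by rw [hd, e1]; positivity) (by positivity) ?_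
  refine hvol.congr' ?_
  filter_upwards [self_mem_nhdsWithin] with ε hε
  have hε : 0 < ε := hε
  rw [curveFrom, volume_thickening_transfer I, hIg]
  congr 2
  rw [← Real.rpow_natCast, ← Real.rpow_mul hε.le, hd, e1]
  congr 1
  push_cast
  field_simp
  ring
end
end

section
/- Let f : [φ₁,∞) → (0,∞), with φ₁ > e, be a decreasing C² function, let α ∈ (0,1) and l ∈ ℕ, and suppose there are positive constants m̲, m̄, a̲, ā, M₁, M₂ such that for all φ ≥ φ₁: m̲ φ^{−α} (log φ)^l ≤ f(φ) ≤ m̄ φ^{−α} (log φ)^l; a̲ φ^{−α−1} (log φ)^l ≤ f(φ) − f(φ+2π) ≤ ā φ^{−α−1} (log φ)^l; and M₁ φ^{−α−1} (log φ)^l ≤ |f'(φ)| ≤ M₂ φ^{−α−1} (log φ)^l. Let Γ be the graph of r = f(φ) in polar coordinates and d := 2/(1+α). Then dim_B Γ = dim_B(Γ, rad) = d, and M^{*d}(Γ) = M^{*d}(Γ, rad) = +∞. -/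
open MeasureTheory Filter Metric Set Topology ENNReal

noncomputable section

lemma pt_apply0 (a b : ℝ) : (pt a b) 0 = a := by simp [pt]
lemma pt_apply1 (a b : ℝ) : (pt a b) 1 = b := by simp [pt]

lemma norm_pt_polar (r θ : ℝ) (hr : 0 ≤ r) : ‖pt (r * Real.cos θ) (r * Real.sin θ)‖ = r := by
  rw [EuclideanSpace.norm_eq]
  simp only [Fin.sum_univ_two, pt_apply0, pt_apply1, Real.norm_eq_abs, sq_abs]
  rw [show (r * Real.cos θ)^2 + (r * Real.sin θ)^2 = r^2 by
    nlinarith [Real.sin_sq_add_cos_sq θ]]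
  exact Real.sqrt_sq hr

lemma dist_pt_le (a b c d : ℝ) : dist (pt a b) (pt c d) ≤ |a - c| + |b - d| := by
  rw [EuclideanSpace.dist_eq]
  simp only [Fin.sum_univ_two, pt_apply0, pt_apply1, Real.dist_eq, sq_abs]
  apply Real.sqrt_le_iff.mpr
  refine ⟨by positivity, ?_⟩
  rw [← sq_abs (a - c), ← sq_abs (b-d)]
  nlinarith [abs_nonneg (a-c), abs_nonneg (b-d)]

lemma rayNbhd_subset_thickening (ε : ℝ) (A : Set E2) : rayNbhd ε A ⊆ Metric.thickening ε A := by
  rintro y ⟨z, hz, -, hd⟩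
  exact Metric.mem_thickening_iff.mpr ⟨z, hz, hd⟩

lemma exists_polar (y : E2) : ∃ θ : ℝ, y = pt (‖y‖ * Real.cos θ) (‖y‖ * Real.sin θ) := by
  refine ⟨Complex.arg ⟨y 0, y 1⟩, ?_⟩
  have hn : ‖(⟨y 0, y 1⟩ : ℂ)‖ = ‖y‖ := by
    rw [EuclideanSpace.norm_eq, Complex.norm_eq_sqrt_sq_add_sq]
    simp [Fin.sum_univ_two]
  rw [← hn, Complex.norm_mul_cos_arg, Complex.norm_mul_sin_arg]
  ext i
  fin_cases i <;> simp [pt]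

lemma vol_ball (x : E2) (r : ℝ) (hr : 0 ≤ r) :
    volume (Metric.ball x r) = ENNReal.ofReal (r^2 * Real.pi) := by
  rw [EuclideanSpace.volume_ball_fin_two, ENNReal.ofReal_mul (by positivity),
    ENNReal.ofReal_pow hr]

/-- covering lemma -/
lemma vol_thick_lip (g : ℝ → E2) (a b K ε : ℝ) (hab : a ≤ b) (hK : 0 < K) (hε : 0 < ε)
    (hg : ∀ u ∈ Icc a b, ∀ v ∈ Icc a b, dist (g u) (g v) ≤ K * |u - v|) :
    volume (Metric.thickening ε (g '' Icc a b)) ≤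
      ENNReal.ofReal (((b - a) * K / ε + 1) * (4 * ε^2 * Real.pi)) := by
  set n := ⌊(b - a) * K / ε⌋₊ with hn
  have hsub : Metric.thickening ε (g '' Icc a b) ⊆
      ⋃ k ∈ Finset.range (n+1), Metric.ball (g (a + k * (ε / K))) (2 * ε) := by
    intro y hy
    obtain ⟨z, ⟨u, hu, rfl⟩, hd⟩ := Metric.mem_thickening_iff.mp hy
    have h0 : 0 ≤ (u - a) * K / ε := by have := hu.1; have : 0 ≤ u - a := by linarith
                                        positivity
    have h1 : (⌊(u - a) * K / ε⌋₊ : ℝ) ≤ (u - a) * K / ε := Nat.floor_le h0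
    have h2 : (u - a) * K / ε < ⌊(u - a) * K / ε⌋₊ + 1 := Nat.lt_floor_add_one _
    have h3 : ⌊(u - a) * K / ε⌋₊ ≤ n := by
      apply Nat.floor_le_floor
      have := hu.2
      gcongr
    generalize ⌊(u - a) * K / ε⌋₊ = k at *
    rw [le_div_iff₀ hε] at h1
    rw [div_lt_iff₀ hε] at h2
    have h4 : (k:ℝ) * (ε / K) ≤ u - a := by
      rw [← mul_div_assoc, div_le_iff₀ hK]; exact h1
    have h5 : K * (u - (a + k * (ε / K))) < ε := by
      have : K * (u - (a + k * (ε / K))) = (u - a) * K - k * ε := by field_simp; ring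
      rw [this]; linarith
    have hk0 : 0 ≤ (k:ℝ) * (ε / K) := by positivity
    have h6 := hg u hu (a + k * (ε / K)) ⟨by linarith, by linarith [hu.2]⟩
    rw [abs_of_nonneg (by linarith)] at h6
    simp only [mem_iUnion]
    refine ⟨k, Finset.mem_range.mpr (by omega), ?_⟩
    rw [Metric.mem_ball]
    have := dist_triangle y (g u) (g (a + k * (ε / K)))
    linarith
  have hpi := Real.pi_pos
  calc _ ≤ _ := measure_mono hsub
    _ ≤ ∑ k ∈ Finset.range (n+1), volume (Metric.ball (g (a + k * (ε / K))) (2 * ε)) :=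
        measure_biUnion_finset_le _ _
    _ = ENNReal.ofReal ((n + 1 : ℝ) * (4 * ε^2 * Real.pi)) := by
        simp only [vol_ball _ (2 * ε) (by positivity), Finset.sum_const, Finset.card_range]
        rw [nsmul_eq_mul, ← ENNReal.ofReal_natCast, ← ENNReal.ofReal_mul (by positivity)]
        congr 1
        push_cast
        ring
    _ ≤ _ := by
        apply ENNReal.ofReal_le_ofReal
        gcongr
        apply Nat.floor_le
        have : 0 ≤ b - a := by linarith
        positivity

lemma spiral_lip (f : ℝ → ℝ) (φ₁ β C : ℝ) (hφ₁ : 1 < φ₁) (hβ0 : 0 < β) (hβ1 : β < 1)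
    (hC : 0 < C) (hd : ∀ φ ≥ φ₁, DifferentiableAt ℝ f φ)
    (hf : ∀ φ ≥ φ₁, |f φ| ≤ C * φ ^ (-β)) (hf' : ∀ φ ≥ φ₁, |deriv f φ| ≤ C * φ ^ (-β)) 
    (T : ℝ → ℝ) (T' : ℝ → ℝ) (hT : ∀ x, HasDerivAt T (T' x) x) (h1 : ∀ x, |T x| ≤ 1)
    (h2 : ∀ x, |T' x| ≤ 1) (u v : ℝ) (hu : φ₁ ^ (1 - β) ≤ u) (hv : φ₁ ^ (1 - β) ≤ v) :
    |f (u ^ (1/(1-β))) * T (u ^ (1/(1-β))) - f (v ^ (1/(1-β))) * T (v ^ (1/(1-β)))|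
      ≤ (2 * C / (1 - β)) * |u - v| := by
  have hq : 0 < 1 - β := by linarith
  have key : ∀ x ∈ Ici (φ₁ ^ (1 - β)), 0 < x ∧ φ₁ ≤ x ^ (1/(1-β)) := by
    intro x hx
    have hx' : φ₁ ^ (1 - β) ≤ x := hx
    have h0 : 0 < φ₁ ^ (1 - β) := by positivity
    refine ⟨by linarith, ?_⟩
    calc φ₁ = (φ₁ ^ (1 - β)) ^ (1/(1-β)) := by
          rw [← Real.rpow_mul (by positivity), mul_one_div_cancel hq.ne', Real.rpow_one]
      _ ≤ _ := by gcongr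
  have := Convex.norm_image_sub_le_of_norm_hasDerivWithin_le (𝕜 := ℝ) (s := Ici (φ₁ ^ (1 - β)))
    (f := fun x => f (x ^ (1/(1-β))) * T (x ^ (1/(1-β)))) (C := 2 * C / (1 - β))
    (f' := fun x => (deriv f (x ^ (1/(1-β))) * ((1/(1-β)) * x ^ (1/(1-β) - 1))) * T (x ^ (1/(1-β)))
        + f (x ^ (1/(1-β))) * (T' (x ^ (1/(1-β))) * ((1/(1-β)) * x ^ (1/(1-β) - 1))))
    (x := v) (y := u) ?_ ?_ (convex_Ici _) hv hu
  · simpa only [Real.norm_eq_abs] using this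
  · intro x hx
    obtain ⟨hx0, hx1⟩ := key x hx
    have hp : HasDerivAt (fun x : ℝ => x ^ (1/(1-β))) ((1/(1-β)) * x ^ (1/(1-β) - 1)) x :=
      Real.hasDerivAt_rpow_const (Or.inl hx0.ne')
    apply HasDerivAt.hasDerivWithinAt
    exact ((hd _ hx1).hasDerivAt.comp x hp).mul ((hT _).comp x hp)
  · intro x hx
    obtain ⟨hx0, hx1⟩ := key x hx
    rw [Real.norm_eq_abs]
    have e : (x ^ (1/(1-β))) ^ (-β) * x ^ (1/(1-β) - 1) = 1 := by
      rw [← Real.rpow_mul hx0.le, ← Real.rpow_add hx0]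
      rw [show 1 / (1 - β) * -β + (1 / (1 - β) - 1) = 0 by field_simp; ring, Real.rpow_zero]
    have hA := hf _ hx1
    have hB := hf' _ hx1
    have hC1 := h1 (x ^ (1/(1-β)))
    have hC2 := h2 (x ^ (1/(1-β)))
    have hw : 0 < x ^ (1/(1-β) - 1) := by positivity
    generalize x ^ (1/(1-β) - 1) = w at *
    generalize x ^ (1/(1-β)) = φ at *
    have hφ : 0 < φ := by linarith
    calc _ ≤ |deriv f φ * (1 / (1 - β) * w) * T φ| + |f φ * (T' φ * (1 / (1 - β) * w))| :=
          abs_add_le _ _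
      _ = |deriv f φ| * (1 / (1 - β) * w) * |T φ| + |f φ| * (|T' φ| * (1 / (1 - β) * w)) := by
          simp only [abs_mul, abs_of_pos hw, abs_of_pos (show 0 < 1 / (1 - β) by positivity)]
      _ ≤ (C * φ ^ (-β)) * (1 / (1 - β) * w) * 1 + (C * φ ^ (-β)) * (1 * (1 / (1 - β) * w)) := by
          gcongr
      _ = 2 * C / (1 - β) * (φ ^ (-β) * w) := by ring
      _ = _ := by rw [e, mul_one]

lemma vol_upper (f : ℝ → ℝ) (φ₁ β C : ℝ) (hφ₁ : 1 < φ₁) (hβ0 : 0 < β) (hβ1 : β < 1)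
    (hC : 0 < C) (hd : ∀ φ ≥ φ₁, DifferentiableAt ℝ f φ) (hpos : ∀ φ ≥ φ₁, 0 < f φ)
    (hanti : AntitoneOn f (Ici φ₁))
    (hf : ∀ φ ≥ φ₁, f φ ≤ C * φ ^ (-β)) (hf' : ∀ φ ≥ φ₁, |deriv f φ| ≤ C * φ ^ (-β)) :
    ∃ K > 0, ∀ ε, 0 < ε → ε ≤ φ₁ ^ (-(1+β)) →
      volume (Metric.thickening ε (spiralArc f (Ici φ₁))) ≤
        ENNReal.ofReal (K * ε ^ (2 * β / (1 + β))) := by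
  have hq : 0 < 1 - β := by linarith
  have hpi := Real.pi_pos
  set K := 2 * (2 * C / (1 - β)) with hK
  have hK0 : 0 < K := by positivity
  refine ⟨4 * Real.pi * K + 4 * Real.pi + Real.pi * (C+1)^2, by positivity, ?_⟩
  intro ε hε hε1
  set φ₀ := ε ^ (-(1/(1+β))) with hφ₀
  have h0pos : 0 < φ₀ := by positivity
  have h01 : φ₁ ≤ φ₀ := by
    calc φ₁ = (φ₁ ^ (-(1+β))) ^ (-(1/(1+β))) := by
          rw [← Real.rpow_mul (by positivity), show -(1+β) * -(1/(1+β)) = 1 by field_simp,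
            Real.rpow_one]
      _ ≤ _ := Real.rpow_le_rpow_of_nonpos hε hε1 (by rw [neg_nonpos]; positivity)
  have hεle1 : ε ≤ 1 := hε1.trans (Real.rpow_le_one_of_one_le_of_nonpos hφ₁.le (by linarith))
  set e := ε ^ (β/(1+β)) with he
  have he0 : 0 < e := by positivity
  have hee : ε ^ (2 * β / (1 + β)) = e^2 := by
    rw [he, ← Real.rpow_mul_natCast hε.le]; congr 1; push_cast; ring
  have hεe : ε ≤ e := by
    rw [he]
    conv_lhs => rw [← Real.rpow_one ε]
    apply Real.rpow_le_rpow_of_exponent_ge hε hεle1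
    rw [div_le_one (by positivity)]; linarith
  have e1 : φ₀ ^ (-β) = e := by
    rw [hφ₀, he, ← Real.rpow_mul hε.le]; congr 1; field_simp
  have e2 : φ₀ ^ (1 - β) * ε = e^2 := by
    rw [hφ₀, ← hee, ← Real.rpow_mul hε.le]
    conv_lhs => rw [← Real.rpow_one ε]
    rw [← Real.rpow_mul hε.le, ← Real.rpow_add hε]; congr 1; field_simp; ring
  set g : ℝ → E2 := fun u => pt (f (u ^ (1/(1-β))) * Real.cos (u ^ (1/(1-β))))
    (f (u ^ (1/(1-β))) * Real.sin (u ^ (1/(1-β)))) with hg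
  have habs : ∀ φ ≥ φ₁, |f φ| ≤ C * φ ^ (-β) := fun φ h => by
    rw [abs_of_pos (hpos φ h)]; exact hf φ h
  have hsub : spiralArc f (Ici φ₁) ⊆ g '' Icc (φ₁ ^ (1-β)) (φ₀ ^ (1-β)) ∪ closedBall 0 (f φ₀) := by
    rintro _ ⟨φ, hφ, rfl⟩
    have hφ' : φ₁ ≤ φ := hφ
    have hφ0 : 0 < φ := by linarith
    rcases le_total φ φ₀ with h | h
    · left
      refine ⟨φ ^ (1-β), ⟨by gcongr, by gcongr⟩, ?_⟩
      have : (φ ^ (1-β)) ^ (1/(1-β)) = φ := by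
        rw [← Real.rpow_mul hφ0.le, mul_one_div_cancel hq.ne', Real.rpow_one]
      simp only [hg, this]
    · right
      rw [mem_closedBall_zero_iff]
      dsimp only
      rw [norm_pt_polar _ _ (hpos φ hφ').le]
      exact hanti (mem_Ici.mpr h01) hφ h
  have hv1 := vol_thick_lip g (φ₁ ^ (1-β)) (φ₀ ^ (1-β)) K ε (by gcongr) hK0 hε (by
    intro u hu v hv
    have hc := spiral_lip f φ₁ β C hφ₁ hβ0 hβ1 hC hd habs hf' Real.cos (fun x => - Real.sin x)
      Real.hasDerivAt_cos Real.abs_cos_le_one (fun x => by rw [abs_neg]; exact Real.abs_sin_le_one x)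
      u v hu.1 hv.1
    have hs := spiral_lip f φ₁ β C hφ₁ hβ0 hβ1 hC hd habs hf' Real.sin Real.cos
      Real.hasDerivAt_sin Real.abs_sin_le_one Real.abs_cos_le_one u v hu.1 hv.1
    refine (dist_pt_le _ _ _ _).trans ?_
    rw [hK]; linarith)
  have hf0 := hpos φ₀ h01
  have hv2 : volume (Metric.thickening ε (closedBall (0:E2) (f φ₀))) ≤
      ENNReal.ofReal ((f φ₀ + ε)^2 * Real.pi) := by
    rw [← vol_ball 0 (f φ₀ + ε) (by positivity)]
    apply measure_mono
    intro y hy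
    obtain ⟨z, hz, hd⟩ := Metric.mem_thickening_iff.mp hy
    rw [mem_closedBall] at hz
    rw [mem_ball]
    linarith [dist_triangle y z 0]
  calc _ ≤ _ := measure_mono (Metric.thickening_subset_of_subset ε hsub)
    _ ≤ _ := by rw [Metric.thickening_union]; exact measure_union_le _ _
    _ ≤ _ := add_le_add hv1 hv2
    _ = ENNReal.ofReal (((φ₀ ^ (1-β) - φ₁ ^ (1-β)) * K / ε + 1) * (4 * ε^2 * Real.pi)
          + (f φ₀ + ε)^2 * Real.pi) := by
        rw [ENNReal.ofReal_add _ (by positivity)]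
        have : 0 ≤ φ₀ ^ (1-β) - φ₁ ^ (1-β) := by
          rw [sub_nonneg]; gcongr
        positivity
    _ ≤ _ := by
        apply ENNReal.ofReal_le_ofReal
        rw [hee]
        have hfe : f φ₀ ≤ C * e := by rw [← e1]; exact hf _ h01
        have t1 : (f φ₀ + ε)^2 * Real.pi ≤ (C * e + e)^2 * Real.pi := by gcongr
        have t2 : ((φ₀ ^ (1-β) - φ₁ ^ (1-β)) * K / ε + 1) * (4 * ε^2 * Real.pi)
            ≤ (φ₀ ^ (1-β) * K / ε + 1) * (4 * ε^2 * Real.pi) := by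
          gcongr
          have : 0 < φ₁ ^ (1-β) := by positivity
          linarith
        have t3 : (φ₀ ^ (1-β) * K / ε + 1) * (4 * ε^2 * Real.pi)
            = 4 * Real.pi * K * (φ₀ ^ (1-β) * ε) + 4 * Real.pi * ε^2 := by field_simp
        have t4 : 4 * Real.pi * ε^2 ≤ 4 * Real.pi * e^2 := by gcongr
        rw [t3, e2] at t2
        nlinarith

lemma log_pow_le (l : ℕ) (δ : ℝ) (hδ : 0 < δ) : ∃ C > 0, ∀ x ≥ (1:ℝ), Real.log x ^ l ≤ C * x ^ δ := by
  have hl : (0:ℝ) < l + 1 := by positivity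
  have hη : 0 < δ / (l + 1) := by positivity
  refine ⟨(1/(δ / (l + 1)))^l, by positivity, fun x hx => ?_⟩
  have hx0 : 0 < x := by linarith
  have h1 := Real.log_le_rpow_div hx0.le hη
  calc Real.log x ^ l ≤ (x ^ (δ/(l+1)) / (δ/(l+1)))^l := by
        apply pow_le_pow_left₀ (Real.log_nonneg hx) h1
    _ = (1/(δ / (l + 1)))^l * (x ^ (δ/(l+1)))^l := by rw [← mul_pow]; congr 1; ring
    _ ≤ _ := by
        gcongr
        rw [← Real.rpow_mul_natCast hx0.le]
        apply Real.rpow_le_rpow_of_exponent_le hx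
        rw [div_mul_eq_mul_div, div_le_iff₀ hl]
        nlinarith

/-- the radial neighbourhood contains a punctured ball. -/
lemma ball_subset_ray (f : ℝ → ℝ) (φ₁ Φ ε : ℝ) (hΦ : φ₁ ≤ Φ)
    (hpos : ∀ φ ≥ φ₁, 0 < f φ) (hanti : AntitoneOn f (Ici φ₁))
    (hlim : Tendsto f atTop (𝓝 0))
    (hdiff : ∀ φ ≥ Φ, f φ - f (φ + 2 * Real.pi) ≤ ε) :
    ball (0:E2) (f (Φ + 2 * Real.pi)) \ {0} ⊆ rayNbhd ε (spiralArc f (Ici φ₁)) := by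
  rintro y ⟨hy, hy0⟩
  have hpi := Real.two_pi_pos
  rw [mem_ball_zero_iff] at hy
  have hr : 0 < ‖y‖ := norm_pos_iff.mpr hy0
  obtain ⟨θ₀, hθ₀⟩ := exists_polar y
  obtain ⟨N, hN, -⟩ := existsUnique_add_zsmul_mem_Ico Real.two_pi_pos θ₀ Φ
  rw [zsmul_eq_mul] at hN
  set θ := θ₀ + N * (2 * Real.pi) with hθdef
  have hθ : y = pt (‖y‖ * Real.cos θ) (‖y‖ * Real.sin θ) := by
    rw [hθdef, Real.cos_add_int_mul_two_pi, Real.sin_add_int_mul_two_pi]; exact hθ₀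
  have hex : ∃ k : ℕ, f (θ + k * (2 * Real.pi)) ≤ ‖y‖ := by
    have ht : Tendsto (fun k : ℕ => θ + k * (2 * Real.pi)) atTop atTop :=
      tendsto_atTop_add_const_left _ _ (tendsto_natCast_atTop_atTop.atTop_mul_const hpi)
    have := (hlim.comp ht).eventually (gt_mem_nhds hr)
    obtain ⟨k, hk⟩ := this.exists
    exact ⟨k, le_of_lt hk⟩
  classical
  set k := Nat.find hex with hk
  have hk1 : f (θ + k * (2 * Real.pi)) ≤ ‖y‖ := Nat.find_spec hex
  have hk0 : k ≠ 0 := by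
    intro h
    rw [h] at hk1
    simp only [Nat.cast_zero, zero_mul, add_zero] at hk1
    have := hanti (show θ ∈ Ici φ₁ from hΦ.trans hN.1)
      (show Φ + 2 * Real.pi ∈ Ici φ₁ by rw [mem_Ici]; linarith) hN.2.le
    linarith
  obtain ⟨j, hj⟩ := Nat.exists_eq_succ_of_ne_zero hk0
  have hj1 : ‖y‖ < f (θ + j * (2 * Real.pi)) := by
    have := Nat.find_min hex (m := j) (by omega)
    exact not_le.mp this
  have hjge : Φ ≤ θ + j * (2 * Real.pi) := by
    have : (0:ℝ) ≤ j * (2 * Real.pi) := by positivity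
    linarith [hN.1]
  have hd := hdiff _ hjge
  have hkj : θ + j * (2 * Real.pi) + 2 * Real.pi = θ + k * (2 * Real.pi) := by
    rw [hj]; push_cast; ring
  rw [hkj] at hd
  have hkge : φ₁ ≤ θ + k * (2 * Real.pi) := by linarith
  have hfk := hpos _ hkge
  have hz : pt (f (θ + k * (2 * Real.pi)) * Real.cos (θ + k * (2 * Real.pi)))
      (f (θ + k * (2 * Real.pi)) * Real.sin (θ + k * (2 * Real.pi))) =
      (f (θ + k * (2 * Real.pi)) / ‖y‖) • y := by
    rw [Real.cos_add_nat_mul_two_pi, Real.sin_add_nat_mul_two_pi]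
    generalize f (θ + k * (2 * Real.pi)) = w
    have h0 : y 0 = ‖y‖ * Real.cos θ := by
      conv_lhs => rw [hθ]
      rw [pt_apply0]
    have h1 : y 1 = ‖y‖ * Real.sin θ := by
      conv_lhs => rw [hθ]
      rw [pt_apply1]
    ext i
    fin_cases i
    · simp only [Fin.zero_eta, Fin.isValue, PiLp.smul_apply, smul_eq_mul, h0, pt_apply0]
      field_simp
    · simp only [Fin.mk_one, Fin.isValue, PiLp.smul_apply, smul_eq_mul, h1, pt_apply1]
      field_simp
  refine ⟨_, ⟨_, hkge, rfl⟩, ⟨_, by positivity, hz⟩, ?_⟩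
  dsimp only
  rw [hz, dist_eq_norm]
  generalize f (θ + k * (2 * Real.pi)) = w at *
  have : y - (w / ‖y‖) • y = (1 - w/‖y‖) • y := by rw [sub_smul, one_smul]
  rw [this, norm_smul, Real.norm_eq_abs, abs_of_nonneg (by
    rw [sub_nonneg, div_le_one hr]; exact hk1), sub_mul, div_mul_cancel₀ _ hr.ne']
  linarith

lemma sInf_dim (d : ℝ) (m : ℝ → ℝ≥0∞) (hd : 0 ≤ d) (h1 : ∀ s, d < s → m s = 0)
    (h2 : ∀ s, s ≤ d → m s ≠ 0) : sInf {s : ℝ | 0 ≤ s ∧ m s = 0} = d := by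
  have : {s : ℝ | 0 ≤ s ∧ m s = 0} = Ioi d := by
    ext s
    constructor
    · rintro ⟨-, h⟩
      by_contra hs
      exact h2 s (not_lt.mp hs) h
    · intro hs
      exact ⟨hd.trans (le_of_lt hs), h1 s hs⟩
  rw [this, csInf_Ioi]

lemma rad_lower (φ₁ α : ℝ) (l : ℕ) (hl : 1 ≤ l) (f : ℝ → ℝ)
    (hφ₁ : Real.exp 1 < φ₁) (hα0 : 0 < α) (hα1 : α < 1)
    (hpos : ∀ φ ≥ φ₁, 0 < f φ) (hanti : AntitoneOn f (Ici φ₁)) (hlim : Tendsto f atTop (𝓝 0))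
    (mlo ahi : ℝ) (hmlo : 0 < mlo) (hahi : 0 < ahi)
    (hf : ∀ φ ≥ φ₁, mlo * φ ^ (-α) * Real.log φ ^ l ≤ f φ)
    (hdiff : ∀ φ ≥ φ₁, f φ - f (φ + 2 * Real.pi) ≤ ahi * φ ^ (-α-1) * Real.log φ ^ l)
    (s : ℝ) (hs : s ≤ 2/(1+α)) :
    radLowerMink s (spiralArc f (Ici φ₁)) = ⊤ := by
  have he1 : (2:ℝ) < Real.exp 1 := by have := Real.exp_one_gt_d9; linarith
  have hpi := Real.pi_pos
  have hl0 : (0:ℝ) < l := by exact_mod_cast hl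
  set a := (1+α)/l with ha
  have ha0 : 0 < a := by positivity
  set X0 := max φ₁ (Real.exp a⁻¹) with hX0
  set g : ℝ → ℝ := fun x => ahi * x ^ (-α-1) * Real.log x ^ l with hg
  have hgeq : ∀ x > 0, g x = ahi * (Real.log x / x ^ a) ^ l := by
    intro x hx
    have : (x ^ a) ^ l = x ^ (1+α) := by
      rw [← Real.rpow_mul_natCast hx.le, ha]; congr 1; field_simp
    rw [hg]
    dsimp only
    rw [div_pow, this, show -α-1 = -(1+α) by ring, Real.rpow_neg hx.le]
    ring
  have hXpos : ∀ x ≥ X0, 0 < x ∧ φ₁ ≤ x := fun x hx => by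
    have := (le_max_left φ₁ (Real.exp a⁻¹)).trans hx
    exact ⟨by linarith, this⟩
  have hlogge : ∀ x ≥ X0, 1 ≤ Real.log x := fun x hx => by
    have := hXpos x hx
    rw [Real.le_log_iff_exp_le this.1]; linarith
  have hganti : AntitoneOn g (Ici X0) := by
    intro x hx y hy hxy
    obtain ⟨hx0, hx1⟩ := hXpos x hx
    obtain ⟨hy0, hy1⟩ := hXpos y hy
    have := Real.log_div_self_rpow_antitoneOn ha0
      (show x ∈ Ici (Real.exp a⁻¹) from mem_Ici.mpr ((le_max_right φ₁ (Real.exp a⁻¹)).trans (mem_Ici.mp hx)))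
      (show y ∈ Ici (Real.exp a⁻¹) from mem_Ici.mpr ((le_max_right φ₁ (Real.exp a⁻¹)).trans (mem_Ici.mp hy))) hxy
    have hly := hlogge y hy
    rw [hgeq x hx0, hgeq y hy0]
    dsimp only at this
    gcongr
  have hgcont : ContinuousOn g (Ici X0) := by
    intro x hx
    obtain ⟨hx0, hx1⟩ := hXpos x hx
    apply ContinuousAt.continuousWithinAt
    exact (continuousAt_const.mul (Real.continuousAt_rpow_const _ _ (Or.inl hx0.ne'))).mul
      ((Real.continuousAt_log hx0.ne').pow l)
  have hglim : Tendsto g atTop (𝓝 0) := by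
    have h1 : Tendsto (fun x : ℝ => Real.log x / x ^ a) atTop (𝓝 0) :=
      (isLittleO_log_rpow_atTop ha0).tendsto_div_nhds_zero
    have h2 := (h1.pow l).const_mul ahi
    rw [zero_pow (by omega), mul_zero] at h2
    refine h2.congr' ?_
    filter_upwards [eventually_gt_atTop 0] with x hx using (hgeq x hx).symm
  set κ := 2 * α / (1 + α) with hκ
  have hκ0 : 0 < κ := by positivity
  have hκ1 : κ ≤ 1 := by rw [hκ, div_le_one (by positivity)]; linarith
  set c0 := mlo * 5 ^ (-α) with hc0
  have hc0p : 0 < c0 := by positivity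
  set c := Real.pi * c0^2 / ahi ^ κ with hc
  have hcp : 0 < c := by positivity
  have main : ∀ X ≥ X0, ∀ ε, 0 < ε → ε ≤ g X → ε ≤ 1 →
      ENNReal.ofReal (c * Real.log X) * ENNReal.ofReal (ε ^ (2 - s)) ≤
        volume (rayNbhd ε (spiralArc f (Ici φ₁))) := by
    intro X hX ε hε hεX hε1
    obtain ⟨Y, hYX, hY⟩ : ∃ Y ≥ X, g Y < ε := by
      have := (hglim.eventually (gt_mem_nhds hε)).and (eventually_ge_atTop X)
      obtain ⟨Y, h1, h2⟩ := this.exists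
      exact ⟨Y, h2, h1⟩
    obtain ⟨Φ, hΦ, hΦε⟩ := intermediate_value_Icc' hYX
      (hgcont.mono (fun z hz => hX.trans hz.1)) ⟨hY.le, hεX⟩
    have hΦX : X ≤ Φ := hΦ.1
    have hΦX0 : X0 ≤ Φ := hX.trans hΦX
    obtain ⟨hΦ0, hΦ1⟩ := hXpos Φ hΦX0
    have hL := hlogge Φ hΦX0
    have hball := ball_subset_ray f φ₁ Φ ε hΦ1 hpos hanti hlim (by
      intro φ hφ
      rw [← hΦε]
      exact (hdiff φ (hΦ1.trans hφ)).trans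
        (hganti (show Φ ∈ Ici X0 from hΦX0) (show φ ∈ Ici X0 from hΦX0.trans hφ) hφ))
    have h2pi := Real.two_pi_pos
    have hge2 : φ₁ ≤ Φ + 2 * Real.pi := by linarith
    have hflow : c0 * Φ ^ (-α) * Real.log Φ ^ l ≤ f (Φ + 2 * Real.pi) := by
      refine le_trans ?_ (hf _ hge2)
      have h5 : Φ + 2 * Real.pi ≤ 5 * Φ := by
        have := Real.pi_le_four
        linarith
      have : (5:ℝ) ^ (-α) * Φ ^ (-α) ≤ (Φ + 2 * Real.pi) ^ (-α) := by
        rw [← Real.mul_rpow (by norm_num) hΦ0.le]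
        exact Real.rpow_le_rpow_of_nonpos (by positivity) h5 (by linarith)
      rw [hc0, mul_assoc mlo]
      gcongr
      linarith
    have hεκ : ε ^ (2 - s) ≤ ahi ^ κ * (Φ ^ (-α))^2 * Real.log Φ ^ l := by
      calc ε ^ (2 - s) ≤ ε ^ κ := by
            apply Real.rpow_le_rpow_of_exponent_ge hε hε1
            have : κ = 2 - 2/(1+α) := by rw [hκ]; field_simp; ring
            rw [this]; linarith
        _ = ahi ^ κ * (Φ ^ (-α-1)) ^ κ * (Real.log Φ ^ l) ^ κ := by
            rw [← hΦε, hg]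
            dsimp only
            rw [Real.mul_rpow (by positivity) (by positivity),
              Real.mul_rpow (by positivity) (by positivity)]
        _ ≤ _ := by
            have e1 : (Φ ^ (-α-1)) ^ κ = (Φ ^ (-α))^2 := by
              rw [← Real.rpow_mul hΦ0.le, ← Real.rpow_mul_natCast hΦ0.le]
              congr 1; rw [hκ]; push_cast; field_simp; ring
            rw [e1]
            gcongr
            calc (Real.log Φ ^ l) ^ κ ≤ (Real.log Φ ^ l) ^ (1:ℝ) :=
                  Real.rpow_le_rpow_of_exponent_le (one_le_pow₀ hL) hκ1
              _ = _ := Real.rpow_one _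
    have hlogX : Real.log X ≤ Real.log Φ ^ l := by
      calc Real.log X ≤ Real.log Φ := Real.log_le_log (hXpos X hX).1 hΦX
        _ = Real.log Φ ^ 1 := (pow_one _).symm
        _ ≤ _ := pow_le_pow_right₀ hL hl
    have hlX0 : 0 ≤ Real.log X := by linarith [hlogge X hX]
    calc _ = ENNReal.ofReal (c * Real.log X * ε ^ (2 - s)) :=
          (ENNReal.ofReal_mul (by positivity)).symm
      _ ≤ ENNReal.ofReal ((f (Φ + 2 * Real.pi))^2 * Real.pi) := by
          apply ENNReal.ofReal_le_ofReal
          calc c * Real.log X * ε ^ (2 - s)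
              ≤ c * Real.log Φ ^ l * (ahi ^ κ * (Φ ^ (-α))^2 * Real.log Φ ^ l) := by gcongr
            _ = (c0 * Φ ^ (-α) * Real.log Φ ^ l)^2 * Real.pi := by
                rw [hc]; field_simp
            _ ≤ _ := by gcongr
      _ = volume (ball (0:E2) (f (Φ + 2 * Real.pi)) \ {0}) := by
          rw [measure_sdiff_null (measure_singleton _), vol_ball _ _ (hpos _ hge2).le]
      _ ≤ _ := measure_mono hball
  apply ENNReal.eq_top_of_forall_nnreal_le
  intro r
  set X := max X0 (Real.exp (r / c)) with hX
  have hXX0 : X0 ≤ X := le_max_left _ _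
  have hrX : (r:ℝ) ≤ c * Real.log X := by
    have : (r:ℝ) / c ≤ Real.log X := by
      rw [Real.le_log_iff_exp_le (hXpos X hXX0).1]; exact le_max_right _ _
    rw [div_le_iff₀ hcp] at this
    linarith
  have hgX : 0 < g X := by
    have h1 := (hXpos X hXX0).1
    have h2 := hlogge X hXX0
    rw [hg]; positivity
  apply le_liminf_of_le
  · isBoundedDefault
  filter_upwards [Ioc_mem_nhdsGT (lt_min hgX one_pos)] with ε hε
  have hε0 : 0 < ε := hε.1
  have hp : 0 < ε ^ (2 - s) := by positivity
  rw [ENNReal.le_div_iff_mul_le (Or.inl (by simpa using hp)) (Or.inl ENNReal.ofReal_ne_top)]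
  refine le_trans ?_ (main X hXX0 ε hε.1 (hε.2.trans (min_le_left _ _)) (hε.2.trans (min_le_right _ _)))
  gcongr
  rw [← ENNReal.ofReal_coe_nnreal]
  exact ENNReal.ofReal_le_ofReal hrX

/-- **Theorem (modified Theorem 5 from [zuzu])**: for a decreasing `C²` function `f` with
two-sided power-log bounds on `f`, on `f(φ) - f(φ+2π)` and on `|f'|`, the spiral `r = f(φ)`
satisfies `dim_B Γ = dim_B(Γ,rad) = d = 2/(1+α)` and `M^{*d}(Γ) = M^{*d}(Γ,rad) = +∞`. -/
theorem spiral_dimension_log_degenerate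
    (φ₁ α : ℝ) (l : ℕ) (hl : 1 ≤ l) (f : ℝ → ℝ)
    (hφ₁ : Real.exp 1 < φ₁)
    (hα : α ∈ Set.Ioo (0:ℝ) 1)
    (hf_pos : ∀ φ ≥ φ₁, 0 < f φ)
    (hf_dec : StrictAntiOn f (Set.Ici φ₁))
    (hf_C2 : ContDiffOn ℝ 2 f (Set.Ici φ₁))
    (mlo mhi alo ahi M₁ M₂ : ℝ)
    (hmlo : 0 < mlo) (hmhi : 0 < mhi) (halo : 0 < alo) (hahi : 0 < ahi)
    (hM₁ : 0 < M₁) (hM₂ : 0 < M₂)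
    (hf_bd : ∀ φ ≥ φ₁,
      mlo * φ ^ (-α) * Real.log φ ^ l ≤ f φ ∧ f φ ≤ mhi * φ ^ (-α) * Real.log φ ^ l)
    (hf_diff_bd : ∀ φ ≥ φ₁,
      alo * φ ^ (-α-1) * Real.log φ ^ l ≤ f φ - f (φ + 2 * Real.pi) ∧
      f φ - f (φ + 2 * Real.pi) ≤ ahi * φ ^ (-α-1) * Real.log φ ^ l)
    (hf'_bd : ∀ φ ≥ φ₁,
      M₁ * φ ^ (-α-1) * Real.log φ ^ l ≤ |deriv f φ| ∧
      |deriv f φ| ≤ M₂ * φ ^ (-α-1) * Real.log φ ^ l) :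
    dimBEq (spiralArc f (Set.Ici φ₁)) (2/(1+α)) ∧
    radDimBEq (spiralArc f (Set.Ici φ₁)) (2/(1+α)) ∧
    upperMink (2/(1+α)) (spiralArc f (Set.Ici φ₁)) = ⊤ ∧
    radUpperMink (2/(1+α)) (spiralArc f (Set.Ici φ₁)) = ⊤ := by
  obtain ⟨hα0, hα1⟩ := hα
  have he1 : (2:ℝ) < Real.exp 1 := by have := Real.exp_one_gt_d9; linarith
  have hφ1 : 1 < φ₁ := by linarith
  have hlogge : ∀ φ ≥ φ₁, 1 ≤ Real.log φ := fun φ hφ => by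
    rw [Real.le_log_iff_exp_le (by linarith)]; linarith
  have hd : ∀ φ ≥ φ₁, DifferentiableAt ℝ f φ := by
    intro φ hφ
    by_contra h
    have h1 := (hf'_bd φ hφ).1
    rw [deriv_zero_of_not_differentiableAt h, abs_zero] at h1
    have h2 := hlogge φ hφ
    have h3 : 0 < φ := by linarith
    have : 0 < M₁ * φ ^ (-α-1) * Real.log φ ^ l := by positivity
    linarith
  have hanti : AntitoneOn f (Ici φ₁) := hf_dec.antitoneOn
  -- power bounds
  have hpow : ∀ β, 0 < β → β < α → ∃ C > 0, (∀ φ ≥ φ₁, f φ ≤ C * φ ^ (-β)) ∧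
      (∀ φ ≥ φ₁, |deriv f φ| ≤ C * φ ^ (-β)) := by
    intro β hβ0 hβ
    obtain ⟨C, hC, hCl⟩ := log_pow_le l (α - β) (by linarith)
    have key : ∀ φ ≥ φ₁, φ ^ (-α) * Real.log φ ^ l ≤ C * φ ^ (-β) := by
      intro φ hφ
      have h0 : 0 < φ := by linarith
      calc φ ^ (-α) * Real.log φ ^ l ≤ φ ^ (-α) * (C * φ ^ (α - β)) := by
            gcongr
            exact hCl φ (by linarith)
        _ = C * (φ ^ (-α) * φ ^ (α - β)) := by ring
        _ = _ := by rw [← Real.rpow_add h0]; congr 2; ring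
    refine ⟨(mhi + M₂) * C, by positivity, fun φ hφ => ?_, fun φ hφ => ?_⟩
    · have h0 : 0 < φ := by linarith
      have h1 := key φ hφ
      have h2 := (hf_bd φ hφ).2
      have h3 : 0 < C * φ ^ (-β) := by positivity
      nlinarith [mul_le_mul_of_nonneg_left h1 hmhi.le]
    · have h0 : 0 < φ := by linarith
      have h1 := key φ hφ
      have h2 := (hf'_bd φ hφ).2
      have h3 : 0 < C * φ ^ (-β) := by positivity
      have h4 : φ ^ (-α-1) * Real.log φ ^ l ≤ φ ^ (-α) * Real.log φ ^ l := by
        have := hlogge φ hφ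
        gcongr
        · linarith
        · linarith
      nlinarith [mul_le_mul_of_nonneg_left (h4.trans h1) hM₂.le]
  have hlim : Tendsto f atTop (𝓝 0) := by
    obtain ⟨C, hC, h, -⟩ := hpow (α/2) (by linarith) (by linarith)
    have ht : Tendsto (fun φ : ℝ => C * φ ^ (-(α/2))) atTop (𝓝 0) := by
      simpa using (tendsto_rpow_neg_atTop (y := α/2) (by linarith)).const_mul C
    refine squeeze_zero' ?_ ?_ ht
    · filter_upwards [eventually_ge_atTop φ₁] with φ hφ using (hf_pos φ hφ).le
    · filter_upwards [eventually_ge_atTop φ₁] with φ hφ using h φ hφ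
  have hup : ∀ s, 2/(1+α) < s → upperMink s (spiralArc f (Ici φ₁)) = 0 := by
    intro s hs
    have hs0 : 0 < s := lt_trans (by positivity) hs
    have h1 : 2/s - 1 < α := by
      rw [div_lt_iff₀ (by positivity)] at hs
      rw [sub_lt_iff_lt_add, div_lt_iff₀ hs0]; linarith
    obtain ⟨β, hβ1, hβ2⟩ := exists_between (max_lt hα0 h1)
    have hβ0 : 0 < β := (le_max_left _ _).trans_lt hβ1
    have hβs : 2/s - 1 < β := (le_max_right _ _).trans_lt hβ1
    obtain ⟨C, hC, hb1, hb2⟩ := hpow β hβ0 hβ2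
    obtain ⟨K, hK, hvol⟩ := vol_upper f φ₁ β C hφ1 hβ0 (by linarith) hC hd hf_pos hanti hb1 hb2
    have hexp : 0 < 2 * β / (1 + β) - (2 - s) := by
      rw [sub_lt_iff_lt_add, div_lt_iff₀ hs0] at hβs
      have : 2 * β / (1 + β) - (2 - s) = ((β + 1) * s - 2) / (1 + β) := by field_simp; ring
      rw [this]
      apply div_pos <;> linarith
    apply Tendsto.limsup_eq
    have ht : Tendsto (fun ε : ℝ => ENNReal.ofReal (K * ε ^ (2 * β / (1 + β) - (2 - s))))
        (𝓝[>] (0:ℝ)) (𝓝 0) := by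
      rw [← ENNReal.ofReal_zero]
      apply ENNReal.tendsto_ofReal
      have h := ((Real.continuous_rpow_const hexp.le).tendsto (0:ℝ)).const_mul K
      rw [Real.zero_rpow hexp.ne', mul_zero] at h
      exact h.mono_left nhdsWithin_le_nhds
    refine tendsto_of_tendsto_of_tendsto_of_le_of_le' tendsto_const_nhds ht
      (Eventually.of_forall fun _ => zero_le) ?_
    have hthr : 0 < φ₁ ^ (-(1+β)) := by positivity
    filter_upwards [Ioc_mem_nhdsGT hthr] with ε hε
    have hε0 : 0 < ε := hε.1
    have hp : 0 < ε ^ (2 - s) := by positivity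
    apply ENNReal.div_le_of_le_mul
    rw [← ENNReal.ofReal_mul (by positivity), mul_assoc, ← Real.rpow_add hε0, sub_add_cancel]
    exact hvol ε hε.1 hε.2
  have hlow := rad_lower φ₁ α l hl f hφ₁ hα0 hα1 hf_pos hanti hlim mlo ahi hmlo hahi
    (fun φ hφ => (hf_bd φ hφ).1) (fun φ hφ => (hf_diff_bd φ hφ).2)
  set Γ := spiralArc f (Ici φ₁) with hΓ
  have hle : ∀ s ε : ℝ, volume (rayNbhd ε Γ) / ENNReal.ofReal (ε ^ (2 - s)) ≤
      volume (Metric.thickening ε Γ) / ENNReal.ofReal (ε ^ (2 - s)) := fun s ε =>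
    ENNReal.div_le_div_right (measure_mono (rayNbhd_subset_thickening ε Γ)) _
  have i1 : ∀ s, radLowerMink s Γ ≤ radUpperMink s Γ := fun s => liminf_le_limsup
  have i2 : ∀ s, radLowerMink s Γ ≤ lowerMink s Γ := fun s =>
    liminf_le_liminf (Eventually.of_forall (hle s))
  have i3 : ∀ s, lowerMink s Γ ≤ upperMink s Γ := fun s => liminf_le_limsup
  have i4 : ∀ s, radUpperMink s Γ ≤ upperMink s Γ := fun s =>
    limsup_le_limsup (Eventually.of_forall (hle s))
  have hd0 : 0 ≤ 2/(1+α) := by positivity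
  have nt : ∀ x : ℝ≥0∞, ⊤ ≤ x → x ≠ 0 := fun x hx h => by simp [h] at hx
  refine ⟨⟨?_, ?_⟩, ⟨?_, ?_⟩, ?_, ?_⟩
  · exact sInf_dim _ (fun s => lowerMink s Γ) hd0
      (fun s hs => le_antisymm ((i3 s).trans (hup s hs).le) zero_le)
      (fun s hs => nt _ ((hlow s hs).ge.trans (i2 s)))
  · exact sInf_dim _ (fun s => upperMink s Γ) hd0 hup
      (fun s hs => nt _ ((hlow s hs).ge.trans ((i2 s).trans (i3 s))))
  · exact sInf_dim _ (fun s => radLowerMink s Γ) hd0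
      (fun s hs => le_antisymm (((i2 s).trans (i3 s)).trans (hup s hs).le) zero_le)
      (fun s hs => nt _ (hlow s hs).ge)
  · exact sInf_dim _ (fun s => radUpperMink s Γ) hd0
      (fun s hs => le_antisymm ((i4 s).trans (hup s hs).le) zero_le)
      (fun s hs => nt _ ((hlow s hs).ge.trans (i1 s)))
  · exact top_le_iff.mp ((hlow _ le_rfl).ge.trans ((i2 _).trans (i3 _)))
  · exact top_le_iff.mp ((hlow _ le_rfl).ge.trans (i1 _))
end
end
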